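/- Let k > 2 be a fixed real number and let q be a large integer such that every Dirichlet L-function modulo q satisfies the Riemann Hypothesis. Then there are constants C and D depending only on k such that for all real y with 1 ≤ y ≤ q^{1/2}, one has ∑_{χ ∈ X_q^*} |∑_{n ≤ q/y} χ(n)|^{2k} ≤ C · φ(q) · (q/y)^k · (log 2y)^D. -/

import Mathlib

open Complex Real Finset

def dirichletRH {q : ℕ} [NeZero q] (χ : DirichletCharacter ℂ q) : Prop :=
  ∀ s : ℂ, 0 < s.re → s.re < 1 → DirichletCharacter.LFunction χ s = 0 → s.re = 1 / 2


lemma log_branch {U : Set ℂ} (hU : IsOpen U) (hc : Convex ℝ U) (hne : U.Nonempty) {f : ℂ → ℂ}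
    (hf : DifferentiableOn ℂ f U) (h0 : ∀ z ∈ U, f z ≠ 0) :
    ∃ g : ℂ → ℂ, DifferentiableOn ℂ g U ∧ ∀ z ∈ U, Complex.exp (g z) = f z := by
  have hsc : IsSimplyConnected U := by
    have := hc.contractibleSpace hne
    change SimplyConnectedSpace U
    infer_instance
  obtain ⟨g, hg, hge⟩ := exists_continuousOn_eqOn_exp_comp hsc hU hf.continuousOn
    (by rintro ⟨z, hz, h⟩; exact h0 z hz h)
  have hge' : ∀ z ∈ U, Complex.exp (g z) = f z := fun z hz => hge hz
  refine ⟨g, fun z hz => DifferentiableAt.differentiableWithinAt ?_, hge'⟩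
  have hcont : ContinuousAt g z := hg.continuousAt (hU.mem_nhds hz)
  have hfd : DifferentiableAt ℂ f z := hf.differentiableAt (hU.mem_nhds hz)
  have h1 : ∀ᶠ w in nhds z, ‖g w - g z‖ < 1 := by
    have := Metric.tendsto_nhds.1 hcont 1 one_pos
    simpa [dist_eq_norm] using this
  have h2 : g =ᶠ[nhds z] fun w => g z + Complex.log (f w / f z) := by
    filter_upwards [h1, hU.mem_nhds hz] with w hw hwU
    rw [← hge' w hwU, ← hge' z hz, ← Complex.exp_sub, Complex.log_exp]
    · ring
    · have := (abs_le.1 ((Complex.abs_im_le_norm (g w - g z)).trans hw.le)).1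
      linarith [Real.pi_gt_three]
    · have := (abs_le.1 ((Complex.abs_im_le_norm (g w - g z)).trans hw.le)).2
      linarith [Real.pi_gt_three]
  refine DifferentiableAt.congr_of_eventuallyEq ?_ h2
  refine (DifferentiableAt.clog (hfd.div_const _) ?_).const_add _
  rw [div_self (h0 z hz)]; simp

/-- removing zeros -/
lemma remove_zeros {R r : ℝ} (hr : 0 < r) (hrR : r < R) {U : Set ℂ} (hU : IsOpen U)
    (hsub : Metric.closedBall (0:ℂ) R ⊆ U) {B : ℝ} (N : ℕ) :
    ∀ f : ℂ → ℂ, DifferentiableOn ℂ f U → (∀ z ∈ Metric.closedBall (0:ℂ) R, ‖f z‖ ≤ B) →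
      f 0 ≠ 0 → B ≤ ‖f 0‖ * (R / r) ^ N →
      ∃ (Z : List ℂ) (F : ℂ → ℂ), Z.length ≤ N ∧ (∀ ρ ∈ Z, f ρ = 0 ∧ ‖ρ‖ ≤ r) ∧
        DifferentiableOn ℂ F U ∧ (∀ z ∈ Metric.closedBall (0:ℂ) r, F z ≠ 0) ∧
        (∀ z ∈ Metric.closedBall (0:ℂ) R, ‖F z‖ ≤ B) ∧ ‖f 0‖ ≤ ‖F 0‖ ∧
        ∀ z ∈ U, F z * (Z.map (fun ρ => (z - ρ))).prod
          = f z * (Z.map (fun ρ => ((R:ℂ)^2 - (starRingEnd ℂ) ρ * z) / R)).prod := by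
  have hR : 0 < R := hr.trans hrR
  have key : ∀ f : ℂ → ℂ, DifferentiableOn ℂ f U → (∀ z ∈ Metric.closedBall (0:ℂ) R, ‖f z‖ ≤ B) →
      f 0 ≠ 0 → ∀ ρ : ℂ, f ρ = 0 → ‖ρ‖ ≤ r → ∃ f1 : ℂ → ℂ, DifferentiableOn ℂ f1 U ∧
        (∀ z ∈ Metric.closedBall (0:ℂ) R, ‖f1 z‖ ≤ B) ∧ ‖f 0‖ * (R / r) ≤ ‖f1 0‖ ∧
        (∀ z ∈ U, f1 z * (z - ρ) = f z * (((R:ℂ)^2 - (starRingEnd ℂ) ρ * z) / R)) := by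
    intro f hf hfB hf0 ρ hρ hρr
    have hρU : ρ ∈ U := hsub (by simp; linarith)
    have hρ0 : ρ ≠ 0 := by rintro rfl; exact hf0 hρ
    have hds : ∀ z, (z - ρ) * dslope f ρ z = f z := by
      intro z
      have := sub_smul_dslope f ρ z
      simpa [hρ] using this
    refine ⟨fun z => dslope f ρ z * (((R:ℂ)^2 - (starRingEnd ℂ) ρ * z) / R), ?_, ?_, ?_, ?_⟩
    · refine DifferentiableOn.mul ((Complex.differentiableOn_dslope (hU.mem_nhds hρU)).2 hf) ?_
      fun_prop
    · have hd : DifferentiableOn ℂ (fun z => dslope f ρ z * (((R:ℂ)^2 - (starRingEnd ℂ) ρ * z) / R)) U := by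
        refine DifferentiableOn.mul ((Complex.differentiableOn_dslope (hU.mem_nhds hρU)).2 hf) ?_
        fun_prop
      intro z hz
      have hcl : closure (Metric.ball (0:ℂ) R) = Metric.closedBall 0 R := closure_ball _ hR.ne'
      have hd' : DiffContOnCl ℂ (fun z => dslope f ρ z * (((R:ℂ)^2 - (starRingEnd ℂ) ρ * z) / R))
          (Metric.ball (0:ℂ) R) :=
        (hd.mono (by rw [hcl]; exact hsub)).diffContOnCl
      refine Complex.norm_le_of_forall_mem_frontier_norm_le
        (f := fun z => dslope f ρ z * (((R:ℂ)^2 - (starRingEnd ℂ) ρ * z) / R))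
        Metric.isBounded_ball hd' ?_ (by rw [hcl]; exact hz)
      intro w hw
      rw [frontier_ball _ hR.ne'] at hw
      have hwn : ‖w‖ = R := by simpa using hw
      have e1 : ‖((R:ℂ)^2 - (starRingEnd ℂ) ρ * w) / R‖ = ‖w - ρ‖ := by
        have : ((R:ℂ)^2 - (starRingEnd ℂ) ρ * w) = w * (starRingEnd ℂ) (w - ρ) := by
          have h2 : w * (starRingEnd ℂ) w = (R:ℂ)^2 := by
            rw [Complex.mul_conj, Complex.normSq_eq_norm_sq, hwn]; push_cast; rfl
          rw [map_sub, mul_sub, h2]; ring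
        rw [this, norm_div, norm_mul, hwn, RCLike.norm_conj]
        simp only [Complex.norm_real, Real.norm_eq_abs, abs_of_pos hR]
        field_simp
      rw [norm_mul, e1, mul_comm, ← norm_mul, hds]
      exact hfB w (by simp [hwn])
    · have : dslope f ρ 0 = - f 0 / ρ := by
        have := hds 0
        field_simp
        linear_combination -this
      simp only [this, mul_zero, sub_zero]
      rw [norm_mul, norm_div, norm_neg, norm_div, norm_pow, Complex.norm_real, Real.norm_eq_abs, abs_of_pos hR]
      have hn : 0 < ‖ρ‖ := norm_pos_iff.2 hρ0
      have : ‖f 0‖ / ‖ρ‖ * (R ^ 2 / R) = ‖f 0‖ * (R / ‖ρ‖) := by field_simp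
      rw [this]
      gcongr
    · intro z hz
      have := hds z
      simp only
      rw [← this]; ring
  induction N with
  | zero =>
    intro f hf hfB hf0 hN
    refine ⟨[], f, by simp, by simp, hf, ?_, hfB, le_rfl, by simp⟩
    intro z hz hfz
    obtain ⟨f1, -, h1, h2, -⟩ := key f hf hfB hf0 z hfz (by simpa using hz)
    have h3 := h1 0 (by simp [hR.le])
    have h4 : 1 < R / r := by rw [lt_div_iff₀ hr]; linarith
    have : 0 < ‖f 0‖ := norm_pos_iff.2 hf0
    simp at hN
    nlinarith
  | succ N ih =>
    intro f hf hfB hf0 hN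
    by_cases h : ∀ z ∈ Metric.closedBall (0:ℂ) r, f z ≠ 0
    · exact ⟨[], f, by simp, by simp, hf, h, hfB, le_rfl, by simp⟩
    · push Not at h
      obtain ⟨ρ, hρr, hρ⟩ := h
      have hρr' : ‖ρ‖ ≤ r := by simpa using hρr
      obtain ⟨f1, h1, h2, h3, h4⟩ := key f hf hfB hf0 ρ hρ hρr'
      have hpos : 0 < ‖f 0‖ := norm_pos_iff.2 hf0
      have h10 : f1 0 ≠ 0 := by
        rw [← norm_pos_iff]
        refine lt_of_lt_of_le ?_ h3
        have := div_pos hR hr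
        positivity
      obtain ⟨Z, F, g1, g2, g3, g4, g5, g6, g7⟩ := ih f1 h1 h2 h10 (by
        refine hN.trans ?_
        rw [pow_succ', ← mul_assoc]
        have := div_pos hR hr
        gcongr)
      refine ⟨ρ :: Z, F, by simpa using g1, ?_, g3, g4, g5, ?_, ?_⟩
      · intro ρ' hρ'
        rcases List.mem_cons.1 hρ' with rfl | h
        · exact ⟨hρ, hρr'⟩
        · obtain ⟨a, b⟩ := g2 _ h
          refine ⟨?_, b⟩
          have := h4 ρ' (hsub (by simp; linarith))
          rw [a, zero_mul] at this
          rcases mul_eq_zero.1 this.symm with h | h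
          · exact h
          · exfalso
            rw [div_eq_zero_iff] at h
            rcases h with h | h
            · have h' : ((R:ℂ)^2) = (starRingEnd ℂ) ρ * ρ' := by linear_combination h
              have := congrArg norm h'
              rw [norm_mul, RCLike.norm_conj, norm_pow, Complex.norm_real, Real.norm_eq_abs, abs_of_pos hR] at this
              nlinarith [norm_nonneg ρ, norm_nonneg ρ']
            · exact hR.ne' (by exact_mod_cast h)
      · refine le_trans ?_ g6
        refine le_trans ?_ h3
        have h4 : 1 ≤ R / r := by rw [le_div_iff₀ hr]; linarith
        nlinarith
      · intro z hz
        simp only [List.map_cons, List.prod_cons]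
        have e1 := g7 z hz
        have e2 := h4 z hz
        linear_combination (z - ρ) * e1 + (List.map (fun ρ => ((R:ℂ) ^ 2 - (starRingEnd ℂ) ρ * z) / R) Z).prod * e2


lemma log_diff_le {u v d : ℝ} (hd : 0 < d) (hu : d ≤ u) (hv : d ≤ v) :
    |Real.log u - Real.log v| ≤ |u - v| / d := by
  have main : ∀ u v : ℝ, d ≤ u → d ≤ v → Real.log u - Real.log v ≤ |u - v| / d := by
    intro u v hu hv
    have hv0 : 0 < v := by linarith
    have hu0 : 0 < u := by linarith
    rw [← Real.log_div hu0.ne' hv0.ne']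
    have := Real.log_le_sub_one_of_pos (div_pos hu0 hv0)
    refine this.trans ?_
    have : u / v - 1 = (u - v) / v := by field_simp
    rw [this]
    calc (u - v) / v ≤ |u - v| / v := by gcongr; exact le_abs_self _
      _ ≤ _ := by gcongr
  rw [abs_le]
  constructor
  · have := main v u hv hu
    rw [abs_sub_comm] at this; linarith
  · exact main u v hu hv

/-- Lipschitz bound for `log |F|`, zero-free `F`. -/
lemma log_norm_lip {F : ℂ → ℂ} {M : ℝ} (hM : 1 ≤ M)
    (hF : DifferentiableOn ℂ F (Metric.ball 0 1.7)) (h0 : ∀ z ∈ Metric.ball (0:ℂ) 1.7, F z ≠ 0)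
    (hFB : ∀ z ∈ Metric.ball (0:ℂ) 1.7, ‖F z‖ ≤ Real.exp M) (hF0 : Real.exp (-M) ≤ ‖F 0‖) :
    ∀ z ∈ Metric.closedBall (0:ℂ) 1.6, ∀ w ∈ Metric.closedBall (0:ℂ) 1.6,
      |Real.log ‖F z‖ - Real.log ‖F w‖| ≤ 3000 * M * ‖z - w‖ := by
  obtain ⟨g, hg, hge⟩ := log_branch Metric.isOpen_ball (convex_ball (0:ℂ) 1.7) ⟨0, by norm_num⟩ hF h0
  have hlog : ∀ z ∈ Metric.ball (0:ℂ) 1.7, Real.log ‖F z‖ = (g z).re := by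
    intro z hz; rw [← hge z hz, Complex.norm_exp, Real.log_exp]
  have hz0 : (0:ℂ) ∈ Metric.ball (0:ℂ) 1.7 := by norm_num
  have hg0 : -M ≤ (g 0).re := by
    rw [← hge 0 hz0, Complex.norm_exp, Real.exp_le_exp] at hF0; exact hF0
  have hBC : ∀ z ∈ Metric.closedBall (0:ℂ) 1.65, ‖g z - g 0‖ ≤ 132 * M := by
    intro z hz
    have hzn : ‖z‖ ≤ 1.65 := by simpa using hz
    have hd : DifferentiableOn ℂ (fun z => g z - g 0) (Metric.ball 0 1.7) := hg.sub_const _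
    have := Complex.borelCaratheodory_zero (M := 2 * M) (R := 1.7) (z := z) (by linarith) hd ?_ (by norm_num) ?_ (by simp)
    · refine this.trans ?_
      rw [div_le_iff₀ (by linarith)]
      nlinarith [norm_nonneg z]
    · intro w hw
      have := hFB w hw
      rw [← hge w hw, Complex.norm_exp, Real.exp_le_exp] at this
      simp; linarith
    · simp; linarith
  intro z hz w hw
  have hder : ∀ x ∈ Metric.closedBall (0:ℂ) 1.6, ‖deriv g x‖ ≤ 3000 * M := by
    intro x hx
    have hxn : ‖x‖ ≤ 1.6 := by simpa using hx
    have hsub : Metric.closedBall x 0.05 ⊆ Metric.closedBall (0:ℂ) 1.65 := by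
      apply Metric.closedBall_subset_closedBall'
      simp; linarith
    have hsub2 : Metric.closedBall (0:ℂ) 1.65 ⊆ Metric.ball (0:ℂ) 1.7 :=
      Metric.closedBall_subset_ball (by norm_num)
    have := Complex.norm_deriv_le_of_forall_mem_sphere_norm_le (c := x) (R := 0.05) (C := 132 * M)
      (f := fun z => g z - g 0) (by norm_num) ?_ ?_
    · rw [deriv_sub_const] at this
      refine this.trans ?_
      rw [div_le_iff₀ (by norm_num)]; linarith
    · apply DifferentiableOn.diffContOnCl
      rw [closure_ball _ (by norm_num)]
      exact (hg.sub_const _).mono (hsub.trans hsub2)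
    · intro y hy
      exact hBC y (hsub (Metric.sphere_subset_closedBall hy))
  have hin : Metric.closedBall (0:ℂ) 1.6 ⊆ Metric.ball (0:ℂ) 1.7 :=
    Metric.closedBall_subset_ball (by norm_num)
  rw [hlog z (hin hz), hlog w (hin hw), ← Complex.sub_re]
  refine (Complex.abs_re_le_norm _).trans ?_
  exact (convex_closedBall (0:ℂ) 1.6).norm_image_sub_le_of_norm_deriv_le
    (fun x hx => hg.differentiableAt (Metric.isOpen_ball.mem_nhds (hin hx))) hder hw hz

lemma list_sum_lip (Z : List ℂ) (φ : ℂ → ℝ) (ψ : ℂ → ℝ) (K : ℝ) (h : ∀ ρ ∈ Z, |φ ρ - ψ ρ| ≤ K) :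
    |(Z.map φ).sum - (Z.map ψ).sum| ≤ Z.length * K := by
  induction Z with
  | nil => simp
  | cons a t ih =>
    simp only [List.map_cons, List.sum_cons, List.length_cons, List.forall_mem_cons] at *
    have := ih h.2
    push_cast
    have e : φ a + (List.map φ t).sum - (ψ a + (List.map ψ t).sum) =
      (φ a - ψ a) + ((List.map φ t).sum - (List.map ψ t).sum) := by ring
    rw [e]
    refine (abs_add_le _ _).trans ?_
    linarith [h.1]

lemma log_norm_list_prod (Z : List ℂ) (φ : ℂ → ℂ) (h : ∀ ρ ∈ Z, φ ρ ≠ 0) :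
    Real.log ‖(Z.map φ).prod‖ = (Z.map (fun ρ => Real.log ‖φ ρ‖)).sum ∧ (Z.map φ).prod ≠ 0 := by
  induction Z with
  | nil => simp
  | cons a t ih =>
    simp only [List.map_cons, List.sum_cons, List.prod_cons, List.forall_mem_cons] at *
    obtain ⟨h1, h2⟩ := ih h.2
    refine ⟨?_, mul_ne_zero h.1 h2⟩
    rw [norm_mul, Real.log_mul (norm_ne_zero_iff.2 h.1) (norm_ne_zero_iff.2 h2), h1]

lemma local_fac0 {f : ℂ → ℂ} {U : Set ℂ} (hU : IsOpen U) (hsub : Metric.closedBall (0:ℂ) 1.9 ⊆ U)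
    (hf : DifferentiableOn ℂ f U) {M : ℝ} (hM : 1 ≤ M)
    (hB : ∀ z ∈ Metric.closedBall (0:ℂ) 1.9, ‖f z‖ ≤ Real.exp M) (h0 : Real.exp (-M) ≤ ‖f 0‖) :
    ∃ (Z : List ℂ) (h : ℂ → ℝ), (Z.length : ℝ) ≤ 60 * M ∧ (∀ ρ ∈ Z, f ρ = 0 ∧ ‖ρ‖ ≤ 1.7) ∧
      (∀ z ∈ Metric.closedBall (0:ℂ) 1.6, f z ≠ 0 →
        Real.log ‖f z‖ = (Z.map (fun ρ => Real.log ‖z - ρ‖)).sum + h z) ∧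
      (∀ z ∈ Metric.closedBall (0:ℂ) 1.6, ∀ w ∈ Metric.closedBall (0:ℂ) 1.6,
        |h z - h w| ≤ 4000 * M * ‖z - w‖) ∧ |h 0| ≤ 100 * M := by
  have hf0 : f 0 ≠ 0 := by
    rw [← norm_pos_iff]; exact lt_of_lt_of_le (Real.exp_pos _) h0
  set N := ⌈(50 * M)⌉₊ with hN
  have hNle : (N : ℝ) ≤ 60 * M := by
    have := Nat.ceil_lt_add_one (a := 50 * M) (by linarith)
    linarith
  have hratio : Real.exp M ≤ ‖f 0‖ * ((1.9:ℝ) / 1.7) ^ N := by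
    have h1 : Real.exp (2 * M) ≤ ((1.9:ℝ) / 1.7) ^ N := by
      have e1 : Real.exp (1/10) ≤ (1.9:ℝ)/1.7 := by
        have := Real.exp_bound_div_one_sub_of_interval (x := 1/10) (by norm_num) (by norm_num)
        refine this.trans ?_
        norm_num
      calc Real.exp (2 * M) ≤ Real.exp (N * (1/10)) := by
            rw [Real.exp_le_exp]
            have := Nat.le_ceil (50 * M)
            rw [← hN] at this; linarith
        _ = Real.exp (1/10) ^ N := by rw [Real.exp_nat_mul]
        _ ≤ _ := by gcongr
    calc Real.exp M = Real.exp (-M) * Real.exp (2 * M) := by rw [← Real.exp_add]; ring_nf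
      _ ≤ _ := by gcongr
  obtain ⟨Z, F, g1, g2, g3, g4, g5, g6, g7⟩ := remove_zeros (R := 1.9) (r := 1.7) (by norm_num)
    (by norm_num) hU hsub N f hf hB hf0 hratio
  set b : ℂ → ℂ → ℂ := fun z ρ => (((1.9:ℝ):ℂ)^2 - (starRingEnd ℂ) ρ * z) / ((1.9:ℝ):ℂ) with hb
  have hbl : ∀ z ∈ Metric.closedBall (0:ℂ) 1.6, ∀ ρ ∈ Z, 0.4 ≤ ‖b z ρ‖ := by
    intro z hz ρ hρ
    have hzn : ‖z‖ ≤ 1.6 := by simpa using hz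
    have hρn := (g2 ρ hρ).2
    rw [hb]; simp only
    rw [norm_div, Complex.norm_real, le_div_iff₀ (by norm_num)]
    have h1 : ‖(starRingEnd ℂ) ρ * z‖ ≤ 1.7 * 1.6 := by
      rw [norm_mul, RCLike.norm_conj]
      gcongr
    have h2 := norm_sub_norm_le (((1.9:ℝ):ℂ)^2) ((starRingEnd ℂ) ρ * z)
    rw [norm_pow, Complex.norm_real] at h2
    norm_num at *
    linarith
  have hin : Metric.closedBall (0:ℂ) 1.6 ⊆ U := (Metric.closedBall_subset_closedBall (by norm_num)).trans hsub
  have hin7 : Metric.ball (0:ℂ) 1.7 ⊆ Metric.closedBall 0 1.9 :=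
    Metric.ball_subset_closedBall.trans (Metric.closedBall_subset_closedBall (by norm_num))
  have hlen : (Z.length : ℝ) ≤ 60 * M := le_trans (by exact_mod_cast g1) hNle
  have hFl := log_norm_lip (F := F) hM (g3.mono (hin7.trans hsub))
    (fun z hz => g4 z (Metric.ball_subset_closedBall hz)) (fun z hz => g5 z (hin7 hz)) (h0.trans g6)
  have z0 : (0:ℂ) ∈ Metric.closedBall (0:ℂ) 1.6 := by norm_num
  have hF0 : F 0 ≠ 0 := g4 0 (by norm_num)
  refine ⟨Z, fun z => Real.log ‖F z‖ - (Z.map (fun ρ => Real.log ‖b z ρ‖)).sum, hlen, g2, ?_, ?_, ?_⟩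
  · intro z hz hfz
    have e := g7 z (hin hz)
    have n1 := log_norm_list_prod Z (fun ρ => b z ρ) (fun ρ hρ => by
      rw [← norm_pos_iff]; linarith [hbl z hz ρ hρ])
    have n2 := log_norm_list_prod Z (fun ρ => z - ρ) (fun ρ hρ h => by
      rw [sub_eq_zero.1 h] at hfz; exact hfz (g2 ρ hρ).1)
    have hFz : F z ≠ 0 := g4 z (Metric.closedBall_subset_closedBall (by norm_num) hz)
    have e' := congrArg (fun x => Real.log ‖x‖) e
    simp only [norm_mul] at e'
    rw [Real.log_mul (norm_ne_zero_iff.2 hFz) (norm_ne_zero_iff.2 n2.2),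
      Real.log_mul (norm_ne_zero_iff.2 hfz) (norm_ne_zero_iff.2 n1.2), n2.1, n1.1] at e'
    simp only
    linarith
  · intro z hz w hw
    have l1 := hFl z hz w hw
    have l2 := list_sum_lip Z (fun ρ => Real.log ‖b z ρ‖) (fun ρ => Real.log ‖b w ρ‖) (3 * ‖z - w‖) ?_
    · simp only
      have e : ∀ a b c d : ℝ, (a - b) - (c - d) = (a - c) - (b - d) := by intros; ring
      rw [e]
      refine (abs_sub _ _).trans ?_
      nlinarith [norm_nonneg (z - w)]
    · intro ρ hρ
      refine (log_diff_le (d := 0.4) (by norm_num) (hbl z hz ρ hρ) (hbl w hw ρ hρ)).trans ?_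
      rw [div_le_iff₀ (by norm_num)]
      refine (abs_norm_sub_norm_le _ _).trans ?_
      have : b z ρ - b w ρ = - ((starRingEnd ℂ) ρ * (z - w)) / ((1.9:ℝ):ℂ) := by
        rw [hb]; simp only; ring
      rw [this, norm_div, norm_neg, norm_mul, RCLike.norm_conj, Complex.norm_real, div_le_iff₀ (by norm_num)]
      have := (g2 ρ hρ).2
      norm_num
      nlinarith [norm_nonneg (z - w)]
  · have k1 : |Real.log ‖F 0‖| ≤ M := by
      rw [abs_le]
      constructor
      · rw [Real.le_log_iff_exp_le (norm_pos_iff.2 hF0)]; exact h0.trans g6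
      · rw [Real.log_le_iff_le_exp (norm_pos_iff.2 hF0)]; exact g5 0 (by norm_num)
    have k2 := list_sum_lip Z (fun ρ => Real.log ‖b 0 ρ‖) (fun _ => 0) 1 ?_
    · simp at k2
      refine (abs_sub _ _).trans ?_
      linarith
    · intro ρ hρ
      have e : ‖b 0 ρ‖ = 1.9 := by
        rw [hb]; simp only [mul_zero, sub_zero]
        rw [norm_div, norm_pow, Complex.norm_real]; norm_num
      rw [e, sub_zero, abs_of_nonneg (Real.log_nonneg (by norm_num))]
      have := Real.log_le_sub_one_of_pos (x := 1.9) (by norm_num)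
      linarith

lemma local_fac (c : ℂ) {f : ℂ → ℂ} {U : Set ℂ} (hU : IsOpen U) (hsub : Metric.closedBall c 1.9 ⊆ U)
    (hf : DifferentiableOn ℂ f U) {M : ℝ} (hM : 1 ≤ M)
    (hB : ∀ z ∈ Metric.closedBall c 1.9, ‖f z‖ ≤ Real.exp M) (h0 : Real.exp (-M) ≤ ‖f c‖) :
    ∃ (Z : List ℂ) (h : ℂ → ℝ), (Z.length : ℝ) ≤ 60 * M ∧ (∀ ρ ∈ Z, f ρ = 0 ∧ ‖ρ - c‖ ≤ 1.7) ∧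
      (∀ z ∈ Metric.closedBall c 1.6, f z ≠ 0 →
        Real.log ‖f z‖ = (Z.map (fun ρ => Real.log ‖z - ρ‖)).sum + h z) ∧
      (∀ z ∈ Metric.closedBall c 1.6, ∀ w ∈ Metric.closedBall c 1.6,
        |h z - h w| ≤ 4000 * M * ‖z - w‖) ∧ |h c| ≤ 100 * M := by
  have hmem : ∀ (z : ℂ) (r : ℝ), z + c ∈ Metric.closedBall c r ↔ z ∈ Metric.closedBall (0:ℂ) r := by
    intro z r; simp
  have hmem' : ∀ (z : ℂ) (r : ℝ), z ∈ Metric.closedBall c r → z - c ∈ Metric.closedBall (0:ℂ) r := by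
    intro z r h; rw [← hmem]; simpa using h
  obtain ⟨Z, h, h1, h2, h3, h4, h5⟩ := local_fac0 (f := fun z => f (z + c))
    (U := (fun z => z + c) ⁻¹' U) (hU.preimage (by fun_prop))
    (fun z hz => hsub ((hmem z _).2 hz))
    (hf.comp (by fun_prop) (fun z hz => hz)) hM (fun z hz => hB _ ((hmem z _).2 hz)) (by simpa using h0)
  refine ⟨Z.map (fun ρ => ρ + c), fun z => h (z - c), by simpa using h1, ?_, ?_, ?_, by simpa using h5⟩
  · intro ρ hρ
    obtain ⟨ρ', hρ', rfl⟩ := List.mem_map.1 hρ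
    simpa using h2 ρ' hρ'
  · intro z hz hfz
    have := h3 (z - c) (hmem' z _ hz) (by simpa using hfz)
    simp only [sub_add_cancel] at this
    rw [this, List.map_map]
    congr 2
    apply List.map_congr_left
    intro ρ _
    simp only [Function.comp]
    rw [sub_sub, add_comm c]
  · intro z hz w hw
    have := h4 _ (hmem' z _ hz) _ (hmem' w _ hw)
    simpa using this


noncomputable def cs (z : ℂ) : ℂ := dslope Complex.sin 0 z

lemma cs_mul (z : ℂ) : z * cs z = Complex.sin z := by
  have := sub_smul_dslope Complex.sin 0 z
  simpa [cs] using this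

lemma cs_diff : Differentiable ℂ cs := by
  rw [← differentiableOn_univ]
  exact (Complex.differentiableOn_dslope Filter.univ_mem).2 Complex.differentiable_sin.differentiableOn

lemma cs_ofReal (v : ℝ) : cs (v : ℂ) = (Real.sinc v : ℂ) := by
  by_cases hv : v = 0
  · subst hv; simp [cs]
  · have h := cs_mul v
    rw [Real.sinc_of_ne_zero hv]
    have : (v:ℂ) ≠ 0 := by exact_mod_cast hv
    push_cast
    field_simp
    linear_combination h

lemma norm_cexp_I_le (z : ℂ) : ‖Complex.exp (z * I)‖ ≤ Real.exp |z.im| := by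
  rw [Complex.norm_exp, Real.exp_le_exp]
  simp
  exact neg_le_abs _

lemma norm_cexp_I_le' (z : ℂ) : ‖Complex.exp (-z * I)‖ ≤ Real.exp |z.im| := by
  have := norm_cexp_I_le (-z)
  simpa using this

lemma norm_csin_le (z : ℂ) : ‖Complex.sin z‖ ≤ Real.exp |z.im| := by
  rw [Complex.sin]
  rw [norm_div, norm_mul, Complex.norm_I, mul_one]
  have := norm_sub_le (Complex.exp (-z * I)) (Complex.exp (z * I))
  have h1 := norm_cexp_I_le z
  have h2 := norm_cexp_I_le' z
  simp only [Complex.norm_ofNat]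
  linarith

lemma norm_ccos_le (z : ℂ) : ‖Complex.cos z‖ ≤ Real.exp |z.im| := by
  rw [Complex.cos]
  rw [norm_div]
  have := norm_add_le (Complex.exp (z * I)) (Complex.exp (-z * I))
  have h1 := norm_cexp_I_le z
  have h2 := norm_cexp_I_le' z
  simp only [Complex.norm_ofNat]
  linarith

lemma norm_cs_le (z : ℂ) : ‖cs z‖ ≤ Real.exp |z.im| := by
  by_cases hz : z = 0
  · subst hz; simp [cs]
  · have h1 : ‖Complex.sin z‖ ≤ Real.exp |z.im| * ‖z‖ := by
      have := (convex_segment (0:ℂ) z).norm_image_sub_le_of_norm_deriv_le (𝕜 := ℂ) (f := Complex.sin)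
        (C := Real.exp |z.im|) (fun x _ => Complex.differentiable_sin x) ?_
        (left_mem_segment ℝ (0:ℂ) z) (right_mem_segment ℝ (0:ℂ) z)
      · simpa using this
      · intro x hx
        rw [Complex.deriv_sin]
        refine (norm_ccos_le x).trans ?_
        rw [Real.exp_le_exp]
        obtain ⟨a, b, ha, hb, hab, rfl⟩ := hx
        simp
        rw [abs_of_nonneg hb]
        nlinarith [abs_nonneg z.im]
    rw [← cs_mul, norm_mul, mul_comm] at h1
    exact le_of_mul_le_mul_right h1 (norm_pos_iff.2 hz)

lemma norm_cs_mul_le (z : ℂ) : ‖cs z‖ * (1 + ‖z‖) ≤ 2 * Real.exp |z.im| := by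
  have h1 := norm_cs_le z
  have h2 := norm_csin_le z
  rw [← cs_mul, norm_mul] at h2
  linarith

lemma norm_cs_pow_le (z : ℂ) : ‖cs z ^ 6‖ ≤ 64 * Real.exp (6 * |z.im|) / (1 + ‖z‖ ^ 2) ^ 3 := by
  rw [le_div_iff₀ (by positivity), norm_pow]
  calc ‖cs z‖ ^ 6 * (1 + ‖z‖ ^ 2) ^ 3 ≤ ‖cs z‖ ^ 6 * ((1 + ‖z‖) ^ 2) ^ 3 := by
        gcongr; nlinarith [norm_nonneg z]
    _ = (‖cs z‖ * (1 + ‖z‖)) ^ 6 := by ring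
    _ ≤ (2 * Real.exp |z.im|) ^ 6 := pow_le_pow_left₀ (by positivity) (norm_cs_mul_le z) 6
    _ = _ := by rw [mul_pow, ← Real.exp_nat_mul]; norm_num

lemma sinc_pow_le (v : ℝ) : Real.sinc v ^ 6 ≤ 64 / (1 + v ^ 2) ^ 3 := by
  have := norm_cs_pow_le (v : ℂ)
  rw [cs_ofReal] at this
  simp only [norm_pow, Complex.norm_real, Complex.ofReal_im, abs_zero, mul_zero, Real.exp_zero, mul_one, Real.norm_eq_abs, sq_abs] at this
  rwa [Even.pow_abs (by decide)] at this

lemma sinc6_nonneg (v : ℝ) : 0 ≤ Real.sinc v ^ 6 := Even.pow_nonneg (by decide) _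

lemma integrable_mul_sinc {φ : ℝ → ℝ} (hφ : MeasureTheory.AEStronglyMeasurable φ) {A : ℝ}
    (h : ∀ v, |φ v| ≤ A * (1 + v ^ 2) ^ 2) : MeasureTheory.Integrable (fun v => φ v * Real.sinc v ^ 6) := by
  have hi : MeasureTheory.Integrable (fun v : ℝ => 64 * A * (1 + v ^ 2)⁻¹) :=
    integrable_inv_one_add_sq.const_mul _
  refine hi.mono' (hφ.mul (by fun_prop)) (Filter.Eventually.of_forall fun v => ?_)
  rw [norm_mul, Real.norm_eq_abs, Real.norm_eq_abs, abs_of_nonneg (sinc6_nonneg v)]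
  calc |φ v| * Real.sinc v ^ 6 ≤ (A * (1 + v ^ 2) ^ 2) * (64 / (1 + v ^ 2) ^ 3) := by
        exact mul_le_mul (h v) (sinc_pow_le v) (sinc6_nonneg v) ((abs_nonneg _).trans (h v))
    _ = _ := by field_simp

noncomputable def I0 : ℝ := ∫ v : ℝ, Real.sinc v ^ 6
noncomputable def m2 : ℝ := (∫ v : ℝ, v ^ 2 * Real.sinc v ^ 6) / I0
noncomputable def m4 : ℝ := (∫ v : ℝ, v ^ 4 * Real.sinc v ^ 6) / I0

lemma integrable_sinc6 : MeasureTheory.Integrable (fun v => Real.sinc v ^ 6) := by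
  have := integrable_mul_sinc (φ := fun _ => 1) (by fun_prop) (A := 1) (fun v => by
      rw [abs_one, one_mul]; nlinarith [sq_nonneg v, sq_nonneg (v^2)])
  simpa using this

lemma I0_pos : 0 < I0 := by
  have hc : Continuous (fun v => Real.sinc v ^ 6) := by fun_prop
  exact MeasureTheory.integral_pos_of_integrable_nonneg_nonzero hc integrable_sinc6 (fun v => sinc6_nonneg v) (x := 0) (by simp)

noncomputable def kap (Δ v : ℝ) : ℝ := Δ / I0 * Real.sinc (Δ * v) ^ 6

lemma kap_nonneg {Δ : ℝ} (hΔ : 0 < Δ) (v : ℝ) : 0 ≤ kap Δ v :=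
  mul_nonneg (div_nonneg hΔ.le I0_pos.le) (sinc6_nonneg _)

lemma kap_even (Δ v : ℝ) : kap Δ (-v) = kap Δ v := by simp [kap]

lemma kap_cont (Δ : ℝ) : Continuous (kap Δ) := by unfold kap; fun_prop

lemma kap_le {Δ : ℝ} (hΔ : 1 ≤ Δ) (v : ℝ) : kap Δ v ≤ 64 * Δ / I0 / (1 + v ^ 2) ^ 3 := by
  have h := sinc_pow_le (Δ * v)
  have h2 : 64 / (1 + (Δ * v) ^ 2) ^ 3 ≤ 64 / (1 + v ^ 2) ^ 3 := by
    have h3 : v ^ 2 ≤ (Δ * v) ^ 2 := by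
      rw [mul_pow]; nlinarith [sq_nonneg v, one_le_pow₀ hΔ (n := 2)]
    exact div_le_div_of_nonneg_left (by norm_num) (by positivity) (pow_le_pow_left₀ (by positivity) (by linarith) 3)
  have := I0_pos
  calc kap Δ v ≤ Δ / I0 * (64 / (1 + v ^ 2) ^ 3) := by
        unfold kap; gcongr; exact h.trans h2
    _ = _ := by ring

lemma kap_int_eq {Δ : ℝ} (hΔ : 0 < Δ) (f : ℝ → ℝ) :
    ∫ v, f (Δ * v) * kap Δ v = (∫ v, f v * Real.sinc v ^ 6) / I0 := by
  have := MeasureTheory.Measure.integral_comp_mul_left (fun v => f v * Real.sinc v ^ 6) Δ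
  rw [show (fun v => f (Δ * v) * kap Δ v) = fun v => (Δ / I0) * (f (Δ * v) * Real.sinc (Δ * v) ^ 6) by
    ext v; unfold kap; ring]
  rw [MeasureTheory.integral_const_mul, this, abs_of_pos (inv_pos.2 hΔ)]
  simp; field_simp

lemma kap_int_one {Δ : ℝ} (hΔ : 0 < Δ) : ∫ v, kap Δ v = 1 := by
  have := kap_int_eq hΔ (fun _ => 1)
  simp only [one_mul] at this
  rw [this]; exact div_self I0_pos.ne'

lemma kap_int_two {Δ : ℝ} (hΔ : 0 < Δ) : ∫ v, v ^ 2 * kap Δ v = m2 / Δ ^ 2 := by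
  have := kap_int_eq hΔ (fun v => v ^ 2)
  rw [m2, ← this, show (fun v => (Δ * v) ^ 2 * kap Δ v) = fun v => Δ ^ 2 * (v ^ 2 * kap Δ v) by ext; ring,
    MeasureTheory.integral_const_mul]
  field_simp

lemma kap_int_four {Δ : ℝ} (hΔ : 0 < Δ) : ∫ v, v ^ 4 * kap Δ v = m4 / Δ ^ 4 := by
  have := kap_int_eq hΔ (fun v => v ^ 4)
  rw [m4, ← this, show (fun v => (Δ * v) ^ 4 * kap Δ v) = fun v => Δ ^ 4 * (v ^ 4 * kap Δ v) by ext; ring,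
    MeasureTheory.integral_const_mul]
  field_simp

lemma kap_integrable {Δ : ℝ} (hΔ : 1 ≤ Δ) {E : Type*} [NormedAddCommGroup E] [NormedSpace ℝ E]
    {φ : ℝ → E} (hφ : MeasureTheory.AEStronglyMeasurable φ) {A : ℝ}
    (h : ∀ v, ‖φ v‖ ≤ A * (1 + v ^ 2) ^ 2) : MeasureTheory.Integrable (fun v => kap Δ v • φ v) := by
  have hi : MeasureTheory.Integrable (fun v : ℝ => (64 * Δ / I0) * A * (1 + v ^ 2)⁻¹) :=
    integrable_inv_one_add_sq.const_mul _
  have := kap_cont Δ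
  refine hi.mono' (this.aestronglyMeasurable.smul hφ) (Filter.Eventually.of_forall fun v => ?_)
  rw [norm_smul, Real.norm_eq_abs, abs_of_nonneg (kap_nonneg (by linarith) v)]
  calc kap Δ v * ‖φ v‖ ≤ (64 * Δ / I0 / (1 + v ^ 2) ^ 3) * (A * (1 + v ^ 2) ^ 2) :=
        mul_le_mul (kap_le hΔ v) (h v) (norm_nonneg _) ((kap_nonneg (by linarith) v).trans (kap_le hΔ v))
    _ = _ := by field_simp

lemma kap_integrable_real {Δ : ℝ} (hΔ : 1 ≤ Δ)
    {φ : ℝ → ℝ} (hφ : MeasureTheory.AEStronglyMeasurable φ) {A : ℝ}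
    (h : ∀ v, |φ v| ≤ A * (1 + v ^ 2) ^ 2) : MeasureTheory.Integrable (fun v => φ v * kap Δ v) := by
  have := kap_integrable hΔ hφ h
  simpa [mul_comm] using this

lemma m2_nonneg : 0 ≤ m2 := div_nonneg (MeasureTheory.integral_nonneg fun v => mul_nonneg (sq_nonneg _) (sinc6_nonneg _)) I0_pos.le
lemma m4_nonneg : 0 ≤ m4 := div_nonneg (MeasureTheory.integral_nonneg fun v => mul_nonneg (by positivity) (sinc6_nonneg _)) I0_pos.le
lemma log_sym_ge {a : ℝ} (ha : 0 < a) (γ v : ℝ) :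
    2 * Real.log (a ^ 2 + γ ^ 2) - 4 * (v ^ 2 + v ^ 4 / a ^ 2) / (a ^ 2 + γ ^ 2) ≤
      Real.log (a ^ 2 + (γ + v) ^ 2) + Real.log (a ^ 2 + (γ - v) ^ 2) := by
  have hA : 0 < a ^ 2 + γ ^ 2 := by positivity
  have hX : 0 < a ^ 2 + (γ + v) ^ 2 := by positivity
  have hY : 0 < a ^ 2 + (γ - v) ^ 2 := by positivity
  have key : ∀ w : ℝ, a ^ 2 + γ ^ 2 ≤ 2 * (1 + v ^ 2 / a ^ 2) * (a ^ 2 + (γ + w) ^ 2) ∨ w ^ 2 ≠ v ^ 2 := by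
    intro w
    by_cases hw : w ^ 2 = v ^ 2
    · left
      rw [← hw]
      have : 2 * (1 + w ^ 2 / a ^ 2) * (a ^ 2 + (γ + w) ^ 2) = 2 * a ^ 2 + 2 * w ^ 2 + 2 * (γ + w) ^ 2 + 2 * (w ^ 2 / a ^ 2) * (γ + w) ^ 2 := by
        field_simp; ring
      rw [this]
      have : 0 ≤ 2 * (w ^ 2 / a ^ 2) * (γ + w) ^ 2 := by positivity
      nlinarith [sq_nonneg (γ + 2 * w), sq_nonneg a]
    · right; exact hw
  have k1 := (key v).resolve_right (by simp)
  have k2 := (key (-v)).resolve_right (by simp)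
  have hE : 0 ≤ 2 * (1 + v ^ 2 / a ^ 2) := by positivity
  rw [← sub_eq_add_neg] at k2
  have hprod : (a ^ 2 + γ ^ 2) ^ 2 ≤ 2 * (1 + v ^ 2 / a ^ 2) * ((a ^ 2 + (γ + v) ^ 2) * (a ^ 2 + (γ - v) ^ 2)) := by
    rcases le_total 0 (γ * v) with h | h
    · have : a ^ 2 + γ ^ 2 ≤ a ^ 2 + (γ + v) ^ 2 := by nlinarith [sq_nonneg v]
      calc (a ^ 2 + γ ^ 2) ^ 2 = (a ^ 2 + γ ^ 2) * (a ^ 2 + γ ^ 2) := by ring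
        _ ≤ (a ^ 2 + (γ + v) ^ 2) * (2 * (1 + v ^ 2 / a ^ 2) * (a ^ 2 + (γ - v) ^ 2)) :=
            mul_le_mul this k2 hA.le hX.le
        _ = _ := by ring
    · have : a ^ 2 + γ ^ 2 ≤ a ^ 2 + (γ - v) ^ 2 := by nlinarith [sq_nonneg v]
      calc (a ^ 2 + γ ^ 2) ^ 2 = (a ^ 2 + γ ^ 2) * (a ^ 2 + γ ^ 2) := by ring
        _ ≤ (a ^ 2 + (γ - v) ^ 2) * (2 * (1 + v ^ 2 / a ^ 2) * (a ^ 2 + (γ + v) ^ 2)) :=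
            mul_le_mul this k1 hA.le hY.le
        _ = _ := by ring
  set A := a ^ 2 + γ ^ 2 with hAd
  set X := a ^ 2 + (γ + v) ^ 2 with hXd
  set Y := a ^ 2 + (γ - v) ^ 2 with hYd
  have hXY : 0 < X * Y := mul_pos hX hY
  have hlog : 1 - A ^ 2 / (X * Y) ≤ Real.log (X * Y / A ^ 2) := by
    have := Real.one_sub_inv_le_log_of_pos (x := X * Y / A ^ 2) (by positivity)
    rwa [inv_div] at this
  rw [Real.log_div hXY.ne' (by positivity), Real.log_mul hX.ne' hY.ne', Real.log_pow] at hlog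
  have h1 : -(4 * (v ^ 2 + v ^ 4 / a ^ 2) / A) ≤ 1 - A ^ 2 / (X * Y) := by
    have e1 : 1 - A ^ 2 / (X * Y) = (X * Y - A ^ 2) / (X * Y) := by field_simp
    have e2 : X * Y - A ^ 2 ≥ - (2 * v ^ 2 * A) := by
      have : X * Y - A ^ 2 = v ^ 4 + 2 * v ^ 2 * (a ^ 2 - γ ^ 2) := by
        rw [hXd, hYd, hAd]; ring
      rw [this, hAd]
      have : 0 ≤ v ^ 4 + 4 * v ^ 2 * a ^ 2 := by positivity
      nlinarith
    rw [e1, ← neg_div, div_le_div_iff₀ hA hXY]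
    have e3 : 4 * (v ^ 2 + v ^ 4 / a ^ 2) * (X * Y) = 2 * v ^ 2 * (2 * (1 + v ^ 2 / a ^ 2) * (X * Y)) := by
      field_simp; ring
    rw [neg_mul, e3]
    have e4 : 2 * v ^ 2 * A ^ 2 ≤ 2 * v ^ 2 * (2 * (1 + v ^ 2 / a ^ 2) * (X * Y)) := by gcongr
    nlinarith
  push_cast at hlog
  linarith

lemma log_growth {a : ℝ} (ha : 0 < a) (γ v : ℝ) :
    |Real.log (a ^ 2 + (γ + v) ^ 2)| ≤ (|Real.log (a ^ 2)| + a ^ 2 + 2 * γ ^ 2 + 2) * (1 + v ^ 2) ^ 2 := by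
  have h1 : Real.log (a ^ 2) ≤ Real.log (a ^ 2 + (γ + v) ^ 2) :=
    Real.log_le_log (by positivity) (by nlinarith [sq_nonneg (γ + v)])
  have h2 : Real.log (a ^ 2 + (γ + v) ^ 2) ≤ a ^ 2 + (γ + v) ^ 2 := Real.log_le_self (by positivity)
  have h3 : |Real.log (a ^ 2 + (γ + v) ^ 2)| ≤ |Real.log (a ^ 2)| + a ^ 2 + 2 * γ ^ 2 + 2 * v ^ 2 := by
    rw [abs_le]; constructor
    · have := neg_abs_le (Real.log (a ^ 2)); nlinarith [sq_nonneg γ, sq_nonneg v, sq_nonneg a]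
    · have := abs_nonneg (Real.log (a ^ 2)); nlinarith [sq_nonneg (γ - v)]
  refine h3.trans ?_
  have h4 : 1 + v ^ 2 ≤ (1 + v ^ 2) ^ 2 := by nlinarith [sq_nonneg v]
  have h5 : 0 ≤ |Real.log (a ^ 2)| + a ^ 2 + 2 * γ ^ 2 := by positivity
  nlinarith [mul_le_mul_of_nonneg_left h4 h5, mul_nonneg h5 (sq_nonneg v)]

lemma kap_j0 {Δ : ℝ} (hΔ : 1 ≤ Δ) : MeasureTheory.Integrable (fun v => kap Δ v) := by
  have := kap_integrable_real hΔ (φ := fun _ => 1) (A := 1) (by fun_prop) (fun v => by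
    rw [abs_one, one_mul]; nlinarith [sq_nonneg v, sq_nonneg (v^2)])
  simpa using this
lemma kap_j2 {Δ : ℝ} (hΔ : 1 ≤ Δ) : MeasureTheory.Integrable (fun v => v ^ 2 * kap Δ v) :=
  kap_integrable_real hΔ (A := 1) (by fun_prop) (fun v => by
    rw [abs_of_nonneg (by positivity)]; nlinarith [sq_nonneg v, sq_nonneg (v^2)])
lemma kap_j4 {Δ : ℝ} (hΔ : 1 ≤ Δ) : MeasureTheory.Integrable (fun v => v ^ 4 * kap Δ v) :=
  kap_integrable_real hΔ (A := 1) (by fun_prop) (fun v => by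
    rw [abs_of_nonneg (by positivity)]; nlinarith [sq_nonneg v, sq_nonneg (v^2)])

lemma one_dim {Δ a b : ℝ} (hΔ : 1 ≤ Δ) (hb : 0 < b) (hba : b ≤ a / 2)
    (hm : m2 / (Δ * a) ^ 2 + m4 / (Δ * a) ^ 4 ≤ 3 / 8) (γ : ℝ) :
    Real.log (b ^ 2 + γ ^ 2) ≤ ∫ v, Real.log (a ^ 2 + (γ + v) ^ 2) * kap Δ v := by
  have ha : 0 < a := by linarith
  have hΔ0 : 0 < Δ := by linarith
  have hA : 0 < a ^ 2 + γ ^ 2 := by positivity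
  have hi1 : MeasureTheory.Integrable (fun v => Real.log (a ^ 2 + (γ + v) ^ 2) * kap Δ v) :=
    kap_integrable_real hΔ (Measurable.aestronglyMeasurable (by fun_prop)) (log_growth ha γ)
  have hi2 : MeasureTheory.Integrable (fun v => Real.log (a ^ 2 + (γ - v) ^ 2) * kap Δ v) := by
    have := hi1.comp_neg
    simpa [kap_even, ← sub_eq_add_neg] using this
  have he : ∫ v, Real.log (a ^ 2 + (γ - v) ^ 2) * kap Δ v = ∫ v, Real.log (a ^ 2 + (γ + v) ^ 2) * kap Δ v := by
    rw [← MeasureTheory.integral_neg_eq_self]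
    congr 1; ext v; rw [kap_even, sub_neg_eq_add]
  have j0 := kap_j0 hΔ
  have j2 := kap_j2 hΔ
  have j4 := kap_j4 hΔ
  have hlow : ∫ v, ((2 * Real.log (a ^ 2 + γ ^ 2)) * kap Δ v - (4 / (a ^ 2 + γ ^ 2)) * (v ^ 2 * kap Δ v)
      - (4 / (a ^ 2 + γ ^ 2) / a ^ 2) * (v ^ 4 * kap Δ v)) ≤
      ∫ v, (Real.log (a ^ 2 + (γ + v) ^ 2) * kap Δ v + Real.log (a ^ 2 + (γ - v) ^ 2) * kap Δ v) := by
    refine MeasureTheory.integral_mono (((j0.const_mul _).sub (j2.const_mul _)).sub (j4.const_mul _)) (hi1.add hi2) fun v => ?_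
    have := mul_le_mul_of_nonneg_right (log_sym_ge ha γ v) (kap_nonneg hΔ0 v)
    simp only
    calc _ = (2 * Real.log (a ^ 2 + γ ^ 2) - 4 * (v ^ 2 + v ^ 4 / a ^ 2) / (a ^ 2 + γ ^ 2)) * kap Δ v := by
          field_simp; ring
      _ ≤ _ := this
      _ = _ := by ring
  have jj : MeasureTheory.Integrable (fun v => (2 * Real.log (a ^ 2 + γ ^ 2)) * kap Δ v - (4 / (a ^ 2 + γ ^ 2)) * (v ^ 2 * kap Δ v)) :=
    (j0.const_mul _).sub (j2.const_mul _)
  rw [MeasureTheory.integral_add hi1 hi2, he,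
    MeasureTheory.integral_sub jj (j4.const_mul _),
    MeasureTheory.integral_sub (j0.const_mul _) (j2.const_mul _), MeasureTheory.integral_const_mul,
    MeasureTheory.integral_const_mul, MeasureTheory.integral_const_mul, kap_int_one hΔ0, kap_int_two hΔ0,
    kap_int_four hΔ0] at hlow
  have e1 : 4 / (a ^ 2 + γ ^ 2) * (m2 / Δ ^ 2) + 4 / (a ^ 2 + γ ^ 2) / a ^ 2 * (m4 / Δ ^ 4)
     = 4 * (a ^ 2 / (a ^ 2 + γ ^ 2)) * (m2 / (Δ * a) ^ 2 + m4 / (Δ * a) ^ 4) := by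
    field_simp
  have e2 : 4 * (a ^ 2 / (a ^ 2 + γ ^ 2)) * (m2 / (Δ * a) ^ 2 + m4 / (Δ * a) ^ 4) ≤ 4 * (a ^ 2 / (a ^ 2 + γ ^ 2)) * (3 / 8) := by
    gcongr
  have e3 : Real.log (b ^ 2 + γ ^ 2) ≤ Real.log (a ^ 2 / 4 + γ ^ 2) := by
    apply Real.log_le_log (by positivity); nlinarith
  have e4 : Real.log ((a ^ 2 / 4 + γ ^ 2) / (a ^ 2 + γ ^ 2)) ≤ (a ^ 2 / 4 + γ ^ 2) / (a ^ 2 + γ ^ 2) - 1 :=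
    Real.log_le_sub_one_of_pos (by positivity)
  rw [Real.log_div (by positivity) hA.ne'] at e4
  have e5 : (a ^ 2 / 4 + γ ^ 2) / (a ^ 2 + γ ^ 2) - 1 = - (3 / 4) * (a ^ 2 / (a ^ 2 + γ ^ 2)) := by
    field_simp; ring
  linarith


lemma sum_range_zmod {q : ℕ} [NeZero q] (f : ZMod q → ℂ) : ∑ i ∈ range q, f (i : ZMod q) = ∑ a : ZMod q, f a := by
  refine Finset.sum_nbij' (fun i => (i : ZMod q)) (fun a => a.val) ?_ ?_ ?_ ?_ ?_
  · intro a _; simp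
  · intro a _; simpa using ZMod.val_lt a
  · intro a ha; exact ZMod.val_cast_of_lt (by simpa using ha)
  · intro a _; simp
  · intro a _; rfl

lemma norm_char_le {q : ℕ} (χ : DirichletCharacter ℂ q) (a : ZMod q) : ‖χ a‖ ≤ 1 := DirichletCharacter.norm_le_one χ a

lemma char_range_bound {q : ℕ} [NeZero q] {χ : DirichletCharacter ℂ q} (hχ : χ ≠ 1) (N : ℕ) :
    ‖∑ n ∈ range N, χ (n : ZMod q)‖ ≤ q := by
  induction N using Nat.strong_induction_on with
  | _ N ih =>
    by_cases h : N < q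
    · calc ‖∑ n ∈ range N, χ (n : ZMod q)‖ ≤ ∑ n ∈ range N, (1:ℝ) :=
            norm_sum_le_of_le _ (fun n _ => norm_char_le χ _)
        _ = N := by simp
        _ ≤ q := by exact_mod_cast h.le
    · push Not at h
      have hq : 0 < q := Nat.pos_of_ne_zero (NeZero.ne q)
      have h1 := ih (N - q) (by omega)
      have h2 : ∑ n ∈ range N, χ (n : ZMod q) = ∑ n ∈ range (N - q), χ (n : ZMod q) := by
        conv_lhs => rw [show N = (N - q) + q by omega, Finset.sum_range_add]
        have : ∑ x ∈ range q, χ (((N - q + x : ℕ)) : ZMod q) = 0 := by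
          have e := sum_range_zmod (q := q) (fun a => χ (((N - q : ℕ) : ZMod q) + a))
          simp only [Nat.cast_add]
          rw [e]
          have e2 := Equiv.sum_comp (Equiv.addLeft ((N - q : ℕ) : ZMod q)) (fun a => χ a)
          simp only [Equiv.coe_addLeft] at e2
          rw [e2]
          exact MulChar.sum_eq_zero_of_ne_one hχ
        rw [this, add_zero]
      rw [h2]; exact h1

lemma char_zero {q : ℕ} [NeZero q] {χ : DirichletCharacter ℂ q} (hχ : χ ≠ 1) : χ 0 = 0 := by
  have hq : q ≠ 1 := by
    rintro rfl
    exact hχ (Subsingleton.elim _ _)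
  have : Fact (1 < q) := ⟨by have := NeZero.ne q; omega⟩
  exact MulChar.map_nonunit χ (by simp)

lemma char_Icc_eq {q : ℕ} [NeZero q] {χ : DirichletCharacter ℂ q} (hχ : χ ≠ 1) (N : ℕ) :
    ∑ n ∈ Icc 1 N, χ (n : ZMod q) = ∑ n ∈ range (N + 1), χ (n : ZMod q) := by
  rw [Finset.range_eq_Ico, Finset.sum_eq_sum_Ico_succ_bot (by omega)]
  simp only [Nat.cast_zero, char_zero hχ, zero_add]
  rfl

lemma char_Icc_bound {q : ℕ} [NeZero q] {χ : DirichletCharacter ℂ q} (hχ : χ ≠ 1) (N : ℕ) :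
    ‖∑ n ∈ Icc 1 N, χ (n : ZMod q)‖ ≤ q := by
  rw [char_Icc_eq hχ]; exact char_range_bound hχ _

noncomputable def SS {q : ℕ} (χ : DirichletCharacter ℂ q) (u : ℝ) : ℂ := ∑ n ∈ Icc 1 ⌊u⌋₊, χ (n : ZMod q)

lemma SS_meas {q : ℕ} (χ : DirichletCharacter ℂ q) : Measurable (SS χ) :=
  (measurable_from_nat (f := fun N => ∑ n ∈ Icc 1 N, χ (n : ZMod q))).comp Nat.measurable_floor

lemma SS_bound {q : ℕ} [NeZero q] {χ : DirichletCharacter ℂ q} (hχ : χ ≠ 1) (u : ℝ) : ‖SS χ u‖ ≤ q :=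
  char_Icc_bound hχ _

open MeasureTheory in
lemma Lfun_integrable {q : ℕ} [NeZero q] {χ : DirichletCharacter ℂ q} (hχ : χ ≠ 1) {s : ℂ} (hs : 0 < s.re) :
    IntegrableOn (fun u : ℝ => SS χ u * (u : ℂ) ^ (-(s + 1))) (Set.Ioi 1) := by
  have h1 : IntegrableOn (fun u : ℝ => (q:ℝ) * u ^ (-(s.re + 1))) (Set.Ioi 1) :=
    (integrableOn_Ioi_rpow_of_lt (by linarith) (by norm_num)).const_mul _
  refine h1.mono' ?_ ?_
  · refine ((SS_meas χ).aestronglyMeasurable).mul ?_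
    refine (ContinuousOn.aestronglyMeasurable ?_ measurableSet_Ioi)
    intro u hu
    have hu' : (1:ℝ) < u := hu
    exact (continuousAt_ofReal_cpow_const u _ (Or.inr (by linarith))).continuousWithinAt
  · refine (ae_restrict_iff' measurableSet_Ioi).2 (Filter.Eventually.of_forall fun u hu => ?_)
    have hu' : (1:ℝ) < u := hu
    rw [norm_mul, Complex.norm_cpow_eq_rpow_re_of_pos (by linarith)]
    simp only [neg_re, add_re, one_re]
    gcongr
    exact SS_bound hχ u

open MeasureTheory in
lemma mellin_SS {q : ℕ} (χ : DirichletCharacter ℂ q) (s : ℂ) :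
    mellin (Set.indicator (Set.Ioi 1) (SS χ)) (-s) = ∫ u in Set.Ioi (1:ℝ), SS χ u * (u : ℂ) ^ (-(s + 1)) := by
  rw [mellin]
  have : (fun t : ℝ => (t : ℂ) ^ (-s - 1) • Set.indicator (Set.Ioi 1) (SS χ) t) = Set.indicator (Set.Ioi 1) (fun u : ℝ => SS χ u * (u : ℂ) ^ (-(s + 1))) := by
    ext t
    by_cases ht : t ∈ Set.Ioi (1:ℝ)
    · rw [Set.indicator_of_mem ht, Set.indicator_of_mem ht, smul_eq_mul, mul_comm]
      congr 2; ring_nf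
    · rw [Set.indicator_of_notMem ht, Set.indicator_of_notMem ht, smul_zero]
  rw [this, setIntegral_indicator measurableSet_Ioi]
  rw [Set.inter_eq_right.2 (Set.Ioi_subset_Ioi (zero_le_one (α := ℝ)))]

open MeasureTheory in
lemma Lfun_eq {q : ℕ} [NeZero q] {χ : DirichletCharacter ℂ q} (hχ : χ ≠ 1) {s : ℂ} (hs : 0 < s.re) :
    DirichletCharacter.LFunction χ s = s * ∫ u in Set.Ioi (1:ℝ), SS χ u * (u : ℂ) ^ (-(s + 1)) := by
  set f : ℝ → ℂ := Set.indicator (Set.Ioi 1) (SS χ) with hf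
  have hmel : ∀ s : ℂ, mellin f (-s) = ∫ u in Set.Ioi (1:ℝ), SS χ u * (u : ℂ) ^ (-(s + 1)) := by
    exact mellin_SS χ
  have hdiff : ∀ s : ℂ, 0 < s.re → DifferentiableAt ℂ (mellin f) (-s) := by
    intro s hs
    refine mellin_differentiableAt_of_isBigO_rpow (a := 0) (b := (-s).re - 1) ?_ ?_ (by simpa using hs) ?_ (by linarith)
    · refine LocallyIntegrable.locallyIntegrableOn ?_ _
      have hc : LocallyIntegrable (fun _ : ℝ => (q:ℝ)) := continuous_const.locallyIntegrable
      refine hc.mono ((SS_meas χ).indicator measurableSet_Ioi).aestronglyMeasurable ?_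
      refine Filter.Eventually.of_forall fun u => ?_
      refine (norm_indicator_le_norm_self _ _).trans ?_
      simpa using SS_bound hχ u
    · refine Asymptotics.IsBigO.of_bound q (Filter.Eventually.of_forall fun u => ?_)
      simp only [neg_zero, Real.rpow_zero, norm_one, mul_one]
      exact (norm_indicator_le_norm_self _ _).trans (SS_bound hχ u)
    · refine Asymptotics.IsBigO.of_bound 0 ?_
      have : Set.Iio (1:ℝ) ∈ nhdsWithin (0:ℝ) (Set.Ioi 0) := mem_nhdsWithin_of_mem_nhds (Iio_mem_nhds (by norm_num))
      filter_upwards [this] with u hu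
      have : u ∉ Set.Ioi (1:ℝ) := by simp at hu ⊢; linarith
      rw [hf, Set.indicator_of_notMem this]; simp
  set U : Set ℂ := {s | 0 < s.re} with hU
  have hUo : IsOpen U := isOpen_lt continuous_const Complex.continuous_re
  have hUc : IsPreconnected U := (convex_halfSpace_re_gt 0).isPreconnected
  have hL : AnalyticOnNhd ℂ (DirichletCharacter.LFunction χ) U :=
    ((DirichletCharacter.differentiable_LFunction hχ).differentiableOn).analyticOnNhd hUo
  have hR : AnalyticOnNhd ℂ (fun s => s * mellin f (-s)) U := by
    refine DifferentiableOn.analyticOnNhd ?_ hUo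
    intro s hs
    exact (differentiableAt_id.mul ((hdiff s hs).comp s (differentiableAt_id.neg))).differentiableWithinAt
  have heq : DirichletCharacter.LFunction χ =ᶠ[nhds 2] (fun s => s * mellin f (-s)) := by
    have : {s : ℂ | 1 < s.re} ∈ nhds (2:ℂ) := (isOpen_lt continuous_const Complex.continuous_re).mem_nhds (by simp)
    filter_upwards [this] with s hs
    have hs' : 1 < s.re := hs
    rw [DirichletCharacter.LFunction_eq_LSeries χ hs', hmel]
    refine LSeries_eq_mul_integral _ (r := 0) le_rfl (by linarith) (DirichletCharacter.LSeriesSummable_of_one_lt_re χ hs') ?_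
    refine Asymptotics.IsBigO.of_bound q (Filter.Eventually.of_forall fun n => ?_)
    simpa using char_Icc_bound hχ n
  have := hL.eqOn_of_preconnected_of_eventuallyEq hR hUc (by simp [hU] : (2:ℂ) ∈ U) heq hs
  rw [this]; simp only [hmel]

open MeasureTheory in
lemma Lfun_bound {q : ℕ} [NeZero q] {χ : DirichletCharacter ℂ q} (hχ : χ ≠ 1) {s : ℂ} (hs : 0 < s.re) :
    ‖DirichletCharacter.LFunction χ s‖ ≤ q * ‖s‖ / s.re := by
  rw [Lfun_eq hχ hs, norm_mul]
  have h1 : IntegrableOn (fun u : ℝ => (q:ℝ) * u ^ (-(s.re + 1))) (Set.Ioi 1) :=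
    (integrableOn_Ioi_rpow_of_lt (by linarith) (by norm_num)).const_mul _
  have : ‖∫ u in Set.Ioi (1:ℝ), SS χ u * (u : ℂ) ^ (-(s + 1))‖ ≤ ∫ u in Set.Ioi (1:ℝ), (q:ℝ) * u ^ (-(s.re + 1)) := by
    refine norm_integral_le_of_norm_le h1 ?_
    refine (ae_restrict_iff' measurableSet_Ioi).2 (Filter.Eventually.of_forall fun u hu => ?_)
    have hu' : (1:ℝ) < u := hu
    rw [norm_mul, Complex.norm_cpow_eq_rpow_re_of_pos (by linarith)]
    simp only [neg_re, add_re, one_re]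
    gcongr
    exact SS_bound hχ u
  rw [integral_const_mul, integral_Ioi_rpow_of_lt (by linarith) (by norm_num)] at this
  have e : (q:ℝ) * (-1 ^ (-(s.re + 1) + 1) / (-(s.re + 1) + 1)) = q / s.re := by
    rw [Real.one_rpow, show -(s.re + 1) + 1 = -s.re by ring]; field_simp
  rw [e] at this
  calc ‖s‖ * _ ≤ ‖s‖ * (q / s.re) := by gcongr
    _ = _ := by ring


open MeasureTheory FourierTransform in
lemma bump_pair : ∃ (φ : ℝ → ℝ) (g : ℝ → ℂ) (C1 : ℝ), Continuous φ ∧ Integrable φ ∧ (∀ v, 0 ≤ φ v) ∧ 0 < ∫ v, φ v ∧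
    (∀ v, φ v ≠ 0 → 0 < v ∧ v < 1) ∧ Continuous g ∧ 0 < C1 ∧ (∀ ξ, ‖g ξ‖ ≤ C1 / (1 + ξ ^ 2)) ∧
    ∀ v, ∫ ξ : ℝ, Complex.exp (((-2 * π * v * ξ : ℝ) : ℂ) * I) * g ξ = (φ v : ℂ) := by
  let B : ContDiffBump (1/2 : ℝ) := ⟨1/8, 1/4, by norm_num, by norm_num⟩
  have hcs : HasCompactSupport (fun v : ℝ => ((B v : ℝ) : ℂ)) := B.hasCompactSupport.comp_left (g := fun x : ℝ => (x:ℂ)) (by simp)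
  have hcd : ContDiff ℝ (⊤ : ℕ∞) (fun v : ℝ => ((B v : ℝ) : ℂ)) :=
    (Complex.ofRealCLM.contDiff).comp B.contDiff
  let P : SchwartzMap ℝ ℂ := hcs.toSchwartzMap hcd
  let G : SchwartzMap ℝ ℂ := 𝓕⁻ P
  obtain ⟨c0, hc0, h0⟩ := G.decay 0 0
  obtain ⟨c2, hc2, h2⟩ := G.decay 2 0
  refine ⟨B, G, c0 + c2, B.continuous, B.integrable, fun v => B.nonneg, B.integral_pos, ?_, G.continuous, by positivity, ?_, ?_⟩
  · intro v hv
    have : v ∈ Function.support B := hv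
    rw [B.support_eq, Metric.mem_ball, Real.dist_eq, abs_lt] at this
    simp only [B] at this
    constructor <;> linarith [this.1, this.2]
  · intro ξ
    have a0 := h0 ξ
    have a2 := h2 ξ
    simp only [pow_zero, one_mul, norm_iteratedFDeriv_zero, Real.norm_eq_abs, sq_abs] at a0 a2
    rw [le_div_iff₀ (by positivity)]
    linarith
  · intro v
    have h : 𝓕 G = P := fourier_fourierInv_eq P
    have h' : (𝓕 G) v = P v := by rw [h]
    rw [SchwartzMap.fourier_coe, Real.fourier_real_eq_integral_exp_smul] at h'
    have e : P v = ((B v : ℝ) : ℂ) := rfl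
    rw [← e, ← h']
    congr 1; ext ξ
    rw [smul_eq_mul]
    congr 3
    ring_nf


open MeasureTheory FourierTransform in
lemma fourier_adj {f g : ℝ → ℂ} (hf : Integrable f) (hg : Integrable g) : ∫ u, f u * 𝓕 g u = ∫ ξ, 𝓕 f ξ * g ξ := by
  have := VectorFourier.integral_bilin_fourierIntegral_eq_flip (ContinuousLinearMap.mul ℂ ℂ) (L := innerₗ ℝ) (e := 𝐞) (μ := volume) (ν := volume) Real.continuous_fourierChar continuous_inner hf hg
  rw [flip_innerₗ] at this
  exact this.symm

lemma Ldiv_bound {q : ℕ} [NeZero q] {χ : DirichletCharacter ℂ q} (hχ : χ ≠ 1) {s : ℂ} (hs : 1/2 ≤ s.re) :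
    ‖DirichletCharacter.LFunction χ s‖ / ‖s‖ ≤ 2 * q := by
  have h1 := Lfun_bound hχ (s := s) (by linarith)
  have hs0 : 0 < ‖s‖ := norm_pos_iff.2 (fun h => by rw [h] at hs; simp at hs; linarith)
  rw [div_le_iff₀ hs0]
  refine h1.trans ?_
  rw [div_le_iff₀ (by linarith)]
  nlinarith [mul_nonneg (Nat.cast_nonneg (α := ℝ) q) hs0.le]

lemma Lline_cont {q : ℕ} [NeZero q] {χ : DirichletCharacter ℂ q} (hχ : χ ≠ 1) {σ : ℝ} (hσ : 0 < σ) :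
    Continuous (fun t : ℝ => ‖DirichletCharacter.LFunction χ (σ + t * I)‖ / ‖(σ + t * I : ℂ)‖) := by
  have h1 : Continuous (DirichletCharacter.LFunction χ) := (DirichletCharacter.differentiable_LFunction hχ).continuous
  refine Continuous.div (by fun_prop) (by fun_prop) (fun t => ?_)
  rw [norm_ne_zero_iff]
  intro h
  have := congrArg Complex.re h
  simp at this; linarith

open MeasureTheory FourierTransform in
lemma perron0 : ∃ C1 : ℝ, 0 < C1 ∧ ∀ (q : ℕ) [NeZero q] (χ : DirichletCharacter ℂ q), χ ≠ 1 →
    ∀ σ : ℝ, 1/2 ≤ σ → ∀ N : ℕ, 1 ≤ N →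
    ‖∑ n ∈ Icc 1 N, χ (n : ZMod q)‖ ≤ C1 * ((N:ℝ) + 1) ^ σ *
      ∫ t : ℝ, ‖DirichletCharacter.LFunction χ (σ + t * I)‖ / ‖(σ + t * I : ℂ)‖ / (1 + (t / N) ^ 2) := by
  obtain ⟨φ, g, C0, hφc, hφi, hφ0, hφp, hφs, hgc, hC0, hg, hgφ⟩ := bump_pair
  set c0 := ∫ v, φ v with hc0
  refine ⟨C0 * 200 / c0, by positivity, fun q _ χ hχ σ hσ N hN => ?_⟩
  have hN1 : (1:ℝ) ≤ N := by exact_mod_cast hN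
  set l := Real.log (N + 1) with hl
  set δ := l - Real.log N with hδ
  have hδpos : 0 < δ := by
    have := Real.log_lt_log (by linarith) (by linarith : (N:ℝ) < N + 1)
    rw [hδ]; linarith
  have hδlow : 1 / (2 * N) ≤ δ := by
    have h := Real.one_sub_inv_le_log_of_pos (x := ((N:ℝ) + 1) / N) (by positivity)
    rw [Real.log_div (by positivity) (by positivity)] at h
    have : 1 / (2 * (N:ℝ)) ≤ 1 - (((N:ℝ) + 1) / N)⁻¹ := by
      rw [inv_div, div_le_iff₀ (by positivity)]
      field_simp; linarith
    linarith
  have hlog0 : 0 ≤ Real.log N := Real.log_nonneg hN1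
  -- the function gN
  set gN : ℝ → ℂ := fun ξ => Complex.exp (((-2 * π * l * ξ : ℝ) : ℂ) * I) * g (δ * ξ) with hgN
  have hgNn : ∀ ξ, ‖gN ξ‖ ≤ C0 / (1 + (δ * ξ) ^ 2) := by
    intro ξ
    rw [hgN]; simp only [norm_mul, Complex.norm_exp_ofReal_mul_I, one_mul]; exact hg _
  have hwi : Integrable (fun ξ : ℝ => C0 / (1 + (δ * ξ) ^ 2)) := by
    have := (integrable_inv_one_add_sq.comp_mul_left' hδpos.ne').const_mul C0
    simpa [div_eq_mul_inv] using this
  have hgNi : Integrable gN := by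
    refine hwi.mono' (Continuous.aestronglyMeasurable (by rw [hgN]; fun_prop)) (Filter.Eventually.of_forall hgNn)
  have hFgN : ∀ u, 𝓕 gN u = ((δ⁻¹ * φ ((u + l) / δ) : ℝ) : ℂ) := by
    intro u
    rw [Real.fourier_real_eq_integral_exp_smul]
    have h1 := hgφ ((u + l) / δ)
    have h2 := Measure.integral_comp_mul_left (fun ξ : ℝ => Complex.exp (((-2 * π * ((u + l) / δ) * ξ : ℝ) : ℂ) * I) * g ξ) δ
    rw [h1, abs_of_pos (inv_pos.2 hδpos)] at h2
    rw [Complex.ofReal_mul, ← Complex.real_smul, ← h2]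
    congr 1; ext ξ
    rw [hgN, smul_eq_mul, ← mul_assoc, ← Complex.exp_add, ← add_mul, ← Complex.ofReal_add]
    congr 4
    field_simp; ring
  set f : ℝ → ℂ := Set.indicator (Set.Ioi 1) (SS χ) with hf
  set G : ℝ → ℂ := fun u => (Real.exp (σ * u)) • f (Real.exp (-u)) with hG
  have hGi : Integrable G := by
    have h1 : Integrable (Set.indicator (Set.Iic (0:ℝ)) (fun u => (q:ℝ) * Real.exp (σ * u))) := by
      rw [integrable_indicator_iff measurableSet_Iic]
      exact (integrableOn_exp_mul_Iic (by linarith) 0).const_mul _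
    refine h1.mono' ?_ (Filter.Eventually.of_forall fun u => ?_)
    · have : Measurable f := (SS_meas χ).indicator measurableSet_Ioi
      exact Measurable.aestronglyMeasurable (by rw [hG]; fun_prop)
    · rw [hG]
      simp only [norm_smul, Real.norm_eq_abs, Real.abs_exp]
      by_cases hu : u ∈ Set.Iic (0:ℝ)
      · rw [Set.indicator_of_mem hu, mul_comm]
        gcongr
        exact (norm_indicator_le_norm_self _ _).trans (SS_bound hχ _)
      · rw [Set.indicator_of_notMem hu]
        have : Real.exp (-u) ∉ Set.Ioi (1:ℝ) := by
          simp at hu ⊢; linarith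
        rw [hf, Set.indicator_of_notMem this]; simp
  have hFG : ∀ ξ, 𝓕 G ξ = DirichletCharacter.LFunction χ (σ + (-(2 * π) * ξ : ℝ) * I) / (σ + (-(2 * π) * ξ : ℝ) * I) := by
    intro ξ
    set s : ℂ := σ + (-(2 * π) * ξ : ℝ) * I with hs
    have hre : s.re = σ := by simp [hs]
    have him : s.im = -(2 * π) * ξ := by simp [hs]
    have h0 : s ≠ 0 := fun h => by rw [h] at hre; simp at hre; linarith
    have h1 := Lfun_eq hχ (s := s) (by rw [hre]; linarith)
    rw [← mellin_SS, mellin_eq_fourier] at h1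
    rw [h1, mul_div_cancel_left₀ _ h0]
    simp only [neg_re, neg_im, hre, him, neg_neg]
    rw [show -(-(2 * π) * ξ) / (2 * π) = ξ by field_simp]
  have hadj := fourier_adj hGi hgNi
  -- left side
  have hLs : ∀ u, G u * 𝓕 gN u = SS χ N * ((Real.exp (σ * u) * (δ⁻¹ * φ ((u + l) / δ)) : ℝ) : ℂ) := by
    intro u
    rw [hFgN]
    by_cases h0 : φ ((u + l) / δ) = 0
    · simp [h0]
    · obtain ⟨h1, h2⟩ := hφs _ h0
      rw [div_lt_one hδpos] at h2
      have h1' : 0 < u + l := by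
        by_contra hh; push Not at hh
        exact absurd h1 (not_lt.2 (div_nonpos_of_nonpos_of_nonneg hh hδpos.le))
      have h3 : (N:ℝ) < Real.exp (-u) := by
        rw [← Real.log_lt_iff_lt_exp (by linarith)]; rw [hδ] at h2; linarith
      have h4 : Real.exp (-u) < N + 1 := by
        rw [← Real.lt_log_iff_exp_lt (by linarith)]; linarith
      have h5 : ⌊Real.exp (-u)⌋₊ = N := by
        rw [Nat.floor_eq_iff (by positivity)]; exact ⟨h3.le, h4⟩
      have h6 : Real.exp (-u) ∈ Set.Ioi (1:ℝ) := by
        show 1 < Real.exp (-u); linarith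
      rw [hG]; simp only
      rw [hf, Set.indicator_of_mem h6, SS, h5, SS, Nat.floor_natCast, Complex.real_smul]
      push_cast; ring
  have hφint : Integrable (fun u => δ⁻¹ * φ ((u + l) / δ)) := by
    have := ((hφi.comp_div hδpos.ne').comp_add_right l).const_mul δ⁻¹
    exact this
  have hφval : ∫ u, δ⁻¹ * φ ((u + l) / δ) = c0 := by
    rw [integral_const_mul, integral_add_right_eq_self (fun u => φ (u / δ)) l, Measure.integral_comp_div]
    rw [abs_of_pos hδpos, smul_eq_mul, ← mul_assoc, inv_mul_cancel₀ hδpos.ne', one_mul]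
  have hJ : ((N:ℝ) + 1) ^ (-σ) * c0 ≤ ∫ u, Real.exp (σ * u) * (δ⁻¹ * φ ((u + l) / δ)) := by
    rw [← hφval, ← integral_const_mul]
    have hpt : ∀ u, φ ((u + l) / δ) ≠ 0 → -l ≤ u ∧ u ≤ 0 := by
      intro u h0
      obtain ⟨h1, h2⟩ := hφs _ h0
      rw [div_lt_one hδpos] at h2
      have h1' : 0 < u + l := by
        by_contra hh; push Not at hh
        exact absurd h1 (not_lt.2 (div_nonpos_of_nonpos_of_nonneg hh hδpos.le))
      constructor
      · linarith
      · rw [hδ] at h2; linarith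
    refine integral_mono (hφint.const_mul _) (hφint.mono' (Continuous.aestronglyMeasurable (by fun_prop)) ?_) ?_
    · refine Filter.Eventually.of_forall fun u => ?_
      have hnn : 0 ≤ δ⁻¹ * φ ((u + l) / δ) := mul_nonneg (inv_nonneg.2 hδpos.le) (hφ0 _)
      rw [norm_mul, Real.norm_eq_abs, Real.norm_eq_abs, Real.abs_exp, abs_of_nonneg hnn]
      by_cases h0 : φ ((u + l) / δ) = 0
      · simp [h0]
      · have := (hpt u h0).2
        have : Real.exp (σ * u) ≤ 1 := Real.exp_le_one_iff.2 (by nlinarith)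
        nlinarith
    · intro u
      have hnn : 0 ≤ δ⁻¹ * φ ((u + l) / δ) := mul_nonneg (inv_nonneg.2 hδpos.le) (hφ0 _)
      by_cases h0 : φ ((u + l) / δ) = 0
      · simp [h0]
      · have := (hpt u h0).1
        have : ((N:ℝ) + 1) ^ (-σ) ≤ Real.exp (σ * u) := by
          rw [Real.rpow_def_of_pos (by linarith), Real.exp_le_exp]; nlinarith
        exact mul_le_mul_of_nonneg_right this hnn
  have hJ0 : 0 ≤ ∫ u, Real.exp (σ * u) * (δ⁻¹ * φ ((u + l) / δ)) :=
    integral_nonneg fun u => mul_nonneg (Real.exp_pos _).le (mul_nonneg (inv_nonneg.2 hδpos.le) (hφ0 _))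
  simp only [hLs] at hadj
  rw [integral_const_mul, integral_complex_ofReal] at hadj
  -- right side
  set H : ℝ → ℝ := fun t => ‖DirichletCharacter.LFunction χ (σ + t * I)‖ / ‖(σ + t * I : ℂ)‖ / (1 + (t / N) ^ 2) with hH
  have hHi : Integrable H := by
    have h1 : Integrable (fun t : ℝ => (2 * q : ℝ) * (1 + (t / N) ^ 2)⁻¹) :=
      (integrable_inv_one_add_sq.comp_div (by positivity)).const_mul _
    refine h1.mono' (Continuous.aestronglyMeasurable ?_) (Filter.Eventually.of_forall fun t => ?_)
    · rw [hH]
      exact (Lline_cont hχ (by linarith)).div (by fun_prop) (fun t => by positivity)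
    · have h0 : 0 ≤ H t := by rw [hH]; positivity
      rw [Real.norm_eq_abs, abs_of_nonneg h0, hH]
      simp only
      rw [div_eq_mul_inv]
      exact mul_le_mul_of_nonneg_right (Ldiv_bound hχ (by simpa using hσ)) (by positivity)
  have hR : ‖∫ ξ, 𝓕 G ξ * gN ξ‖ ≤ ∫ ξ, (C0 * 1000) * H (-(2 * π) * ξ) := by
    refine norm_integral_le_of_norm_le ((hHi.comp_mul_left' (by simp [Real.pi_ne_zero])).const_mul _)
      (Filter.Eventually.of_forall fun ξ => ?_)
    rw [norm_mul, hFG, norm_div, hH]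
    simp only
    have hw : C0 / (1 + (δ * ξ) ^ 2) ≤ C0 * 1000 / (1 + (-(2 * π) * ξ / N) ^ 2) := by
      rw [div_le_div_iff₀ (by positivity) (by positivity)]
      have h1 : (-(2 * π) * ξ / N) ^ 2 ≤ 200 * (δ * ξ) ^ 2 := by
        have : (1 / N : ℝ) ^ 2 ≤ 4 * δ ^ 2 := by
          have h2 : (1 / N : ℝ) ≤ 2 * δ := by
            have : (1 / N : ℝ) = 2 * (1 / (2 * N)) := by field_simp
            rw [this]; linarith
          calc (1 / N : ℝ) ^ 2 ≤ (2 * δ) ^ 2 := by gcongr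
            _ = _ := by ring
        have hpi : π ^ 2 ≤ 12 := by nlinarith [Real.pi_lt_d2, Real.pi_pos]
        calc (-(2 * π) * ξ / N) ^ 2 = 4 * π ^ 2 * ξ ^ 2 * (1 / N) ^ 2 := by field_simp; ring
          _ ≤ 4 * 12 * ξ ^ 2 * (4 * δ ^ 2) := by gcongr
          _ ≤ _ := by nlinarith [sq_nonneg (δ * ξ), sq_nonneg δ, sq_nonneg ξ]
      nlinarith [mul_le_mul_of_nonneg_left h1 hC0.le, sq_nonneg (δ * ξ), mul_nonneg hC0.le (sq_nonneg (δ * ξ))]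
    calc _ ≤ ‖DirichletCharacter.LFunction χ (σ + (-(2 * π) * ξ : ℝ) * I)‖ / ‖(σ + (-(2 * π) * ξ : ℝ) * I : ℂ)‖ * (C0 * 1000 / (1 + (-(2 * π) * ξ / N) ^ 2)) := by
          gcongr
          exact (hgNn ξ).trans hw
      _ = _ := by ring
  rw [integral_const_mul, Measure.integral_comp_mul_left, ← hadj, norm_mul, Complex.norm_real, Real.norm_eq_abs, abs_of_nonneg hJ0] at hR
  have hHnn : 0 ≤ ∫ t, H t := integral_nonneg fun t => by rw [hH]; positivity
  have h2pi : |(-(2 * π))⁻¹| ≤ 1 / 5 := by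
    rw [abs_inv, abs_neg, abs_of_pos (by positivity), inv_eq_one_div]
    apply one_div_le_one_div_of_le (by norm_num); nlinarith [Real.pi_gt_three]
  have hfin : ‖SS χ N‖ * (((N:ℝ) + 1) ^ (-σ) * c0) ≤ C0 * 200 * ∫ t, H t := by
    calc _ ≤ ‖SS χ N‖ * ∫ u, Real.exp (σ * u) * (δ⁻¹ * φ ((u + l) / δ)) := by gcongr
      _ ≤ _ := hR
      _ ≤ C0 * 1000 * (1 / 5 * ∫ t, H t) := by
          rw [smul_eq_mul]; gcongr
      _ = _ := by ring
  rw [Real.rpow_neg (by positivity)] at hfin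
  have hp : 0 < ((N:ℝ) + 1) ^ σ := by positivity
  have e : SS χ N = ∑ n ∈ Icc 1 N, χ (n : ZMod q) := by rw [SS, Nat.floor_natCast]
  rw [← e]
  calc ‖SS χ N‖ = ‖SS χ N‖ * ((((N:ℝ) + 1) ^ σ)⁻¹ * c0) * (((N:ℝ) + 1) ^ σ / c0) := by field_simp
    _ ≤ (C0 * 200 * ∫ t, H t) * (((N:ℝ) + 1) ^ σ / c0) := by gcongr
    _ = _ := by ring

open MeasureTheory in
lemma perron : ∃ C1 : ℝ, 0 < C1 ∧ ∀ (q : ℕ) [NeZero q] (χ : DirichletCharacter ℂ q), χ ≠ 1 →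
    ∀ σ : ℝ, 1/2 ≤ σ → ∀ N : ℕ, 1 ≤ N → N ≤ q →
    ‖∑ n ∈ Icc 1 N, χ (n : ZMod q)‖ ≤ C1 * ((N:ℝ) + 1) ^ σ *
      (1 + ∫ t in Set.Icc (-(q:ℝ)^4) ((q:ℝ)^4), ‖DirichletCharacter.LFunction χ (σ + t * I)‖ / ‖(σ + t * I : ℂ)‖) := by
  obtain ⟨C1, hC1, h⟩ := perron0
  refine ⟨4 * C1, by positivity, fun q _ χ hχ σ hσ N hN hNq => ?_⟩
  refine (h q χ hχ σ hσ N hN).trans ?_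
  have hN1 : (1:ℝ) ≤ N := by exact_mod_cast hN
  have hNq' : (N:ℝ) ≤ q := by exact_mod_cast hNq
  have hq1 : (1:ℝ) ≤ q := hN1.trans hNq'
  set T : ℝ := (q:ℝ)^4 with hT
  have hT1 : 0 < T := by positivity
  set F : ℝ → ℝ := fun t => ‖DirichletCharacter.LFunction χ (σ + t * I)‖ / ‖(σ + t * I : ℂ)‖ with hF
  have hFc : Continuous F := Lline_cont hχ (by linarith)
  have hF0 : ∀ t, 0 ≤ F t := fun t => by rw [hF]; positivity
  have hFb : ∀ t, F t ≤ 2 * q := fun t => Ldiv_bound hχ (by simpa using hσ)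
  have e1 : IntegrableOn F (Set.Icc (-T) T) := hFc.continuousOn.integrableOn_compact isCompact_Icc
  have e2 : IntegrableOn (fun t : ℝ => (2 * q * N^2 : ℝ) * t ^ (-2:ℝ)) (Set.Ioi T) :=
    (integrableOn_Ioi_rpow_of_lt (by norm_num) hT1).const_mul _
  have i1 : Integrable (Set.indicator (Set.Icc (-T) T) F) := (integrable_indicator_iff measurableSet_Icc).2 e1
  have i2 : Integrable (Set.indicator (Set.Ioi T) (fun t : ℝ => (2 * q * N^2 : ℝ) * t ^ (-2:ℝ))) := (integrable_indicator_iff measurableSet_Ioi).2 e2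
  have i3 := i2.comp_neg
  have key : ∫ t, F t / (1 + (t / N) ^ 2) ≤ ∫ t, (Set.indicator (Set.Icc (-T) T) F t +
      (Set.indicator (Set.Ioi T) (fun t : ℝ => (2 * q * N^2 : ℝ) * t ^ (-2:ℝ)) t
       + Set.indicator (Set.Ioi T) (fun t : ℝ => (2 * q * N^2 : ℝ) * t ^ (-2:ℝ)) (-t))) := by
    refine integral_mono_of_nonneg (Filter.Eventually.of_forall fun t => div_nonneg (hF0 t) (by positivity)) (i1.add (i2.add i3)) (Filter.Eventually.of_forall fun t => ?_)
    have n2 : ∀ x, 0 ≤ Set.indicator (Set.Ioi T) (fun t : ℝ => (2 * q * N^2 : ℝ) * t ^ (-2:ℝ)) x := by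
      intro x
      refine Set.indicator_nonneg (fun x hx => ?_) x
      have : 0 < x := hT1.trans hx
      positivity
    have n1 : 0 ≤ Set.indicator (Set.Icc (-T) T) F t := Set.indicator_nonneg (fun x _ => hF0 x) t
    have dd : ∀ t : ℝ, T < |t| → F t / (1 + (t / N) ^ 2) = F t / (1 + (|t| / N) ^ 2) := by
      intro t _; rw [div_pow, div_pow, sq_abs]
    have cc : ∀ x : ℝ, T < x → ∀ y : ℝ, y ≤ 2 * q → 0 ≤ y → y / (1 + (x / N) ^ 2) ≤ (2 * q * N^2 : ℝ) * x ^ (-2:ℝ) := by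
      intro x hx y hy hy0
      have hx0 : 0 < x := hT1.trans hx
      have : x ^ (-2:ℝ) = (x ^ 2)⁻¹ := by
        rw [Real.rpow_neg hx0.le]; norm_num
      rw [this, div_le_iff₀ (by positivity)]
      have : (2 * q * N^2 : ℝ) * (x ^ 2)⁻¹ * (1 + (x / N) ^ 2) = 2 * q * N^2 / x^2 + 2 * q := by
        field_simp
      rw [this]
      have : 0 ≤ 2 * q * N^2 / x^2 := by positivity
      linarith
    simp only
    by_cases h1 : |t| ≤ T
    · have m : t ∈ Set.Icc (-T) T := abs_le.1 h1
      rw [Set.indicator_of_mem m]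
      have : F t / (1 + (t / N) ^ 2) ≤ F t := div_le_self (hF0 t) (by nlinarith [sq_nonneg (t / N)])
      linarith [n2 t, n2 (-t)]
    · push Not at h1
      rcases le_total 0 t with ht | ht
      · rw [abs_of_nonneg ht] at h1
        have m : t ∈ Set.Ioi T := h1
        have b := cc t h1 (F t) (hFb t) (hF0 t)
        have n3 := n2 (-t)
        rw [Set.indicator_of_mem m]
        linarith
      · rw [abs_of_nonpos ht] at h1
        have m : -t ∈ Set.Ioi T := h1
        have b := cc (-t) h1 (F t) (hFb t) (hF0 t)
        rw [neg_div, neg_sq] at b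
        have n3 := n2 t
        rw [Set.indicator_of_mem m]
        linarith
  have s1 : ∫ t, (Set.indicator (Set.Icc (-T) T) F t +
      (Set.indicator (Set.Ioi T) (fun t : ℝ => (2 * q * N^2 : ℝ) * t ^ (-2:ℝ)) t
       + Set.indicator (Set.Ioi T) (fun t : ℝ => (2 * q * N^2 : ℝ) * t ^ (-2:ℝ)) (-t)))
      = (∫ t in Set.Icc (-T) T, F t) + 2 * (2 * q * N^2 / T) := by
    have i23 : Integrable (fun t => Set.indicator (Set.Ioi T) (fun t : ℝ => (2 * q * N^2 : ℝ) * t ^ (-2:ℝ)) t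
       + Set.indicator (Set.Ioi T) (fun t : ℝ => (2 * q * N^2 : ℝ) * t ^ (-2:ℝ)) (-t)) := i2.add i3
    rw [integral_add i1 i23, integral_add i2 i3, integral_indicator measurableSet_Icc,
      integral_neg_eq_self (Set.indicator (Set.Ioi T) (fun t : ℝ => (2 * q * N^2 : ℝ) * t ^ (-2:ℝ))) volume, integral_indicator measurableSet_Ioi,
      integral_const_mul, integral_Ioi_rpow_of_lt (by norm_num) hT1]
    have : -T ^ ((-2:ℝ) + 1) / (-2 + 1) = T⁻¹ := by
      norm_num [Real.rpow_neg_one]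
    rw [this]; ring
  have s2 : 2 * (2 * q * N^2 / T) ≤ 4 := by
    have : 2 * q * (N:ℝ)^2 / T ≤ 2 := by
      rw [div_le_iff₀ hT1, hT]
      have : (N:ℝ)^2 ≤ q^2 := by gcongr
      nlinarith [one_le_pow₀ hq1 (n := 3), pow_le_pow_right₀ hq1 (show 3 ≤ 4 by norm_num), mul_le_mul_of_nonneg_left this (by positivity : (0:ℝ) ≤ q)]
    linarith
  rw [s1] at key
  have s3 : 0 ≤ ∫ t in Set.Icc (-T) T, F t := setIntegral_nonneg measurableSet_Icc fun t _ => hF0 t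
  calc C1 * ((N:ℝ) + 1) ^ σ * ∫ t, F t / (1 + (t / N) ^ 2) ≤ C1 * ((N:ℝ) + 1) ^ σ * (4 * (1 + ∫ t in Set.Icc (-T) T, F t)) := by
        gcongr; linarith
    _ = _ := by ring


noncomputable def ac {q : ℕ} (χ : DirichletCharacter ℂ q) (n : ℕ) : ℂ :=
  χ (n : ZMod q) * ((ArithmeticFunction.vonMangoldt n / Real.log n : ℝ) : ℂ)

lemma lam_nonneg (n : ℕ) : 0 ≤ ArithmeticFunction.vonMangoldt n / Real.log n :=
  div_nonneg ArithmeticFunction.vonMangoldt_nonneg (Real.log_natCast_nonneg n)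

lemma lam_le_one (n : ℕ) : ArithmeticFunction.vonMangoldt n / Real.log n ≤ 1 :=
  div_le_one_of_le₀ ArithmeticFunction.vonMangoldt_le_log (Real.log_natCast_nonneg n)

lemma ac_le_one {q : ℕ} (χ : DirichletCharacter ℂ q) (n : ℕ) : ‖ac χ n‖ ≤ 1 := by
  rw [ac, norm_mul, Complex.norm_real, Real.norm_eq_abs, abs_of_nonneg (lam_nonneg n)]
  exact mul_le_one₀ (DirichletCharacter.norm_le_one χ _) (lam_nonneg n) (lam_le_one n)

lemma ac_one {q : ℕ} (χ : DirichletCharacter ℂ q) : ac χ 1 = 0 := by simp [ac]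

lemma ac_abs {q : ℕ} (χ : DirichletCharacter ℂ q) : LSeries.abscissaOfAbsConv (ac χ) ≤ 1 :=
  LSeries.abscissaOfAbsConv_le_of_le_const ⟨1, fun n _ => ac_le_one χ n⟩

lemma ac_abs' {q : ℕ} (χ : DirichletCharacter ℂ q) {s : ℂ} (hs : 1 < s.re) : LSeries.abscissaOfAbsConv (ac χ) < s.re :=
  (ac_abs χ).trans_lt (by exact_mod_cast hs)

lemma ac_deriv {q : ℕ} [NeZero q] (χ : DirichletCharacter ℂ q) {s : ℂ} (hs : 1 < s.re) :
    HasDerivAt (LSeries (ac χ)) (deriv (DirichletCharacter.LFunction χ) s / DirichletCharacter.LFunction χ s) s := by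
  have h := LSeries_hasDerivAt (ac_abs' χ hs)
  convert h using 1
  have e : LSeries (LSeries.logMul (ac χ)) s = LSeries ((fun n : ℕ => χ n) * (fun n : ℕ => (ArithmeticFunction.vonMangoldt n : ℂ))) s := by
    refine LSeries_congr (fun {n} hn => ?_) s
    rw [LSeries.logMul, ac, Pi.mul_apply]
    by_cases h1 : n = 1
    · subst h1; simp
    · have : (Real.log n) ≠ 0 := by
        have : 1 < n := by omega
        exact (Real.log_pos (by exact_mod_cast this)).ne'
      have h2 : Complex.log n ≠ 0 := by rw [← Complex.natCast_log]; exact_mod_cast this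
      rw [Complex.ofReal_div, Complex.natCast_log]
      field_simp
  rw [e, DirichletCharacter.LSeries_twist_vonMangoldt_eq χ hs, DirichletCharacter.deriv_LFunction_eq_deriv_LSeries χ hs,
    DirichletCharacter.LFunction_eq_LSeries χ hs]
  rw [neg_div, neg_neg]

lemma logL_exists {q : ℕ} [NeZero q] (χ : DirichletCharacter ℂ q) (hχ : χ ≠ 1)
    (hRH : ∀ s : ℂ, 0 < s.re → s.re < 1 → DirichletCharacter.LFunction χ s = 0 → s.re = 1/2) :
    ∃ g : ℂ → ℂ, DifferentiableOn ℂ g {s | 1/2 < s.re} ∧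
      (∀ s : ℂ, 1/2 < s.re → Complex.exp (g s) = DirichletCharacter.LFunction χ s) ∧
      (∀ s : ℂ, 1 < s.re → g s = LSeries (ac χ) s) := by
  have hLd := DirichletCharacter.differentiable_LFunction hχ
  have hne : ∀ s ∈ {s : ℂ | 1/2 < s.re}, DirichletCharacter.LFunction χ s ≠ 0 := by
    intro s hs h0
    simp only [Set.mem_ofPred_eq] at hs
    by_cases h1 : s.re < 1
    · have := hRH s (by linarith) h1 h0; linarith
    · exact DirichletCharacter.LFunction_ne_zero_of_one_le_re χ (Or.inl hχ) (not_lt.1 h1) h0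
  have hop : ∀ a : ℝ, IsOpen {s : ℂ | a < s.re} := fun a => isOpen_lt continuous_const Complex.continuous_re
  obtain ⟨g, hg, hge⟩ := log_branch (hop (1/2)) (convex_halfSpace_re_gt _) ⟨1, by norm_num⟩ hLd.differentiableOn hne
  have hgd : ∀ s : ℂ, 1 < s.re → HasDerivAt g (deriv (DirichletCharacter.LFunction χ) s / DirichletCharacter.LFunction χ s) s := by
    intro s hs
    have hs2 : s ∈ {s : ℂ | 1/2 < s.re} := by simp only [Set.mem_ofPred_eq]; linarith
    have d := hg.differentiableAt ((hop (1/2)).mem_nhds hs2)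
    have e1 : HasDerivAt (fun z => Complex.exp (g z)) (Complex.exp (g s) * deriv g s) s := d.hasDerivAt.cexp
    have e2 : HasDerivAt (fun z => Complex.exp (g z)) (deriv (DirichletCharacter.LFunction χ) s) s :=
      (hLd s).hasDerivAt.congr_of_eventuallyEq (Filter.eventually_of_mem ((hop (1/2)).mem_nhds hs2) fun z hz => hge z hz)
    have e3 := e1.unique e2
    rw [hge s hs2] at e3
    have : deriv g s = deriv (DirichletCharacter.LFunction χ) s / DirichletCharacter.LFunction χ s := by
      rw [← e3, mul_div_cancel_left₀ _ (hne s hs2)]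
    rw [← this]; exact d.hasDerivAt
  obtain ⟨c, hc⟩ := (hop 1).exists_is_const_of_fderiv_eq_zero (𝕜 := ℂ) (f := fun s => g s - LSeries (ac χ) s)
    (convex_halfSpace_re_gt _).isPreconnected
    (fun s hs => ((hgd s hs).sub (ac_deriv χ hs)).differentiableAt.differentiableWithinAt)
    (fun s hs => by
      have := ((hgd s hs).sub (ac_deriv χ hs)).hasFDerivAt.fderiv
      simp only [sub_self] at this
      simp only [Pi.zero_apply]
      refine Eq.trans ?_ (this.trans ?_)
      · rfl
      · ext; simp)
  have hexp : ∀ s : ℂ, 1 < s.re → DirichletCharacter.LFunction χ s = Complex.exp c * Complex.exp (LSeries (ac χ) s) := by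
    intro s hs
    rw [← Complex.exp_add, ← hc s hs, sub_add_cancel, hge s (by simp only [Set.mem_ofPred_eq]; linarith)]
  have t1 : Filter.Tendsto (fun x : ℝ => LSeries (ac χ) x) Filter.atTop (nhds 0) := by
    have := LSeries.tendsto_atTop (f := ac χ) ((ac_abs χ).trans_lt (by exact EReal.coe_lt_top 1))
    rwa [ac_one] at this
  have t2 : Filter.Tendsto (fun x : ℝ => LSeries (fun n : ℕ => χ n) x) Filter.atTop (nhds 1) := by
    have := LSeries.tendsto_atTop (f := fun n : ℕ => χ n) ((LSeries.abscissaOfAbsConv_le_of_le_const ⟨1, fun n _ => DirichletCharacter.norm_le_one χ _⟩).trans_lt (by exact EReal.coe_lt_top 1))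
    simpa using this
  have t3 : Filter.Tendsto (fun x : ℝ => LSeries (fun n : ℕ => χ n) x) Filter.atTop (nhds (Complex.exp c * Complex.exp 0)) := by
    refine Filter.Tendsto.congr' ?_ (((Complex.continuous_exp.tendsto 0).comp t1).const_mul (Complex.exp c))
    filter_upwards [Filter.eventually_gt_atTop 1] with x hx
    have hx' : 1 < (x:ℂ).re := by simpa using hx
    rw [Function.comp, ← hexp x hx', DirichletCharacter.LFunction_eq_LSeries χ hx']
  have hc1 : Complex.exp c = 1 := by
    have := tendsto_nhds_unique t3 t2
    simpa using this
  refine ⟨fun s => g s - c, hg.sub_const c, fun s hs => ?_, fun s hs => ?_⟩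
  · rw [Complex.exp_sub, hge s hs, hc1, div_one]
  · rw [← hc s hs]; ring

lemma g_tail {q : ℕ} [NeZero q] (χ : DirichletCharacter ℂ q) {g : ℂ → ℂ}
    (hg : ∀ s : ℂ, 1 < s.re → g s = LSeries (ac χ) s) {X : ℕ} (hX : 1 ≤ X) {s : ℂ} (hs : 2 ≤ s.re) :
    ‖g s - ∑ n ∈ Icc 1 X, ac χ n * (n:ℂ) ^ (-s)‖ ≤ 2 * (X:ℝ) ^ (2 - s.re) := by
  have hs1 : 1 < s.re := by linarith
  have hS : LSeriesSummable (ac χ) s := LSeriesSummable_of_abscissaOfAbsConv_lt_re (ac_abs' χ hs1)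
  have h1 : HasSum (LSeries.term (ac χ) s) (g s) := by rw [hg s hs1]; exact hS.hasSum
  have hterm : ∀ n ∈ Icc 1 X, LSeries.term (ac χ) s n = ac χ n * (n:ℂ) ^ (-s) := by
    intro n hn
    have : n ≠ 0 := by have := (mem_Icc.1 hn).1; omega
    rw [LSeries.term_of_ne_zero this, Complex.cpow_neg, div_eq_mul_inv]
  have h2 : HasSum (fun n => if n ∈ Icc 1 X then LSeries.term (ac χ) s n else 0) (∑ n ∈ Icc 1 X, ac χ n * (n:ℂ) ^ (-s)) := by
    have := hasSum_sum_of_ne_finset_zero (L := SummationFilter.unconditional ℕ) (f := fun n => if n ∈ Icc 1 X then LSeries.term (ac χ) s n else 0) (s := Icc 1 X)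
      (fun n hn => by simp only [hn, if_false])
    convert this using 1
    refine sum_congr rfl fun n hn => ?_
    rw [if_pos hn, hterm n hn]
  have h3 := h1.sub h2
  rw [← h3.tsum_eq]
  have h4 := hasSum_zeta_two.mul_left ((X:ℝ) ^ (2 - s.re))
  have hX0 : (0:ℝ) < X := by exact_mod_cast hX
  have h5 := tsum_of_norm_bounded h4 (f := fun n => LSeries.term (ac χ) s n - if n ∈ Icc 1 X then LSeries.term (ac χ) s n else 0) (by
    intro n
    by_cases hn : n ∈ Icc 1 X
    · rw [if_pos hn, sub_self, norm_zero]; positivity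
    · rw [if_neg hn, sub_zero]
      rcases Nat.eq_zero_or_pos n with h0 | h0
      · subst h0; simp
      · have hnX : X < n := by rw [mem_Icc] at hn; omega
        have hn0 : (0:ℝ) < n := by exact_mod_cast h0
        rw [LSeries.norm_term_eq, if_neg h0.ne']
        have e : (n:ℝ) ^ s.re = (n:ℝ) ^ (s.re - 2) * (n:ℝ) ^ 2 := by
          rw [← Real.rpow_natCast, ← Real.rpow_add hn0]; norm_num
        have e2 : (X:ℝ) ^ (2 - s.re) = 1 / (X:ℝ) ^ (s.re - 2) := by
          rw [one_div, ← Real.rpow_neg hX0.le]; ring_nf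
        rw [e, e2, div_mul_div_comm, one_mul]
        have : (X:ℝ) ^ (s.re - 2) ≤ (n:ℝ) ^ (s.re - 2) :=
          Real.rpow_le_rpow hX0.le (by exact_mod_cast hnX.le) (by linarith)
        exact div_le_div₀ (by norm_num) (ac_le_one χ n) (by positivity) (by gcongr))
  refine h5.trans ?_
  rw [mul_comm]
  have : π ^ 2 / 6 ≤ 2 := by nlinarith [Real.pi_lt_d2, Real.pi_pos]
  gcongr

lemma g_bd2 {q : ℕ} [NeZero q] (χ : DirichletCharacter ℂ q) {g : ℂ → ℂ}
    (hg : ∀ s : ℂ, 1 < s.re → g s = LSeries (ac χ) s) {s : ℂ} (hs : 2 ≤ s.re) : ‖g s‖ ≤ 2 := by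
  have := g_tail χ hg (le_refl 1) hs
  simpa [ac_one] using this

noncomputable def ell (q : ℕ) (t : ℝ) : ℝ := Real.log (q * (|t| + 3))

lemma ell_ge {q : ℕ} (hq : 3 ≤ q) (t : ℝ) : 2 ≤ ell q t := by
  have h1 : (3:ℝ) ≤ q := by exact_mod_cast hq
  rw [ell, Real.le_log_iff_exp_le (by positivity)]
  have : Real.exp 2 = Real.exp 1 ^ 2 := by rw [← Real.exp_nat_mul]; norm_num
  rw [this]
  have := Real.exp_one_lt_d9
  have h3 : Real.exp 1 ^ 2 ≤ 9 := by nlinarith [Real.exp_pos 1]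
  have : 0 ≤ |t| := abs_nonneg t
  nlinarith

lemma ell_add {q : ℕ} (hq : 3 ≤ q) (t v : ℝ) : ell q (t + v) ≤ ell q t * (1 + |v|) := by
  have h2 := ell_ge hq t
  have hq0 : (0:ℝ) < q := by exact_mod_cast (by omega : 0 < q)
  have h1 : ell q (t + v) ≤ ell q t + Real.log (1 + |v|) := by
    rw [ell, ell, ← Real.log_mul (by positivity) (by positivity)]
    refine Real.log_le_log (by positivity) ?_
    rw [mul_assoc]
    gcongr
    have := abs_add_le t v
    nlinarith [abs_nonneg t, abs_nonneg v, mul_nonneg (abs_nonneg t) (abs_nonneg v)]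
  have h3 : Real.log (1 + |v|) ≤ |v| := by
    have := Real.log_le_sub_one_of_pos (show 0 < 1 + |v| by positivity); linarith
  nlinarith [abs_nonneg v]

lemma logL_le {q : ℕ} [NeZero q] (hq : 3 ≤ q) {χ : DirichletCharacter ℂ q} (hχ : χ ≠ 1) {t : ℝ} {s : ℂ}
    (hs : 1/2 ≤ s.re) (hsr : ‖s‖ ≤ 6 + |t|) : ‖DirichletCharacter.LFunction χ s‖ ≤ Real.exp (2 * ell q t) := by
  have h1 : (3:ℝ) ≤ q := by exact_mod_cast hq
  have h := Lfun_bound hχ (s := s) (by linarith)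
  refine h.trans ?_
  have : Real.exp (2 * ell q t) = (q * (|t| + 3)) ^ 2 := by
    rw [show 2 * ell q t = ell q t + ell q t by ring, Real.exp_add, ell, Real.exp_log (by positivity)]; ring
  rw [this, div_le_iff₀ (by linarith)]
  have ht := abs_nonneg t
  have a1 : (q:ℝ) * ‖s‖ ≤ q * (6 + |t|) := by gcongr
  have a2 : (q:ℝ) * (6 + |t|) ≤ (q * (|t| + 3)) ^ 2 * (1/2) := by
    have : (q * (|t| + 3)) ^ 2 * (1/2) = q * ((q:ℝ) * (|t| + 3)^2 / 2) := by ring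
    rw [this]; gcongr; nlinarith [mul_nonneg ht ht]
  have a3 : (q * (|t| + 3)) ^ 2 * (1/2) ≤ (q * (|t| + 3)) ^ 2 * s.re := by gcongr
  linarith

lemma g_rough {q : ℕ} [NeZero q] (hq : 3 ≤ q) (χ : DirichletCharacter ℂ q) (hχ : χ ≠ 1) {g : ℂ → ℂ}
    (hgd : DifferentiableOn ℂ g {s | 1/2 < s.re})
    (hge : ∀ s : ℂ, 1/2 < s.re → Complex.exp (g s) = DirichletCharacter.LFunction χ s)
    (hg : ∀ s : ℂ, 1 < s.re → g s = LSeries (ac χ) s) {s : ℂ} (hs : 1/2 < s.re) (hs3 : s.re ≤ 3) :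
    ‖g s‖ ≤ 20 * ell q s.im / (s.re - 1/2) := by
  set c : ℂ := 3 + s.im * I with hc
  have hcre : c.re = 3 := by simp [hc]
  have hcim : c.im = s.im := by simp [hc]
  have hre : ∀ z ∈ Metric.ball (0:ℂ) (5/2), 1/2 < (c + z).re := by
    intro z hz
    rw [mem_ball_zero_iff] at hz
    have := abs_le.1 (Complex.abs_re_le_norm z)
    rw [add_re, hcre]; linarith [this.1]
  have hz : s - c = ((s.re - 3 : ℝ) : ℂ) := by
    apply Complex.ext
    · rw [sub_re, hcre, Complex.ofReal_re]
    · rw [sub_im, hcim, Complex.ofReal_im]; ring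
  have hzn : ‖s - c‖ = 3 - s.re := by
    rw [hz, Complex.norm_real, Real.norm_eq_abs, abs_of_nonpos (by linarith)]; ring
  have hE := ell_ge hq s.im
  have := Complex.borelCaratheodory (M := 2 * ell q s.im) (R := 5/2) (f := fun z => g (c + z)) (z := s - c) (by linarith)
    (hgd.comp ((differentiable_const c).add differentiable_id).differentiableOn (fun z hz => hre z hz))
    (fun z hz => by
      simp only [Set.mem_ofPred_eq]
      have h1 := hge (c + z) (hre z hz)
      have h2 : Real.exp (g (c+z)).re ≤ Real.exp (2 * ell q s.im) := by
        rw [← Complex.norm_exp, h1]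
        refine logL_le hq hχ (hre z hz).le ?_
        rw [mem_ball_zero_iff] at hz
        have : ‖c‖ ≤ 3 + |s.im| := by
          refine (norm_add_le _ _).trans ?_
          simp
        have := norm_add_le c z
        linarith
      exact Real.exp_le_exp.1 h2)
    (by norm_num) (by rw [mem_ball_zero_iff, hzn]; linarith)
  simp only [add_sub_cancel, add_zero, hzn] at this
  refine this.trans ?_
  have hgc : ‖g c‖ ≤ 2 := g_bd2 χ hg (by rw [hcre]; norm_num)
  have e : (5/2 - (3 - s.re)) = s.re - 1/2 := by ring
  rw [e, ← add_div]
  refine div_le_div_of_nonneg_right ?_ (by linarith)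
  have a1 : 2 * (2 * ell q s.im) * (3 - s.re) ≤ 2 * (2 * ell q s.im) * (5/2) := by gcongr; linarith
  have a2 : ‖g c‖ * (5 / 2 + (3 - s.re)) ≤ 2 * 5 := mul_le_mul hgc (by linarith) (by linarith) (by norm_num)
  linarith


open MeasureTheory in
lemma shift_zero {R : ℂ → ℂ} {s0 : ℂ} {Δ A B : ℝ} (hΔ : 1 ≤ Δ) (hR : DifferentiableOn ℂ R {s | 1/2 < s.re})
    (hs0 : 1/2 < s0.re) (hA : 0 ≤ A) (hB : 0 ≤ B) (h1 : ∀ s : ℂ, s0.re ≤ s.re → ‖R s‖ ≤ A * (1 + |s.im - s0.im|))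
    (h2 : ∀ s : ℂ, s0.re + 2 ≤ s.re → ‖R s‖ ≤ B * Real.exp (-(7 * Δ * (s.re - s0.re)))) :
    ∫ v : ℝ, kap Δ v • R (s0 + v * I) = 0 := by
  have hI0 := I0_pos
  set K : ℂ → ℂ := fun z => ((Δ / I0 : ℝ) : ℂ) * cs (Δ * (-I * z)) ^ 6 with hK
  set Ψ : ℂ → ℂ := fun z => R (s0 + z) * K z with hΨ
  set E : ℝ := 64 * (Δ / I0) with hE
  have hEp : 0 < E := by positivity
  have hKn : ∀ x y : ℝ, 0 ≤ x → ‖K (x + y * I)‖ ≤ E * Real.exp (6 * Δ * x) / (1 + y ^ 2) ^ 3 := by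
    intro x y hx
    rw [hK]; simp only
    rw [norm_mul, Complex.norm_real, Real.norm_eq_abs, abs_of_nonneg (by positivity)]
    have h := norm_cs_pow_le (Δ * (-I * (x + y * I)))
    have e1 : (Δ * (-I * (x + y * I)) : ℂ) = ((Δ * y : ℝ) : ℂ) + ((-(Δ * x) : ℝ) : ℂ) * I := by
      push_cast
      have := Complex.I_mul_I
      linear_combination (-(Δ * y : ℂ)) * this
    have e2 : (Δ * (-I * (x + y * I)) : ℂ).im = -(Δ * x) := by rw [e1]; simp
    have e3 : (Δ * (-I * (x + y * I)) : ℂ).re = (Δ * y) := by rw [e1]; simp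
    have e4 : |y| ≤ ‖(Δ * (-I * (x + y * I)) : ℂ)‖ := by
      have := Complex.abs_re_le_norm (Δ * (-I * (x + y * I)) : ℂ)
      rw [e3, abs_mul, abs_of_nonneg (by linarith)] at this
      nlinarith [abs_nonneg y]
    rw [e2, abs_neg, abs_of_nonneg (by positivity)] at h
    have e5 : y ^ 2 ≤ ‖(Δ * (-I * (x + y * I)) : ℂ)‖ ^ 2 := by
      rw [← sq_abs y]; gcongr
    calc Δ / I0 * ‖cs (Δ * (-I * (x + y * I))) ^ 6‖ ≤ Δ / I0 * (64 * Real.exp (6 * (Δ * x)) / (1 + y ^ 2) ^ 3) := by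
          gcongr; refine h.trans ?_; gcongr
      _ = _ := by rw [hE, ← mul_assoc]; ring
  have hKr : ∀ v : ℝ, K (v * I) = (kap Δ v : ℂ) := by
    intro v
    rw [hK]; simp only
    have e1 : (Δ * (-I * (v * I)) : ℂ) = ((Δ * v : ℝ) : ℂ) := by
      push_cast
      have := Complex.I_mul_I
      linear_combination (-(Δ * v : ℂ)) * this
    rw [e1, cs_ofReal, kap]; push_cast; ring
  have hintg : (fun v : ℝ => kap Δ v • R (s0 + v * I)) = fun v : ℝ => Ψ (v * I) := by
    ext v; rw [hΨ]; simp only; rw [hKr, Complex.real_smul, mul_comm]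
  have hKd : Differentiable ℂ K := by
    have := cs_diff
    rw [hK]; fun_prop
  have hΨd : ∀ z : ℂ, 0 ≤ z.re → DifferentiableAt ℂ Ψ z := by
    intro z hz
    have hm : s0 + z ∈ {s : ℂ | 1/2 < s.re} := by simp only [Set.mem_ofPred_eq, add_re]; linarith
    have d := hR.differentiableAt ((isOpen_lt continuous_const Complex.continuous_re).mem_nhds hm)
    exact (DifferentiableAt.comp z d ((differentiableAt_const s0).add differentiableAt_id)).mul (hKd z)
  have hcont : Continuous (fun v : ℝ => R (s0 + v * I)) := by
    refine continuous_iff_continuousAt.2 fun v => ?_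
    have hm : s0 + v * I ∈ {s : ℂ | 1/2 < s.re} := by simp; linarith
    have d := hR.differentiableAt ((isOpen_lt continuous_const Complex.continuous_re).mem_nhds hm)
    exact ContinuousAt.comp (f := fun v : ℝ => s0 + v * I) d.continuousAt (by fun_prop)
  have hi : Integrable (fun v : ℝ => Ψ (v * I)) := by
    rw [← hintg]
    refine kap_integrable hΔ hcont.aestronglyMeasurable (A := 2 * A) fun v => ?_
    have := h1 (s0 + v * I) (by simp)
    simp only [add_im, mul_im, ofReal_re, I_im, mul_one, ofReal_im, I_re, mul_zero, add_zero, add_sub_cancel_left] at this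
    refine this.trans ?_
    have h3 : |v| ≤ 1 + v ^ 2 := by nlinarith [sq_abs v, sq_nonneg (|v| - 1), abs_nonneg v]
    nlinarith [sq_nonneg v, sq_nonneg (v^2), mul_nonneg hA (sq_nonneg v), mul_nonneg hA (sq_nonneg (v^2)), mul_le_mul_of_nonneg_left h3 hA]
  rw [hintg]
  have hlim := intervalIntegral_tendsto_integral hi Filter.tendsto_neg_atTop_atBot Filter.tendsto_id
  -- bound for each U
  have key : ∀ U : ℝ, 2 ≤ U → ‖∫ v : ℝ, Ψ (v * I)‖ ≤ B * E * π * Real.exp (-U) := by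
    intro U hU
    have hT : ∀ T : ℝ, 1 ≤ T → ‖∫ v in (-T)..T, Ψ (v * I)‖ ≤ B * E * π * Real.exp (-U) + 4 * (U * (A * E * Real.exp (6 * Δ * U))) * T⁻¹ := by
      intro T hT
      have hrect := Complex.integral_boundary_rect_eq_zero_of_differentiableOn Ψ (-T * I) (U + T * I) (by
        intro z hz
        refine (hΨd z ?_).differentiableWithinAt
        have := hz.1
        simp [Set.uIcc_of_le (by linarith : (0:ℝ) ≤ U)] at this
        exact this.1)
      simp only [neg_mul, neg_re, neg_im, mul_re, mul_im, ofReal_re, ofReal_im, I_re, I_im, mul_zero, mul_one, zero_mul, sub_zero, add_zero, zero_add, add_re, add_im, sub_self, neg_zero, ofReal_zero] at hrect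
      have htop : ∀ y : ℝ, |y| = T → ‖∫ x in (0:ℝ)..U, Ψ (x + y * I)‖ ≤ 2 * (A * E * Real.exp (6 * Δ * U)) * T⁻¹ * U := by
        intro y hy
        have := intervalIntegral.norm_integral_le_of_norm_le_const (a := 0) (b := U) (f := fun x : ℝ => Ψ (x + y * I)) (C := 2 * (A * E * Real.exp (6 * Δ * U)) * T⁻¹) (by
          intro x hx
          rw [Set.uIoc_of_le (by linarith)] at hx
          rw [hΨ]; simp only
          rw [norm_mul]
          have a1 := h1 (s0 + (x + y * I)) (by simp; exact hx.1.le)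
          have a2 : (s0 + (x + y * I)).im - s0.im = y := by simp
          rw [a2, hy] at a1
          have a3 := hKn x y hx.1.le
          have a4 : y ^ 2 = T ^ 2 := by rw [← sq_abs, hy]
          rw [a4] at a3
          have a5 : Real.exp (6 * Δ * x) ≤ Real.exp (6 * Δ * U) := by
            rw [Real.exp_le_exp]; exact mul_le_mul_of_nonneg_left hx.2 (by positivity)
          have a6 : (1 + T) / (1 + T ^ 2) ^ 3 ≤ 2 * T⁻¹ := by
            rw [← div_eq_mul_inv, div_le_div_iff₀ (by positivity) (by positivity)]
            have : T * T ≤ (1 + T ^ 2) ^ 3 := by nlinarith [sq_nonneg (T^2), sq_nonneg T, mul_nonneg (sq_nonneg T) (sq_nonneg (T^2))]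
            nlinarith
          calc ‖R (s0 + (x + y * I))‖ * ‖K (x + y * I)‖ ≤ (A * (1 + T)) * (E * Real.exp (6 * Δ * U) / (1 + T ^ 2) ^ 3) := by
                refine mul_le_mul a1 (a3.trans ?_) (norm_nonneg _) (by positivity)
                gcongr
            _ = A * E * Real.exp (6 * Δ * U) * ((1 + T) / (1 + T ^ 2) ^ 3) := by ring
            _ ≤ A * E * Real.exp (6 * Δ * U) * (2 * T⁻¹) := by gcongr
            _ = _ := by ring)
        rwa [sub_zero, abs_of_nonneg (by linarith)] at this
      have hright : ‖∫ y in (-T)..T, Ψ (U + y * I)‖ ≤ B * E * π * Real.exp (-U) := by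
        have b1 : ∀ y : ℝ, ‖Ψ (U + y * I)‖ ≤ B * E * Real.exp (-U) * (1 + y ^ 2)⁻¹ := by
          intro y
          rw [hΨ]; simp only
          rw [norm_mul]
          have a1 := h2 (s0 + (U + y * I)) (by simp; exact hU)
          have a2 : (s0 + (U + y * I)).re - s0.re = U := by simp
          rw [a2] at a1
          have a3 := hKn U y (by linarith)
          have a6 : 1 / (1 + y ^ 2) ^ 3 ≤ (1 + y ^ 2)⁻¹ := by
            rw [inv_eq_one_div]
            apply one_div_le_one_div_of_le (by positivity)
            nlinarith [sq_nonneg y, sq_nonneg (y^2), mul_nonneg (sq_nonneg y) (sq_nonneg (y^2))]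
          have a7 : Real.exp (-(7 * Δ * U)) * Real.exp (6 * Δ * U) ≤ Real.exp (-U) := by
            rw [← Real.exp_add, Real.exp_le_exp]; nlinarith
          calc _ ≤ (B * Real.exp (-(7 * Δ * U))) * (E * Real.exp (6 * Δ * U) / (1 + y ^ 2) ^ 3) := by
                gcongr
            _ = B * E * (Real.exp (-(7 * Δ * U)) * Real.exp (6 * Δ * U)) * (1 / (1 + y ^ 2) ^ 3) := by ring
            _ ≤ _ := by gcongr
        have b2 : Integrable (fun y : ℝ => B * E * Real.exp (-U) * (1 + y ^ 2)⁻¹) := integrable_inv_one_add_sq.const_mul _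
        have b3 := intervalIntegral.norm_integral_le_of_norm_le (μ := volume) (show -T ≤ T by linarith) (Filter.Eventually.of_forall fun y _ => b1 y) b2.intervalIntegrable
        refine b3.trans ?_
        rw [intervalIntegral.integral_of_le (by linarith)]
        refine (setIntegral_le_integral b2 (Filter.Eventually.of_forall fun y => by simp only [Pi.zero_apply]; positivity)).trans ?_
        rw [integral_const_mul, integral_univ_inv_one_add_sq]
        exact le_of_eq (by ring)
      have ht1 := htop (-T) (by rw [abs_neg, abs_of_nonneg]; linarith)
      have ht2 := htop T (by rw [abs_of_nonneg]; linarith)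
      set I1 := ∫ x in (0:ℝ)..U, Ψ (x + (-T : ℝ) * I)
      set I2 := ∫ x in (0:ℝ)..U, Ψ (x + T * I)
      set I3 := ∫ y in (-T)..T, Ψ (U + y * I)
      set I4 := ∫ v in (-T)..T, Ψ (v * I)
      have e : I • I4 = I1 - I2 + I • I3 := by
        rw [eq_comm, ← sub_eq_zero]; exact hrect
      have e2 : ‖I4‖ = ‖I1 - I2 + I • I3‖ := by rw [← e, norm_smul, Complex.norm_I, one_mul]
      rw [e2]
      have n1 := norm_add_le (I1 - I2) (I • I3)
      have n2 := norm_sub_le I1 I2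
      rw [norm_smul, Complex.norm_I, one_mul] at n1
      linarith
    have l2 : Filter.Tendsto (fun T : ℝ => B * E * π * Real.exp (-U) + 4 * (U * (A * E * Real.exp (6 * Δ * U))) * T⁻¹) Filter.atTop (nhds (B * E * π * Real.exp (-U) + 4 * (U * (A * E * Real.exp (6 * Δ * U))) * 0)) :=
      (tendsto_inv_atTop_zero.const_mul _).const_add _
    have := le_of_tendsto_of_tendsto hlim.norm l2 (by filter_upwards [Filter.eventually_ge_atTop 1] with T hh using hT T hh)
    simpa using this
  have l3 : Filter.Tendsto (fun U : ℝ => B * E * π * Real.exp (-U)) Filter.atTop (nhds (B * E * π * 0)) :=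
    Real.tendsto_exp_neg_atTop_nhds_zero.const_mul _
  have := ge_of_tendsto l3 (by filter_upwards [Filter.eventually_ge_atTop 2] with U hh using key U hh)
  rw [mul_zero] at this
  exact norm_le_zero_iff.1 this


noncomputable def Wk (Δ : ℝ) (n : ℕ) : ℂ := ∫ v : ℝ, kap Δ v • (n:ℂ) ^ (-(v * I))

lemma norm_npow_I (n : ℕ) (hn : 1 ≤ n) (v : ℝ) : ‖(n:ℂ) ^ (-(v * I))‖ = 1 := by
  rw [Complex.norm_natCast_cpow_of_pos hn]; simp

lemma npow_cont (n : ℕ) (hn : 1 ≤ n) : Continuous (fun v : ℝ => (n:ℂ) ^ (-(v * I))) := by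
  have hn0 : (n:ℂ) ≠ 0 := by exact_mod_cast (by omega : n ≠ 0)
  simp only [Complex.cpow_def_of_ne_zero hn0]
  fun_prop

lemma Wk_int {Δ : ℝ} (hΔ : 1 ≤ Δ) (n : ℕ) (hn : 1 ≤ n) : MeasureTheory.Integrable (fun v : ℝ => kap Δ v • (n:ℂ) ^ (-(v * I))) :=
  kap_integrable hΔ (npow_cont n hn).aestronglyMeasurable (A := 1) fun v => by
    rw [norm_npow_I n hn]; nlinarith [sq_nonneg v, sq_nonneg (v^2)]

lemma Wk_le {Δ : ℝ} (hΔ : 1 ≤ Δ) (n : ℕ) (hn : 1 ≤ n) : ‖Wk Δ n‖ ≤ 1 := by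
  have h0 : 0 < Δ := by linarith
  rw [← kap_int_one h0, Wk]
  refine MeasureTheory.norm_integral_le_of_norm_le (kap_j0 hΔ) (Filter.Eventually.of_forall fun v => ?_)
  rw [norm_smul, norm_npow_I n hn, mul_one, Real.norm_eq_abs, abs_of_nonneg (kap_nonneg h0 v)]

open MeasureTheory in
lemma shift_main {q : ℕ} [NeZero q] (hq : 3 ≤ q) (χ : DirichletCharacter ℂ q) (hχ : χ ≠ 1) {g : ℂ → ℂ}
    (hgd : DifferentiableOn ℂ g {s | 1/2 < s.re})
    (hge : ∀ s : ℂ, 1/2 < s.re → Complex.exp (g s) = DirichletCharacter.LFunction χ s)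
    (hg : ∀ s : ℂ, 1 < s.re → g s = LSeries (ac χ) s) {Δ : ℝ} (hΔ : 1 ≤ Δ) {X : ℕ} (hX : Real.exp (7 * Δ) ≤ X)
    {s0 : ℂ} (hs0 : 1/2 < s0.re) :
    Integrable (fun v : ℝ => kap Δ v • g (s0 + v * I)) ∧
    ∫ v : ℝ, kap Δ v • g (s0 + v * I) = ∑ n ∈ Icc 1 X, ac χ n * (n:ℂ) ^ (-s0) * Wk Δ n := by
  have hX0 : (0:ℝ) < X := (Real.exp_pos _).trans_le hX
  have hX1 : 1 ≤ X := by exact_mod_cast hX0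
  set P : ℂ → ℂ := fun s => ∑ n ∈ Icc 1 X, ac χ n * (n:ℂ) ^ (-s) with hP
  have hPd : Differentiable ℂ P := by
    rw [hP]
    refine Differentiable.fun_sum fun n hn => ?_
    have hn0 : (n:ℂ) ≠ 0 := by exact_mod_cast (by have := (mem_Icc.1 hn).1; omega : n ≠ 0)
    simp only [Complex.cpow_def_of_ne_zero hn0]
    fun_prop
  have hPb : ∀ s : ℂ, 0 < s.re → ‖P s‖ ≤ X := by
    intro s hs
    rw [hP]
    refine (norm_sum_le _ _).trans ?_
    have : ∑ n ∈ Icc 1 X, ‖ac χ n * (n:ℂ) ^ (-s)‖ ≤ ∑ n ∈ Icc 1 X, (1:ℝ) := by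
      refine sum_le_sum fun n hn => ?_
      have hn1 := (mem_Icc.1 hn).1
      rw [norm_mul, Complex.norm_natCast_cpow_of_pos hn1]
      refine mul_le_one₀ (ac_le_one χ n) (by positivity) ?_
      refine Real.rpow_le_one_of_one_le_of_nonpos (by exact_mod_cast hn1) (by simp; exact hs.le)
    simpa using this
  have hE := ell_ge hq s0.im
  set A0 : ℝ := 20 * ell q s0.im / (s0.re - 1/2) + 2 with hA0
  have hd : 0 < s0.re - 1/2 := by linarith
  have hA0p : 0 ≤ 20 * ell q s0.im / (s0.re - 1/2) := by positivity
  have hgb : ∀ s : ℂ, s0.re ≤ s.re → ‖g s‖ ≤ A0 * (1 + |s.im - s0.im|) := by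
    intro s hs
    have hv := abs_nonneg (s.im - s0.im)
    by_cases h3 : s.re ≤ 3
    · refine (g_rough hq χ hχ hgd hge hg (by linarith) h3).trans ?_
      have h4 := ell_add hq s0.im (s.im - s0.im)
      rw [add_sub_cancel] at h4
      have h5 := ell_ge hq s.im
      calc 20 * ell q s.im / (s.re - 1/2) ≤ 20 * (ell q s0.im * (1 + |s.im - s0.im|)) / (s0.re - 1/2) := by
            gcongr
        _ = (20 * ell q s0.im / (s0.re - 1/2)) * (1 + |s.im - s0.im|) := by ring
        _ ≤ _ := by gcongr; linarith
    · refine (g_bd2 χ hg (by linarith)).trans ?_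
      nlinarith
  have hcont : Continuous (fun v : ℝ => g (s0 + v * I)) := by
    refine continuous_iff_continuousAt.2 fun v => ?_
    have hm : s0 + v * I ∈ {s : ℂ | 1/2 < s.re} := by simp; linarith
    have d := hgd.differentiableAt ((isOpen_lt continuous_const Complex.continuous_re).mem_nhds hm)
    exact ContinuousAt.comp (f := fun v : ℝ => s0 + v * I) d.continuousAt (by fun_prop)
  have hi : Integrable (fun v : ℝ => kap Δ v • g (s0 + v * I)) := by
    refine kap_integrable hΔ hcont.aestronglyMeasurable (A := 2 * A0) fun v => ?_
    have := hgb (s0 + v * I) (by simp)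
    simp only [add_im, mul_im, ofReal_re, I_im, mul_one, ofReal_im, I_re, mul_zero, add_zero, add_sub_cancel_left] at this
    refine this.trans ?_
    have h3 : 1 + |v| ≤ 2 * (1 + v ^ 2) ^ 2 := by nlinarith [sq_abs v, sq_nonneg (|v| - 1), abs_nonneg v, sq_nonneg (v^2)]
    calc A0 * (1 + |v|) ≤ A0 * (2 * (1 + v ^ 2) ^ 2) := by gcongr
      _ = _ := by ring
  refine ⟨hi, ?_⟩
  have hz := shift_zero (R := fun s => g s - P s) (s0 := s0) (A := A0 + X) (B := 2 * (X:ℝ) ^ (2:ℝ)) hΔ (hgd.sub hPd.differentiableOn) hs0 (by positivity) (by positivity)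
    (fun s hs => by
      refine (norm_sub_le _ _).trans ?_
      have a1 := hgb s hs
      have a2 := hPb s (by linarith)
      have : 0 ≤ (X:ℝ) * |s.im - s0.im| := by positivity
      linarith)
    (fun s hs => by
      refine (g_tail χ hg hX1 (by linarith)).trans ?_
      rw [sub_eq_add_neg, Real.rpow_add hX0, mul_assoc]
      gcongr
      rw [Real.rpow_neg hX0.le, Real.exp_neg]
      apply inv_anti₀ (Real.exp_pos _)
      calc Real.exp (7 * Δ * (s.re - s0.re)) ≤ Real.exp (7 * Δ * s.re) := by
            rw [Real.exp_le_exp]; gcongr; linarith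
        _ = Real.exp (7 * Δ) ^ s.re := by rw [← Real.exp_mul]
        _ ≤ _ := Real.rpow_le_rpow (Real.exp_pos _).le hX (by linarith))
  have hterm : ∀ n ∈ Icc 1 X, ∀ v : ℝ, kap Δ v • (ac χ n * (n:ℂ) ^ (-(s0 + v * I))) = ac χ n * (n:ℂ) ^ (-s0) * (kap Δ v • (n:ℂ) ^ (-(v * I))) := by
    intro n hn v
    have hn0 : (n:ℂ) ≠ 0 := by exact_mod_cast (by have := (mem_Icc.1 hn).1; omega : n ≠ 0)
    rw [neg_add, Complex.cpow_add _ _ hn0, Complex.real_smul, Complex.real_smul]; ring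
  have hPe : ∀ v : ℝ, kap Δ v • P (s0 + v * I) = ∑ n ∈ Icc 1 X, ac χ n * (n:ℂ) ^ (-s0) * (kap Δ v • (n:ℂ) ^ (-(v * I))) := by
    intro v
    rw [hP]; simp only
    rw [smul_sum]
    exact sum_congr rfl fun n hn => hterm n hn v
  have hPi : ∀ n ∈ Icc 1 X, Integrable (fun v : ℝ => ac χ n * (n:ℂ) ^ (-s0) * (kap Δ v • (n:ℂ) ^ (-(v * I)))) :=
    fun n hn => (Wk_int hΔ n (mem_Icc.1 hn).1).const_mul _
  have hPI : ∫ v : ℝ, kap Δ v • P (s0 + v * I) = ∑ n ∈ Icc 1 X, ac χ n * (n:ℂ) ^ (-s0) * Wk Δ n := by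
    simp only [hPe]
    rw [integral_finset_sum _ hPi]
    refine sum_congr rfl fun n hn => ?_
    rw [integral_const_mul, Wk]
  have hPii : Integrable (fun v : ℝ => kap Δ v • P (s0 + v * I)) := by
    simp only [hPe]
    exact integrable_finset_sum _ hPi
  simp only [smul_sub] at hz
  rw [integral_sub hi hPii, sub_eq_zero] at hz
  rw [hz, hPI]


lemma norm_half (x y : ℝ) : Real.log ‖(x + y * I : ℂ)‖ = 1/2 * Real.log (x ^ 2 + y ^ 2) := by
  rw [Complex.norm_add_mul_I, Real.log_sqrt (by positivity)]; ring

open MeasureTheory in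
lemma list_one_dim {Δ a b t0 : ℝ} (hΔ : 1 ≤ Δ) (hb : 0 < b) (hba : b ≤ a / 2)
    (hm : m2 / (Δ * a) ^ 2 + m4 / (Δ * a) ^ 4 ≤ 3/8) (Z : List ℂ) (hZ : ∀ ρ ∈ Z, ρ.re = 1/2) :
    Integrable (fun v : ℝ => (Z.map (fun ρ => Real.log ‖((1/2 + a : ℝ) + (t0 + v : ℝ) * I : ℂ) - ρ‖)).sum * kap Δ v) ∧
    (Z.map (fun ρ => Real.log ‖((1/2 + b : ℝ) + t0 * I : ℂ) - ρ‖)).sum ≤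
      ∫ v : ℝ, (Z.map (fun ρ => Real.log ‖((1/2 + a : ℝ) + (t0 + v : ℝ) * I : ℂ) - ρ‖)).sum * kap Δ v := by
  induction Z with
  | nil => simp
  | cons ρ Z ih =>
    obtain ⟨i1, i2⟩ := ih (fun ρ h => hZ ρ (List.mem_cons_of_mem _ h))
    have hρ := hZ ρ List.mem_cons_self
    have ha : 0 < a := by linarith
    have e : ∀ x y : ℝ, Real.log ‖((1/2 + x : ℝ) + (y : ℝ) * I : ℂ) - ρ‖ = 1/2 * Real.log (x ^ 2 + (y - ρ.im) ^ 2) := by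
      intro x y
      rw [← norm_half]
      congr 2
      apply Complex.ext
      · simp [hρ]
      · simp
    have hi : Integrable (fun v : ℝ => (1/2 * Real.log (a ^ 2 + (t0 + v - ρ.im) ^ 2)) * kap Δ v) := by
      have : Integrable (fun v : ℝ => Real.log (a ^ 2 + ((t0 - ρ.im) + v) ^ 2) * kap Δ v) := by
        refine kap_integrable_real hΔ ?_ (log_growth ha (t0 - ρ.im))
        refine Continuous.aestronglyMeasurable (Continuous.log (by fun_prop) (fun v => by positivity))
      convert this.const_mul (1/2) using 2 with v
      rw [show t0 + v - ρ.im = t0 - ρ.im + v by ring]; ring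
    have ho := one_dim hΔ hb hba hm (t0 - ρ.im)
    have hI : ∫ v : ℝ, (1/2 * Real.log (a ^ 2 + (t0 + v - ρ.im) ^ 2)) * kap Δ v = 1/2 * ∫ v, Real.log (a ^ 2 + ((t0 - ρ.im) + v) ^ 2) * kap Δ v := by
      rw [← integral_const_mul]
      congr 1; ext v
      rw [show t0 + v - ρ.im = t0 - ρ.im + v by ring]; ring
    simp only [List.map_cons, List.sum_cons, e, add_mul]
    refine ⟨hi.add i1, ?_⟩
    rw [integral_add hi i1, hI]
    have : Real.log (b ^ 2 + (t0 - ρ.im) ^ 2) ≤ ∫ v, Real.log (a ^ 2 + ((t0 - ρ.im) + v) ^ 2) * kap Δ v := ho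
    linarith

set_option maxHeartbeats 2000000 in
open MeasureTheory in
lemma main_ineq : ∃ lam C : ℝ, 1 ≤ lam ∧ 0 < C ∧ ∀ (q : ℕ) [NeZero q], 3 ≤ q → ∀ χ : DirichletCharacter ℂ q, χ ≠ 1 →
    (∀ s : ℂ, 0 < s.re → s.re < 1 → DirichletCharacter.LFunction χ s = 0 → s.re = 1/2) →
    ∀ (t0 Δ b : ℝ) (X : ℕ), 2 * lam ≤ Δ → 0 < b → b ≤ lam / (2 * Δ) → Real.exp (7 * Δ) ≤ X →
    Real.log ‖DirichletCharacter.LFunction χ ((1/2 + b : ℝ) + t0 * I)‖ ≤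
      (∑ n ∈ Icc 1 X, ac χ n * (n:ℂ) ^ (-((1/2 + lam / Δ : ℝ) + t0 * I : ℂ)) * Wk Δ n).re + C * ell q t0 / Δ := by
  have hm2 := m2_nonneg
  have hm4 := m4_nonneg
  set lam : ℝ := 1 + 3 * (m2 + m4) with hlam
  have hlam1 : 1 ≤ lam := by rw [hlam]; linarith
  refine ⟨lam, 3 * (4000 * lam + 2000 + 2000 * m2 + 19200 * m2), hlam1, by positivity, ?_⟩
  intro q _ hq χ hχ hRH t0 Δ b X hΔl hb hbl hX
  have hΔ : 1 ≤ Δ := by linarith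
  have hΔ0 : 0 < Δ := by linarith
  set a : ℝ := lam / Δ with ha
  have ha0 : 0 < a := by positivity
  have ha2 : a ≤ 1/2 := by rw [ha, div_le_iff₀ hΔ0]; linarith
  have hba : b ≤ a / 2 := by
    refine hbl.trans (le_of_eq ?_); rw [ha]; field_simp
  have hΔa : Δ * a = lam := by rw [ha]; field_simp
  have hm : m2 / (Δ * a) ^ 2 + m4 / (Δ * a) ^ 4 ≤ 3/8 := by
    rw [hΔa]
    have l2 : lam ≤ lam ^ 2 := by nlinarith
    have l4 : lam ≤ lam ^ 4 := by nlinarith [sq_nonneg (lam^2), sq_nonneg lam]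
    have : m2 / lam ^ 2 ≤ m2 / lam := by gcongr
    have : m4 / lam ^ 4 ≤ m4 / lam := by gcongr
    have : m2 / lam + m4 / lam ≤ 3/8 := by
      rw [← add_div, div_le_iff₀ (by linarith), hlam]; nlinarith
    linarith
  obtain ⟨g, hgd, hge, hg⟩ := logL_exists χ hχ hRH
  have hE := ell_ge hq t0
  set M : ℝ := 3 * ell q t0 with hM
  set c : ℂ := (2:ℝ) + t0 * I with hc
  have hq3 : (3:ℝ) ≤ q := by exact_mod_cast hq
  have hcre : c.re = 2 := by simp [hc]
  have hcim : c.im = t0 := by simp [hc]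
  have hcn : ‖c‖ ≤ 2 + |t0| := by
    refine (norm_add_le _ _).trans ?_
    simp
  have hballre : ∀ r : ℝ, ∀ z : ℂ, ‖z - c‖ ≤ r → 2 - r ≤ z.re := by
    intro r z hz
    have := (abs_le.1 ((Complex.abs_re_le_norm (z - c)).trans hz)).1
    rw [sub_re, hcre] at this; linarith
  obtain ⟨Z, h, hZlen, hZ, hfac, hlip, hh⟩ := local_fac c isOpen_univ (Set.subset_univ _)
    (DirichletCharacter.differentiable_LFunction hχ).differentiableOn (M := M) (by rw [hM]; linarith)
    (by
      intro z hz
      rw [mem_closedBall_iff_norm] at hz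
      have hre := hballre _ z hz
      have hre0 : 0 < z.re := by norm_num at hre ⊢; linarith
      refine (Lfun_bound hχ hre0).trans ?_
      have e3 : Real.exp M = (q * (|t0| + 3)) ^ 3 := by
        rw [hM, show 3 * ell q t0 = ell q t0 + ell q t0 + ell q t0 by ring, Real.exp_add, Real.exp_add, ell, Real.exp_log (by positivity)]; ring
      rw [e3, div_le_iff₀ hre0]
      have hzn : ‖z‖ ≤ 4 + |t0| := by
        have := norm_add_le (z - c) c
        rw [sub_add_cancel] at this
        linarith
      have ht := abs_nonneg t0
      have p1 : (9:ℝ) ≤ q * (|t0| + 3) := by nlinarith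
      have p2 : (81:ℝ) ≤ (q * (|t0| + 3)) ^ 2 := by nlinarith
      calc (q:ℝ) * ‖z‖ ≤ q * (4 + |t0|) := by gcongr
        _ ≤ 81 * (q * (|t0| + 3)) * (1/10) := by nlinarith
        _ ≤ (q * (|t0| + 3)) ^ 2 * (q * (|t0| + 3)) * z.re := by
            have : 1/10 ≤ z.re := by norm_num at hre ⊢; linarith
            gcongr
        _ = _ := by ring)
    (by
      rw [← hge c (by rw [hcre]; norm_num), Complex.norm_exp, Real.exp_le_exp]
      have h1 := g_bd2 χ hg (s := c) (by rw [hcre])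
      have h2 := (abs_le.1 ((Complex.abs_re_le_norm (g c)).trans h1)).1
      linarith)
  have hZre : ∀ ρ ∈ Z, ρ.re = 1/2 := by
    intro ρ hρ
    obtain ⟨z1, z2⟩ := hZ ρ hρ
    have := hballre _ ρ z2
    by_cases h1 : ρ.re < 1
    · exact hRH ρ (by norm_num at this; linarith) h1 z1
    · exact absurd z1 (DirichletCharacter.LFunction_ne_zero_of_one_le_re χ (Or.inl hχ) (not_lt.1 h1))
  obtain ⟨iF, hF⟩ := list_one_dim (t0 := t0) hΔ hb hba hm Z hZre
  have hdist : ∀ x y : ℝ, ‖((1/2 + x : ℝ) + (t0 + y : ℝ) * I : ℂ) - c‖ = √((x - 3/2)^2 + y^2) := by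
    intro x y
    rw [hc, show ((1/2 + x : ℝ) + (t0 + y : ℝ) * I : ℂ) - ((2:ℝ) + t0 * I) = ((x - 3/2 : ℝ) : ℂ) + (y:ℝ) * I by push_cast; ring,
      Complex.norm_add_mul_I]
  set s1 : ℂ := (1/2 + b : ℝ) + t0 * I with hs1
  set F : ℝ → ℝ := fun v => (Z.map (fun ρ => Real.log ‖((1/2 + a : ℝ) + (t0 + v : ℝ) * I : ℂ) - ρ‖)).sum with hFd
  have hs1c : ‖s1 - c‖ ≤ 1.5 := by
    have := hdist b 0
    rw [add_zero] at this
    rw [hs1, this, Real.sqrt_le_left (by norm_num)]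
    norm_num; nlinarith
  have hs1m : s1 ∈ Metric.closedBall c 1.6 := by
    rw [mem_closedBall_iff_norm]; exact hs1c.trans (by norm_num)
  have hcm : c ∈ Metric.closedBall c 1.6 := Metric.mem_closedBall_self (by norm_num)
  have hs1re : 1/2 < s1.re := by simp [hs1]; exact hb
  have hLs1 : DirichletCharacter.LFunction χ s1 ≠ 0 := by rw [← hge s1 hs1re]; exact Complex.exp_ne_zero _
  have hlog1 := hfac s1 hs1m hLs1
  have hh1 : h s1 ≤ 6100 * M := by
    have l1 := (abs_le.1 (hlip s1 hs1m c hcm)).2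
    have l2 := (abs_le.1 hh).2
    have : 4000 * M * ‖s1 - c‖ ≤ 4000 * M * 1.5 := by gcongr
    norm_num at this; linarith
  set s0 : ℂ := (1/2 + a : ℝ) + t0 * I with hs0
  have hs0re : s0.re = 1/2 + a := by simp [hs0]
  obtain ⟨ig, hgI⟩ := shift_main hq χ hχ hgd hge hg hΔ hX (s0 := s0) (by rw [hs0re]; linarith)
  have hsv : ∀ v : ℝ, s0 + v * I = ((1/2 + a : ℝ) + (t0 + v : ℝ) * I : ℂ) := by
    intro v; rw [hs0]; push_cast; ring
  have hsvre : ∀ v : ℝ, (s0 + v * I).re = 1/2 + a := by intro v; rw [hsv]; simp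
  have hsvim : ∀ v : ℝ, (s0 + v * I).im = t0 + v := by intro v; rw [hsv]; simp
  have ire : Integrable (fun v : ℝ => (g (s0 + v * I)).re * kap Δ v) := by
    have := ig.re
    refine this.congr (Filter.Eventually.of_forall fun v => ?_)
    simp [mul_comm]
  have hreI : ∫ v : ℝ, (g (s0 + v * I)).re * kap Δ v = (∑ n ∈ Icc 1 X, ac χ n * (n:ℂ) ^ (-s0) * Wk Δ n).re := by
    rw [← hgI]
    have := integral_re ig
    simp only [RCLike.re_to_complex] at this
    rw [← this]
    congr 1; ext v; simp [mul_comm]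
  have hlogL : ∀ v : ℝ, (g (s0 + v * I)).re = Real.log ‖DirichletCharacter.LFunction χ (s0 + v * I)‖ := by
    intro v
    rw [← hge _ (by rw [hsvre]; linarith), Complex.norm_exp, Real.log_exp]
  have hpt : ∀ v : ℝ, F v + h s1 - (g (s0 + v * I)).re ≤ M * (4000 * a + 2000 / Δ) + M * (2000 * Δ + 19200 / a) * v ^ 2 := by
    intro v
    have hv0 := abs_nonneg v
    have hM0 : 0 < M := by rw [hM]; linarith
    have hamgm : |v| ≤ 1 / (2 * Δ) + Δ / 2 * v ^ 2 := by
      rw [← sq_abs v]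
      have : 0 ≤ (Δ * |v| - 1) ^ 2 / (2 * Δ) := by positivity
      have e : (Δ * |v| - 1) ^ 2 / (2 * Δ) = Δ / 2 * |v| ^ 2 - |v| + 1 / (2 * Δ) := by field_simp; ring
      linarith
    have b1 : 4000 * M * (a + |v|) ≤ M * (4000 * a + 2000 / Δ) + M * (2000 * Δ) * v ^ 2 := by
      have := mul_le_mul_of_nonneg_left hamgm (by positivity : 0 ≤ 4000 * M)
      have e : 4000 * M * (1 / (2 * Δ) + Δ / 2 * v ^ 2) = M * (2000 / Δ) + M * (2000 * Δ) * v ^ 2 := by field_simp; ring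
      linarith
    have b0 : 0 ≤ M * (19200 / a) * v ^ 2 := by positivity
    by_cases hv : |v| ≤ 1/2
    · have hmem : s0 + v * I ∈ Metric.closedBall c 1.6 := by
        rw [mem_closedBall_iff_norm, hsv, hdist, Real.sqrt_le_left (by norm_num)]
        have : v ^ 2 ≤ 1/4 := by rw [← sq_abs]; nlinarith
        norm_num; nlinarith
      have hne : DirichletCharacter.LFunction χ (s0 + v * I) ≠ 0 := by
        rw [← hge _ (by rw [hsvre]; linarith)]; exact Complex.exp_ne_zero _
      have e := hfac _ hmem hne
      rw [hlogL v, e, hsv]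
      have l1 := (abs_le.1 (hlip s1 hs1m _ hmem)).2
      have l2 : ‖s1 - (s0 + v * I)‖ ≤ a + |v| := by
        rw [show s1 - (s0 + v * I) = ((b - a : ℝ) : ℂ) - v * I by rw [hs1, hs0]; push_cast; ring]
        refine (norm_sub_le _ _).trans ?_
        rw [norm_mul, Complex.norm_I, Complex.norm_real, Complex.norm_real, Real.norm_eq_abs, Real.norm_eq_abs, mul_one, abs_of_nonpos (by linarith)]
        linarith
      have l3 : 4000 * M * ‖s1 - (s0 + v * I)‖ ≤ 4000 * M * (a + |v|) := by gcongr
      rw [hsv] at l1 l3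
      have : F v = (Z.map (fun ρ => Real.log ‖((1/2 + a : ℝ) + (t0 + v : ℝ) * I : ℂ) - ρ‖)).sum := rfl
      rw [this]
      linarith
    · push Not at hv
      have f1 : F v ≤ 60 * M * (4 + |v|) := by
        have : ∀ Y : List ℂ, (∀ ρ ∈ Y, ‖ρ - c‖ ≤ 1.7) → (Y.map (fun ρ => Real.log ‖((1/2 + a : ℝ) + (t0 + v : ℝ) * I : ℂ) - ρ‖)).sum ≤ Y.length * (4 + |v|) := by
          intro Y hY
          induction Y with
          | nil => simp
          | cons ρ Y ih =>
            have i1 := ih (fun ρ h => hY ρ (List.mem_cons_of_mem _ h))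
            have i2 := hY ρ List.mem_cons_self
            have i3 : Real.log ‖((1/2 + a : ℝ) + (t0 + v : ℝ) * I : ℂ) - ρ‖ ≤ 4 + |v| := by
              refine (Real.log_le_self (norm_nonneg _)).trans ?_
              have n1 := norm_sub_le_norm_sub_add_norm_sub (((1/2 + a : ℝ) + (t0 + v : ℝ) * I : ℂ)) c ρ
              have n2 : ‖((1/2 + a : ℝ) + (t0 + v : ℝ) * I : ℂ) - c‖ ≤ 3/2 + |v| := by
                rw [hdist]
                rw [Real.sqrt_le_left (by positivity)]
                rw [← sq_abs v]; nlinarith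
              rw [norm_sub_rev c ρ] at n1
              norm_num at i2 ⊢
              norm_num at n1 n2
              linarith
            simp only [List.map_cons, List.sum_cons, List.length_cons]
            rw [Nat.cast_add, Nat.cast_one, add_mul, one_mul]
            linarith
        refine (this Z (fun ρ hρ => (hZ ρ hρ).2)).trans ?_
        gcongr
      have f2 : -(g (s0 + v * I)).re ≤ 7 * M * (1 + |v|) / a := by
        have g1 := g_rough hq χ hχ hgd hge hg (s := s0 + v * I) (by rw [hsvre]; linarith) (by rw [hsvre]; linarith)
        rw [hsvre, hsvim, add_sub_cancel_left] at g1
        have g2 := (abs_le.1 ((Complex.abs_re_le_norm (g (s0 + v * I))).trans g1)).1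
        have g3 : 20 * ell q (t0 + v) / a ≤ 7 * M * (1 + |v|) / a := by
          have := ell_add hq t0 v
          refine div_le_div_of_nonneg_right ?_ ha0.le
          have h21 : 7 * M * (1 + |v|) = 21 * (ell q t0 * (1 + |v|)) := by rw [hM]; ring
          have h22 : 0 ≤ ell q t0 * (1 + |v|) := by positivity
          linarith
        linarith
      have f3 : 1 + |v| ≤ 6 * v ^ 2 := by rw [← sq_abs v]; nlinarith
      have f4 : 60 * M * (4 + |v|) + 6100 * M ≤ 3193 * M * (1 + |v|) / a := by
        rw [le_div_iff₀ ha0]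
        have : (60 * M * (4 + |v|) + 6100 * M) ≤ 6340 * M * (1 + |v|) := by nlinarith
        have : (60 * M * (4 + |v|) + 6100 * M) * a ≤ 6340 * M * (1 + |v|) * (1/2) := by gcongr
        nlinarith
      have f5 : 3193 * M * (1 + |v|) / a + 7 * M * (1 + |v|) / a ≤ M * (19200 / a) * v ^ 2 := by
        have : M * (19200 / a) * v ^ 2 = 3200 * M * (6 * v ^ 2) / a := by ring
        rw [this, ← add_div]
        gcongr
        nlinarith
      have : 0 ≤ 4000 * M * (a + |v|) := by positivity
      linarith
  -- integrate
  have j0 := kap_j0 hΔ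
  have j2 := kap_j2 hΔ
  have hmono : ∫ v : ℝ, (F v + h s1 - (g (s0 + v * I)).re) * kap Δ v ≤ ∫ v : ℝ, ((M * (4000 * a + 2000 / Δ)) * kap Δ v + (M * (2000 * Δ + 19200 / a)) * (v ^ 2 * kap Δ v)) := by
    refine integral_mono ?_ ((j0.const_mul _).add (j2.const_mul _)) fun v => ?_
    · have := (iF.add (j0.const_mul (h s1))).sub ire
      refine this.congr (Filter.Eventually.of_forall fun v => ?_)
      simp only [Pi.add_apply, Pi.sub_apply]; ring
    · have := mul_le_mul_of_nonneg_right (hpt v) (kap_nonneg hΔ0 v)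
      refine this.trans (le_of_eq ?_); ring
  have hlhs : ∫ v : ℝ, (F v + h s1 - (g (s0 + v * I)).re) * kap Δ v = (∫ v, F v * kap Δ v) + h s1 - (∑ n ∈ Icc 1 X, ac χ n * (n:ℂ) ^ (-s0) * Wk Δ n).re := by
    rw [← hreI]
    have e : (fun v : ℝ => (F v + h s1 - (g (s0 + v * I)).re) * kap Δ v) = fun v => (F v * kap Δ v + h s1 * kap Δ v) - (g (s0 + v * I)).re * kap Δ v := by
      ext v; ring
    have i2 : Integrable (fun v => F v * kap Δ v + h s1 * kap Δ v) := iF.add (j0.const_mul (h s1))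
    rw [e, integral_sub i2 ire, integral_add iF (j0.const_mul _), integral_const_mul, kap_int_one hΔ0, mul_one]
  have hrhs : ∫ v : ℝ, ((M * (4000 * a + 2000 / Δ)) * kap Δ v + (M * (2000 * Δ + 19200 / a)) * (v ^ 2 * kap Δ v)) = M * (4000 * a + 2000 / Δ) + M * (2000 * Δ + 19200 / a) * (m2 / Δ ^ 2) := by
    rw [integral_add (j0.const_mul _) (j2.const_mul _), integral_const_mul, integral_const_mul, kap_int_one hΔ0, kap_int_two hΔ0, mul_one]
  rw [hlhs, hrhs] at hmono
  have hfin : M * (4000 * a + 2000 / Δ) + M * (2000 * Δ + 19200 / a) * (m2 / Δ ^ 2) ≤ 3 * (4000 * lam + 2000 + 2000 * m2 + 19200 * m2) * ell q t0 / Δ := by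
    have e : M * (4000 * a + 2000 / Δ) + M * (2000 * Δ + 19200 / a) * (m2 / Δ ^ 2) = 3 * ell q t0 * (4000 * lam + 2000 + 2000 * m2 + 19200 * m2 / lam) / Δ := by
      rw [ha, hM]; field_simp; ring
    rw [e]
    have : 19200 * m2 / lam ≤ 19200 * m2 := div_le_self (by positivity) hlam1
    have hE0 : 0 ≤ 3 * ell q t0 := by linarith
    refine div_le_div_of_nonneg_right ?_ hΔ0.le
    calc 3 * ell q t0 * (4000 * lam + 2000 + 2000 * m2 + 19200 * m2 / lam) ≤ 3 * ell q t0 * (4000 * lam + 2000 + 2000 * m2 + 19200 * m2) :=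
          mul_le_mul_of_nonneg_left (by linarith) hE0
      _ = _ := by ring
  have hF' : (Z.map (fun ρ => Real.log ‖s1 - ρ‖)).sum ≤ ∫ v, F v * kap Δ v := hF
  rw [hlog1]
  linarith


lemma parseval {q : ℕ} [NeZero q] (D : ZMod q → ℂ) :
    ∑ χ : DirichletCharacter ℂ q, ‖∑ x, D x * χ x‖ ^ 2 ≤ (q.totient : ℝ) * ∑ x, ‖D x‖ ^ 2 := by
  classical
  have key : (∑ χ : DirichletCharacter ℂ q, ((‖∑ x, D x * χ x‖ ^ 2 : ℝ) : ℂ)) =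
      ∑ x ∈ univ.filter (fun x : ZMod q => IsUnit x), (q.totient : ℂ) * ((‖D x‖ ^ 2 : ℝ) : ℂ) := by
    have h1 : ∀ χ : DirichletCharacter ℂ q, ((‖∑ x, D x * χ x‖ ^ 2 : ℝ) : ℂ) =
        ∑ x ∈ univ.filter (fun x : ZMod q => IsUnit x), ∑ y, (starRingEnd ℂ) (D x) * D y * (χ x⁻¹ * χ y) := by
      intro χ
      have h2 : ∑ x, D x * χ x = ∑ x ∈ univ.filter (fun x : ZMod q => IsUnit x), D x * χ x := by
        rw [Finset.sum_filter]
        refine Finset.sum_congr rfl fun x _ => ?_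
        split_ifs with h
        · rfl
        · rw [MulChar.map_nonunit _ h, mul_zero]
      have h3 : ((‖∑ x, D x * χ x‖ ^ 2 : ℝ) : ℂ) = (starRingEnd ℂ) (∑ x, D x * χ x) * ∑ y, D y * χ y := by
        rw [mul_comm, Complex.mul_conj, Complex.normSq_eq_norm_sq]
      rw [h3]
      nth_rewrite 1 [h2]
      rw [map_sum, Finset.sum_mul_sum]
      refine Finset.sum_congr rfl fun x hx => Finset.sum_congr rfl fun y _ => ?_
      have hxu : IsUnit x := (Finset.mem_filter.1 hx).2
      have h4 : (starRingEnd ℂ) (χ x) = χ x⁻¹ := by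
        have h5 : χ x * χ x⁻¹ = 1 := by
          rw [← map_mul, ZMod.mul_inv_of_unit x hxu, map_one]
        have h6 : ‖χ x‖ = 1 := by
          obtain ⟨u, rfl⟩ := hxu
          exact χ.unit_norm_eq_one u
        have h7 : χ x * (starRingEnd ℂ) (χ x) = 1 := by
          rw [Complex.mul_conj, Complex.normSq_eq_norm_sq, h6]; simp
        have h8 : χ x ≠ 0 := fun h => by rw [h] at h6; simp at h6
        exact mul_left_cancel₀ h8 (h7.trans h5.symm)
      rw [map_mul, h4]; ring
    simp only [h1]
    rw [Finset.sum_comm]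
    refine Finset.sum_congr rfl fun x hx => ?_
    have hxu : IsUnit x := (Finset.mem_filter.1 hx).2
    rw [Finset.sum_comm]
    simp only [← Finset.mul_sum, DirichletCharacter.sum_char_inv_mul_char_eq ℂ hxu]
    simp only [mul_ite, mul_zero, Finset.sum_ite_eq, Finset.mem_univ, if_true]
    have : ((‖D x‖ ^ 2 : ℝ) : ℂ) = (starRingEnd ℂ) (D x) * D x := by
      rw [mul_comm, Complex.mul_conj, Complex.normSq_eq_norm_sq]
    rw [this]; ring
  have key2 : ∑ χ : DirichletCharacter ℂ q, ‖∑ x, D x * χ x‖ ^ 2 =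
      ∑ x ∈ univ.filter (fun x : ZMod q => IsUnit x), (q.totient : ℝ) * ‖D x‖ ^ 2 := by
    have := key
    rw [← Complex.ofReal_sum] at this
    have h9 := congrArg Complex.re this
    rw [Complex.ofReal_re, Complex.re_sum] at h9
    rw [h9]
    refine Finset.sum_congr rfl fun x _ => ?_
    rw [← Complex.ofReal_natCast, ← Complex.ofReal_mul, Complex.ofReal_re]
  rw [key2, ← Finset.mul_sum]
  gcongr
  exact Finset.filter_subset _ _

/-- convolution coefficients -/
noncomputable def Dco (q r : ℕ) (A : Finset ℕ) (b : ℕ → ℂ) (x : ZMod q) : ℂ :=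
  ∑ f ∈ (Fintype.piFinset fun _ : Fin r => A).filter (fun f => ((∏ i, f i : ℕ) : ZMod q) = x), ∏ i, b (f i)

lemma Dco_pow {q : ℕ} [NeZero q] (r : ℕ) (A : Finset ℕ) (b : ℕ → ℂ) (χ : DirichletCharacter ℂ q) :
    (∑ a ∈ A, b a * χ (a : ZMod q)) ^ r = ∑ x, Dco q r A b x * χ x := by
  classical
  rw [Finset.sum_pow']
  have h1 : ∀ x : ZMod q, Dco q r A b x * χ x =
      ∑ f ∈ (Fintype.piFinset fun _ : Fin r => A).filter (fun f => ((∏ i, f i : ℕ) : ZMod q) = x),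
        ∏ i, (b (f i) * χ (f i : ZMod q)) := by
    intro x
    rw [Dco, Finset.sum_mul]
    refine Finset.sum_congr rfl fun f hf => ?_
    rw [Finset.prod_mul_distrib, ← map_prod, ← (Finset.mem_filter.1 hf).2, Nat.cast_prod]
  simp only [h1]
  rw [Finset.sum_fiberwise]

lemma moment_le {q : ℕ} [NeZero q] (r : ℕ) (A : Finset ℕ) (b : ℕ → ℂ) :
    ∑ χ : DirichletCharacter ℂ q, ‖∑ a ∈ A, b a * χ (a : ZMod q)‖ ^ (2 * r) ≤
      (q.totient : ℝ) * ∑ x, ‖Dco q r A b x‖ ^ 2 := by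
  refine le_trans (le_of_eq ?_) (parseval (Dco q r A b))
  refine Finset.sum_congr rfl fun χ _ => ?_
  rw [← Dco_pow, norm_pow, ← pow_mul, mul_comm]

lemma prime_moment {q : ℕ} [NeZero q] (r X : ℕ) (hr : 1 ≤ r) (hX : X ^ r < q) (A : Finset ℕ)
    (hA : ∀ p ∈ A, p.Prime ∧ p ≤ X) (b : ℕ → ℂ) :
    ∑ χ : DirichletCharacter ℂ q, ‖∑ a ∈ A, b a * χ (a : ZMod q)‖ ^ (2 * r) ≤
      (q.totient : ℝ) * ((r : ℝ) ^ r * (∑ a ∈ A, ‖b a‖ ^ 2) ^ r) := by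
  classical
  refine (moment_le r A b).trans ?_
  refine mul_le_mul_of_nonneg_left ?_ (Nat.cast_nonneg _)
  have h1 : ∀ x : ZMod q, ‖Dco q r A b x‖ ^ 2 ≤ (r : ℝ) ^ r *
      ∑ f ∈ (Fintype.piFinset fun _ : Fin r => A).filter (fun f => ((∏ i, f i : ℕ) : ZMod q) = x),
        ∏ i, ‖b (f i)‖ ^ 2 := by
    intro x
    set F := (Fintype.piFinset fun _ : Fin r => A).filter (fun f => ((∏ i, f i : ℕ) : ZMod q) = x) with hF
    have hcard : (F.card : ℝ) ≤ (r : ℝ) ^ r := by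
      rcases F.eq_empty_or_nonempty with h | ⟨f0, hf0⟩
      · rw [h]; simp only [Finset.card_empty, Nat.cast_zero]; positivity
      have hmem : ∀ f ∈ F, (∀ i, f i ∈ A) ∧ ((∏ i, f i : ℕ) : ZMod q) = x := by
        intro f hf
        have := Finset.mem_filter.1 hf
        exact ⟨Fintype.mem_piFinset.1 this.1, this.2⟩
      have hlt : ∀ f ∈ F, ∏ i, f i < q := by
        intro f hf
        refine lt_of_le_of_lt ?_ hX
        calc ∏ i, f i ≤ ∏ _i : Fin r, X := Finset.prod_le_prod' fun i _ => (hA _ ((hmem f hf).1 i)).2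
          _ = X ^ r := by simp
      have heq : ∀ f ∈ F, ∏ i, f i = ∏ i, f0 i := by
        intro f hf
        have h2 := ((hmem f hf).2.trans (hmem f0 hf0).2.symm)
        have h3 := (ZMod.natCast_eq_natCast_iff' _ _ _).1 h2
        rwa [Nat.mod_eq_of_lt (hlt f hf), Nat.mod_eq_of_lt (hlt f0 hf0)] at h3
      have hsub : F ⊆ Fintype.piFinset fun _ : Fin r => (Finset.univ.image f0) := by
        intro f hf
        rw [Fintype.mem_piFinset]
        intro i
        have hp := (hA _ ((hmem f hf).1 i)).1
        have : f i ∣ ∏ i, f0 i := by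
          rw [← heq f hf]; exact Finset.dvd_prod_of_mem _ (Finset.mem_univ i)
        obtain ⟨j, _, hj⟩ := (Prime.dvd_finsetProd_iff hp.prime _).1 this
        have := (Nat.prime_dvd_prime_iff_eq hp (hA _ ((hmem f0 hf0).1 j)).1).1 hj
        exact Finset.mem_image.2 ⟨j, Finset.mem_univ _, this.symm⟩
      have h4 := Finset.card_le_card hsub
      rw [Fintype.card_piFinset_const] at h4
      have h5 : (Finset.univ.image f0).card ≤ r := by
        have := Finset.card_image_le (s := (Finset.univ : Finset (Fin r))) (f := f0)
        simpa using this
      have h6 : F.card ≤ r ^ r := h4.trans (Nat.pow_le_pow_left h5 _)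
      exact_mod_cast h6
    have hcs : ‖Dco q r A b x‖ ^ 2 ≤ F.card * ∑ f ∈ F, ∏ i, ‖b (f i)‖ ^ 2 := by
      have h7 : ‖Dco q r A b x‖ ≤ ∑ f ∈ F, ∏ i, ‖b (f i)‖ := by
        refine (norm_sum_le _ _).trans (le_of_eq ?_)
        exact Finset.sum_congr rfl fun f _ => norm_prod _ _
      calc ‖Dco q r A b x‖ ^ 2 ≤ (∑ f ∈ F, ∏ i, ‖b (f i)‖) ^ 2 := by gcongr
        _ ≤ F.card * ∑ f ∈ F, (∏ i, ‖b (f i)‖) ^ 2 := sq_sum_le_card_mul_sum_sq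
        _ = _ := by simp only [Finset.prod_pow]
    refine hcs.trans (mul_le_mul_of_nonneg_right hcard ?_)
    exact Finset.sum_nonneg fun f _ => Finset.prod_nonneg fun i _ => by positivity
  refine (Finset.sum_le_sum fun x _ => h1 x).trans (le_of_eq ?_)
  rw [← Finset.mul_sum, Finset.sum_fiberwise, Finset.sum_pow']

lemma zeta_sum (δ : ℝ) (hδ : 0 < δ) (N : ℕ) :
    ∑ n ∈ Icc 1 N, (n : ℝ) ^ (-(1 + δ)) ≤ 1 + 1 / δ := by
  have h : ∀ N : ℕ, 1 ≤ N → ∑ n ∈ Icc 1 N, (n : ℝ) ^ (-(1 + δ)) ≤ 1 + 1 / δ - (N : ℝ) ^ (-δ) / δ := by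
    intro N hN
    induction N, hN using Nat.le_induction with
    | base => simp
    | succ N hN ih =>
      rw [Finset.sum_Icc_succ_top (by omega)]
      have hN0 : (0 : ℝ) < N := by exact_mod_cast hN
      have key : ((N + 1 : ℕ) : ℝ) ^ (-(1 + δ)) ≤ ((N : ℝ) ^ (-δ) - ((N + 1 : ℕ) : ℝ) ^ (-δ)) / δ := by
        rw [le_div_iff₀ hδ]
        push_cast
        have hb : (0 : ℝ) < N + 1 := by positivity
        have e1 : ((N : ℝ) + 1) ^ (-(1 + δ)) = ((N : ℝ) + 1) ^ (-δ) * (1 / (N + 1)) := by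
          rw [show -(1 + δ) = -δ + -1 by ring, Real.rpow_add hb, Real.rpow_neg_one, one_div]
        have e2 : (N : ℝ) ^ (-δ) = ((N : ℝ) + 1) ^ (-δ) * (N / (N + 1)) ^ (-δ) := by
          rw [← Real.mul_rpow hb.le (by positivity)]
          congr 1; field_simp
        have e3 : 1 + δ * (1 / (N + 1)) ≤ ((N : ℝ) / (N + 1)) ^ (-δ) := by
          rw [Real.rpow_def_of_pos (by positivity)]
          have h1 : Real.log ((N : ℝ) / (N + 1)) ≤ (N : ℝ) / (N + 1) - 1 := Real.log_le_sub_one_of_pos (by positivity)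
          have h2 : (N : ℝ) / (N + 1) - 1 = -(1 / (N + 1)) := by field_simp; ring
          have h3 := Real.add_one_le_exp (Real.log ((N : ℝ) / (N + 1)) * -δ)
          nlinarith
        have e4 : (0 : ℝ) < ((N : ℝ) + 1) ^ (-δ) := by positivity
        rw [e1, e2]
        nlinarith
      rw [sub_div] at key
      linarith
  rcases Nat.eq_zero_or_pos N with h0 | h0
  · subst h0; simp; positivity
  · have := h N h0
    have h2 : 0 ≤ (N : ℝ) ^ (-δ) / δ := by positivity
    linarith


/-- the sum of reciprocals of primes -/
lemma mertens (X : ℕ) (hX : 3 ≤ X) :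
    ∑ p ∈ (X + 1).primesBelow, 1 / (p : ℝ) ≤ Real.exp 1 * Real.log (1 + Real.log X) := by
  have hX3 : (3:ℝ) ≤ X := by exact_mod_cast hX
  have hlog : 0 < Real.log X := Real.log_pos (by linarith)
  set δ : ℝ := 1 / Real.log X with hδd
  have hδ : 0 < δ := by positivity
  let f : ℕ →* ℝ :=
    { toFun := fun n => (n : ℝ) ^ (-(1 + δ))
      map_one' := by simp
      map_mul' := fun a b => by
        push_cast; exact Real.mul_rpow (by positivity) (by positivity) }
  have hf : ∀ n, f n = (n : ℝ) ^ (-(1 + δ)) := fun n => rfl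
  have hf0 : ∀ n, 0 ≤ f n := fun n => by rw [hf]; positivity
  have hsum : Summable f := by
    have : Summable (fun n : ℕ => (n : ℝ) ^ (-(1 + δ))) := Real.summable_nat_rpow.2 (by linarith)
    exact this
  have h1 := EulerProduct.prod_primesBelow_geometric_eq_tsum_smoothNumbers hsum (X + 1)
  have h2 : ∑' m : (X + 1).smoothNumbers, f m ≤ 1 + 1 / δ := by
    refine (hsum.tsum_subtype_le _ _ hf0).trans ?_
    refine Real.tsum_le_of_sum_range_le hf0 fun n => ?_
    refine le_trans ?_ (zeta_sum δ hδ n)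
    have : ∑ i ∈ range n, f i ≤ ∑ i ∈ range (n + 1), f i := by
      rw [Finset.sum_range_succ]; linarith [hf0 n]
    refine this.trans (le_of_eq ?_)
    rw [Finset.sum_range_succ', Finset.range_eq_Ico, Finset.sum_Ico_add' (fun i => f i) 0 n 1]
    have h0 : f 0 = 0 := by rw [hf]; simp; exact Real.zero_rpow (by linarith)
    rw [h0, add_zero]; rfl
  have hp1 : ∀ p ∈ (X + 1).primesBelow, 0 < f p ∧ f p < 1 := by
    intro p hp
    have hpp := Nat.prime_of_mem_primesBelow hp
    have : (1:ℝ) < p := by exact_mod_cast hpp.one_lt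
    exact ⟨by rw [hf]; positivity, by rw [hf]; exact Real.rpow_lt_one_of_one_lt_of_neg this (by linarith)⟩
  have h3 : ∑ p ∈ (X + 1).primesBelow, f p ≤ Real.log (1 + Real.log X) := by
    have e : 1 + Real.log X = 1 + 1 / δ := by rw [hδd, one_div_one_div]
    rw [e]
    have h4 : ∏ p ∈ (X + 1).primesBelow, (1 - f p)⁻¹ ≤ 1 + 1 / δ := h1.le.trans h2
    have h5 : 0 < ∏ p ∈ (X + 1).primesBelow, (1 - f p)⁻¹ :=
      Finset.prod_pos fun p hp => inv_pos.2 (by linarith [(hp1 p hp).2])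
    refine le_trans ?_ (Real.log_le_log h5 h4)
    rw [Real.log_prod fun p hp => inv_ne_zero (by linarith [(hp1 p hp).2])]
    refine Finset.sum_le_sum fun p hp => ?_
    rw [Real.log_inv]
    have := Real.log_le_sub_one_of_pos (x := 1 - f p) (by linarith [(hp1 p hp).2])
    linarith
  refine le_trans ?_ (mul_le_mul_of_nonneg_left h3 (Real.exp_pos 1).le)
  rw [Finset.mul_sum]
  refine Finset.sum_le_sum fun p hp => ?_
  have hpp := Nat.prime_of_mem_primesBelow hp
  have hp0 : (1:ℝ) < p := by exact_mod_cast hpp.one_lt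
  have hpX : (p : ℝ) ≤ X := by exact_mod_cast Nat.lt_succ_iff.1 (Nat.lt_of_mem_primesBelow hp)
  rw [hf, neg_add, Real.rpow_add (by linarith), Real.rpow_neg_one]
  have : 1 ≤ Real.exp 1 * (p:ℝ) ^ (-δ) := by
    rw [Real.rpow_def_of_pos (by linarith), ← Real.exp_add, Real.one_le_exp_iff]
    have : Real.log p * δ ≤ 1 := by
      rw [hδd, mul_one_div, div_le_one hlog]
      exact Real.log_le_log (by linarith) hpX
    linarith
  have h6 : 0 < (p:ℝ)⁻¹ := by positivity
  rw [one_div]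
  nlinarith

lemma sum_image_le {α β : Type*} [DecidableEq α] (S : Finset α) (T : Finset β) (g : β → α) (f : α → ℝ)
    (hf : ∀ a, 0 ≤ f a) (h : ∀ n ∈ S, ∃ t ∈ T, g t = n) : ∑ n ∈ S, f n ≤ ∑ t ∈ T, f (g t) := by
  have h1 : ∑ n ∈ S, ∑ t ∈ T with g t = n, f (g t) ≤ ∑ t ∈ T, f (g t) :=
    Finset.sum_fiberwise_le_sum_of_sum_fiber_nonneg fun y _ => Finset.sum_nonneg fun t _ => hf _
  refine le_trans (Finset.sum_le_sum fun n hn => ?_) h1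
  obtain ⟨t, ht, rfl⟩ := h n hn
  exact Finset.single_le_sum (f := fun t => f (g t)) (fun i _ => hf _) (Finset.mem_filter.2 ⟨ht, rfl⟩)

/-- the prime powers -/
lemma prime_pow_sum (X : ℕ) :
    ∑ n ∈ (Icc 1 X).filter (fun n => ¬ n.Prime ∧ ArithmeticFunction.vonMangoldt n ≠ 0), (n : ℝ) ^ (-(1/2) : ℝ) ≤
      4 * ∑ p ∈ (X + 1).primesBelow, 1 / (p : ℝ) := by
  refine (sum_image_le _ ((X + 1).primesBelow ×ˢ Icc 2 X) (fun t => t.1 ^ t.2) (fun n => (n : ℝ) ^ (-(1/2) : ℝ))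
    (fun n => by positivity) ?_).trans ?_
  · intro n hn
    obtain ⟨hn1, hn2, hn3⟩ := Finset.mem_filter.1 hn
    rw [ArithmeticFunction.vonMangoldt_ne_zero_iff, isPrimePow_nat_iff] at hn3
    obtain ⟨p, j, hp, hj, rfl⟩ := hn3
    have hX := (Finset.mem_Icc.1 hn1).2
    have hj2 : 2 ≤ j := by
      by_contra h
      have : j = 1 := by omega
      subst this
      exact hn2 (by simpa using hp)
    refine ⟨(p, j), ?_, rfl⟩
    rw [Finset.mem_product, Nat.mem_primesBelow, Finset.mem_Icc]
    refine ⟨⟨Nat.lt_succ_iff.2 ((Nat.le_self_pow (by omega) p).trans hX), hp⟩, hj2, ?_⟩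
    exact (Nat.lt_pow_self hp.one_lt).le.trans hX
  · rw [Finset.sum_product, Finset.mul_sum]
    refine Finset.sum_le_sum fun p hp => ?_
    have hpp := Nat.prime_of_mem_primesBelow hp
    have hp2 : (2:ℝ) ≤ p := by exact_mod_cast hpp.two_le
    set z : ℝ := (p : ℝ) ^ (-(1/2) : ℝ) with hz
    have hz0 : 0 ≤ z := by positivity
    have hz2 : z ^ 2 = 1 / p := by
      rw [hz, ← Real.rpow_natCast, ← Real.rpow_mul (by positivity)]
      norm_num
      exact Real.rpow_neg_one _
    have hz3 : z ≤ 3/4 := by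
      have : z ^ 2 ≤ 1/2 := by rw [hz2]; gcongr
      nlinarith
    have h1 : ∀ j, ((p ^ j : ℕ) : ℝ) ^ (-(1/2) : ℝ) = z ^ j := by
      intro j
      rw [hz, Nat.cast_pow, ← Real.rpow_natCast, ← Real.rpow_mul (by positivity), mul_comm,
        Real.rpow_mul (by positivity), Real.rpow_natCast]
    simp only [h1]
    have h2 : ∀ N, ∑ j ∈ range N, z ^ j ≤ 4 := by
      intro N
      have := geom_sum_mul_neg z N
      have h3 : 0 ≤ z ^ N := by positivity
      have h4 : 0 ≤ ∑ j ∈ range N, z ^ j := Finset.sum_nonneg fun _ _ => by positivity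
      nlinarith
    have h5 : ∑ j ∈ Icc 2 X, z ^ j = z ^ 2 * ∑ j ∈ range (X + 1 - 2), z ^ j := by
      rw [← Finset.Ico_succ_right_eq_Icc, Finset.sum_Ico_eq_sum_range, Finset.mul_sum]
      exact Finset.sum_congr (by simp) fun j _ => by rw [pow_add]
    rw [h5, hz2, mul_comm]
    have := h2 (X + 1 - 2)
    gcongr


noncomputable def bb (c t Δ : ℝ) (n : ℕ) : ℂ :=
  ((ArithmeticFunction.vonMangoldt n / Real.log n : ℝ) : ℂ) * (n:ℂ) ^ (-((1/2 + c : ℝ) + t * I : ℂ)) * Wk Δ n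

lemma bb_le {c t Δ : ℝ} (hc : 0 ≤ c) (hΔ : 1 ≤ Δ) {n : ℕ} (hn : 1 ≤ n) : ‖bb c t Δ n‖ ≤ (n:ℝ) ^ (-(1/2) : ℝ) := by
  have hn0 : (1:ℝ) ≤ n := by exact_mod_cast hn
  rw [bb, norm_mul, norm_mul, Complex.norm_real, Real.norm_eq_abs, abs_of_nonneg (lam_nonneg n),
    Complex.norm_natCast_cpow_of_pos (by omega)]
  have h1 : (-((1/2 + c : ℝ) + t * I : ℂ)).re = -(1/2 + c) := by simp
  rw [h1]
  have h2 : (n:ℝ) ^ (-(1/2 + c)) ≤ (n:ℝ) ^ (-(1/2) : ℝ) := Real.rpow_le_rpow_of_exponent_le hn0 (by linarith)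
  have h3 : (0:ℝ) ≤ (n:ℝ) ^ (-(1/2 + c)) := by positivity
  calc _ ≤ 1 * (n:ℝ) ^ (-(1/2) : ℝ) * 1 := by
        gcongr
        · exact lam_le_one n
        · exact Wk_le hΔ n hn
    _ = _ := by ring

lemma P_split {q : ℕ} [NeZero q] (χ : DirichletCharacter ℂ q) {c t Δ : ℝ} (hc : 0 ≤ c) (hΔ : 1 ≤ Δ) (X : ℕ) :
    (∑ n ∈ Icc 1 X, ac χ n * (n:ℂ) ^ (-((1/2 + c : ℝ) + t * I : ℂ)) * Wk Δ n).re ≤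
      ‖∑ p ∈ (X+1).primesBelow, bb c t Δ p * χ (p : ZMod q)‖ + 4 * ∑ p ∈ (X + 1).primesBelow, 1 / (p : ℝ) := by
  have h0 : ∀ n : ℕ, ac χ n * (n:ℂ) ^ (-((1/2 + c : ℝ) + t * I : ℂ)) * Wk Δ n = bb c t Δ n * χ (n : ZMod q) := by
    intro n; rw [ac, bb]; ring
  simp only [h0]
  have hP : (Icc 1 X).filter Nat.Prime = (X+1).primesBelow := by
    ext p
    rw [Finset.mem_filter, Finset.mem_Icc, Nat.mem_primesBelow]
    constructor
    · rintro ⟨⟨_, h⟩, h2⟩; exact ⟨by omega, h2⟩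
    · rintro ⟨h, h2⟩; exact ⟨⟨h2.one_lt.le, by omega⟩, h2⟩
  rw [← Finset.sum_filter_add_sum_filter_not (Icc 1 X) Nat.Prime, hP]
  refine (Complex.re_le_norm _).trans ((norm_add_le _ _).trans ?_)
  refine add_le_add le_rfl (le_trans ?_ (prime_pow_sum X))
  refine (norm_sum_le _ _).trans ?_
  have e1 : (Icc 1 X).filter (fun n => ¬ n.Prime ∧ ArithmeticFunction.vonMangoldt n ≠ 0) =
      ((Icc 1 X).filter (fun n => ¬ n.Prime)).filter (fun n => ArithmeticFunction.vonMangoldt n ≠ 0) := by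
    rw [Finset.filter_filter]
  rw [e1, Finset.sum_filter (fun n => ArithmeticFunction.vonMangoldt n ≠ 0)]
  refine Finset.sum_le_sum fun n hn => ?_
  have hn1 : 1 ≤ n := (Finset.mem_Icc.1 (Finset.mem_filter.1 hn).1).1
  split_ifs with h
  · rw [norm_mul]
    calc _ ≤ (n:ℝ) ^ (-(1/2) : ℝ) * 1 := by
          gcongr
          · exact bb_le hc hΔ hn1
          · exact DirichletCharacter.norm_le_one χ _
      _ = _ := mul_one _
  · push Not at h
    rw [bb, h]; simp

lemma ell_le_six {q : ℕ} (hq : 3 ≤ q) {t : ℝ} (ht : |t| ≤ (q:ℝ)^4) : ell q t ≤ 6 * Real.log q := by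
  have h1 : (3:ℝ) ≤ q := by exact_mod_cast hq
  rw [ell, show (6:ℝ) * Real.log q = Real.log ((q:ℝ)^6) by rw [Real.log_pow]; norm_num]
  apply Real.log_le_log (by positivity)
  have h2 : (81:ℝ) ≤ (q:ℝ)^4 := by
    calc (81:ℝ) = 3^4 := by norm_num
      _ ≤ _ := by gcongr
  have : |t| + 3 ≤ (q:ℝ) * (q:ℝ)^4 := by nlinarith
  calc (q:ℝ) * (|t| + 3) ≤ q * ((q:ℝ) * (q:ℝ)^4) := by gcongr
    _ = _ := by ring

/-- large deviations -/
lemma large_dev : ∃ A : ℝ, 1 ≤ A ∧ ∀ (q : ℕ) [NeZero q], 3 ≤ q →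
    (∀ χ : DirichletCharacter ℂ q, ∀ s : ℂ, 0 < s.re → s.re < 1 → DirichletCharacter.LFunction χ s = 0 → s.re = 1/2) →
    ∀ t : ℝ, |t| ≤ (q:ℝ)^4 → ∀ m : ℕ, 18 * A ≤ m → (m:ℝ) ≤ 12 * Real.log q →
    16 * (Real.exp 1 * Real.log (1 + Real.log q)) ≤ m → ∀ S : Finset (DirichletCharacter ℂ q),
    (∀ χ ∈ S, χ ≠ 1 ∧ (m:ℝ) ≤ Real.log ‖DirichletCharacter.LFunction χ ((1/2 + 1 / Real.log q : ℝ) + t * I)‖) →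
    ∃ r : ℕ, 1 ≤ r ∧ (m:ℝ) / (18 * A) ≤ r ∧ (S.card : ℝ) ≤ q.totient *
      (16 * (Real.exp 1 * Real.log (1 + Real.log q)) / m) ^ r := by
  obtain ⟨lam, C, hlam, hC, H⟩ := main_ineq
  set A : ℝ := 24 * lam + 12 * C with hA
  have hA1 : 24 * lam ≤ A := by rw [hA]; linarith
  have hA2 : 12 * C ≤ A := by rw [hA]; linarith
  have hA3 : 24 ≤ A := by linarith
  clear_value A
  refine ⟨A, by linarith, ?_⟩
  intro q _ hq hRH t ht m hm1 hm2 hm3 S hS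
  have hq3 : (3:ℝ) ≤ q := by exact_mod_cast hq
  have hlog : 0 < Real.log q := Real.log_pos (by linarith)
  have hA0 : 0 < A := by linarith
  have hm0 : (0:ℝ) < m := by linarith
  set Y := Real.exp 1 * Real.log (1 + Real.log q) with hY
  have hY0 : 0 < Y := by
    have : 0 < Real.log (1 + Real.log q) := Real.log_pos (by linarith)
    positivity
  set Δ : ℝ := A * Real.log q / m with hΔ
  have hΔ1 : 2 * lam ≤ Δ := by
    rw [hΔ, le_div_iff₀ hm0]
    calc 2 * lam * m ≤ 2 * lam * (12 * Real.log q) := by gcongr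
      _ = 24 * lam * Real.log q := by ring
      _ ≤ _ := by gcongr
  have hΔ2 : Δ ≤ Real.log q / 18 := by
    rw [hΔ, div_le_div_iff₀ hm0 (by norm_num)]
    nlinarith
  have hΔ0 : 0 < Δ := by linarith
  have hb : 1 / Real.log q ≤ lam / (2 * Δ) := by
    rw [div_le_div_iff₀ hlog (by positivity)]
    nlinarith
  set X : ℕ := ⌈Real.exp (7 * Δ)⌉₊ with hX
  have hX1 : Real.exp (7 * Δ) ≤ X := Nat.le_ceil _
  have hX2 : (X:ℝ) ≤ Real.exp (8 * Δ) := by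
    have h1 : (X:ℝ) < Real.exp (7 * Δ) + 1 := Nat.ceil_lt_add_one (Real.exp_pos _).le
    have h2 : Real.exp (8 * Δ) = Real.exp (7 * Δ) * Real.exp Δ := by rw [← Real.exp_add]; ring_nf
    have h3 := Real.add_one_le_exp Δ
    have h4 : 1 ≤ Real.exp (7 * Δ) := Real.one_le_exp (by positivity)
    nlinarith
  have hX3 : 3 ≤ X := by
    have h1 := Real.add_one_le_exp (7 * Δ)
    have : (3:ℝ) ≤ X := by linarith
    exact_mod_cast this
  have hXq : (X:ℝ) ≤ q := by
    refine hX2.trans ?_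
    rw [← Real.le_log_iff_exp_le (by linarith)]
    linarith
  set r : ℕ := ⌊(m:ℝ) / (9 * A)⌋₊ with hr
  have hr0 : (2:ℝ) ≤ m / (9 * A) := by rw [le_div_iff₀ (by positivity)]; linarith
  have hr1 : (r:ℝ) ≤ m / (9 * A) := Nat.floor_le (by positivity)
  have hr2 : (m:ℝ) / (9 * A) < r + 1 := Nat.lt_floor_add_one _
  have hr3 : (m:ℝ) / (18 * A) ≤ r := by
    have : (m:ℝ) / (18 * A) = m / (9 * A) / 2 := by field_simp; norm_num
    rw [this]; linarith
  have hr4 : 1 ≤ r := by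
    have : (0:ℝ) < r := by linarith
    exact_mod_cast this
  refine ⟨r, hr4, hr3, ?_⟩
  have hXr : X ^ r < q := by
    have h1 : (X:ℝ) ^ r < q := by
      calc (X:ℝ) ^ r ≤ Real.exp (8 * Δ) ^ r := by gcongr
        _ = Real.exp (r * (8 * Δ)) := (Real.exp_nat_mul _ _).symm
        _ < q := by
          rw [← Real.lt_log_iff_exp_lt (by linarith)]
          calc (r:ℝ) * (8 * Δ) ≤ m / (9 * A) * (8 * Δ) := by gcongr
            _ = 8 / 9 * Real.log q := by rw [hΔ]; field_simp
            _ < _ := by linarith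
    exact_mod_cast h1
  have hYX : ∑ p ∈ (X + 1).primesBelow, 1 / (p : ℝ) ≤ Y := by
    refine (mertens X hX3).trans ?_
    rw [hY]
    have h3 : (3:ℝ) ≤ X := by exact_mod_cast hX3
    have h4 : 0 < Real.log X := Real.log_pos (by linarith)
    gcongr
  have hc : 0 ≤ lam / Δ := by positivity
  have hpm := prime_moment (q := q) r X hr4 hXr ((X+1).primesBelow)
    (fun p hp => ⟨Nat.prime_of_mem_primesBelow hp, Nat.lt_succ_iff.1 (Nat.lt_of_mem_primesBelow hp)⟩) (bb (lam / Δ) t Δ)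
  have hbb : ∑ p ∈ (X+1).primesBelow, ‖bb (lam / Δ) t Δ p‖ ^ 2 ≤ Y := by
    refine le_trans (Finset.sum_le_sum fun p hp => ?_) hYX
    have hpp := Nat.prime_of_mem_primesBelow hp
    have := bb_le (t := t) hc (show 1 ≤ Δ by linarith) hpp.one_lt.le
    calc ‖bb (lam / Δ) t Δ p‖ ^ 2 ≤ ((p:ℝ) ^ (-(1/2) : ℝ)) ^ 2 := by gcongr
      _ = 1 / (p:ℝ) := by
        rw [← Real.rpow_natCast, ← Real.rpow_mul (by positivity)]
        norm_num
        exact Real.rpow_neg_one _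
  have hlow : ∀ χ ∈ S, ((m:ℝ) / 4) ^ (2 * r) ≤ ‖∑ p ∈ (X+1).primesBelow, bb (lam / Δ) t Δ p * χ (p : ZMod q)‖ ^ (2 * r) := by
    intro χ hχ
    obtain ⟨h1, h2⟩ := hS χ hχ
    have h3 := H q hq χ h1 (hRH χ) t Δ (1 / Real.log q) X hΔ1 (by positivity) hb hX1
    have h4 := P_split χ (t := t) hc (show 1 ≤ Δ by linarith) X
    have h5 : C * ell q t / Δ ≤ m / 2 := by
      have h6 := ell_le_six hq ht
      calc C * ell q t / Δ ≤ C * (6 * Real.log q) / Δ := by gcongr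
        _ = (6 * C / A) * m := by rw [hΔ]; field_simp
        _ ≤ 1 / 2 * m := by
          refine mul_le_mul_of_nonneg_right ?_ hm0.le
          rw [div_le_div_iff₀ hA0 (by norm_num)]; linarith
        _ = _ := by ring
    have h7 : (m:ℝ) / 4 ≤ ‖∑ p ∈ (X+1).primesBelow, bb (lam / Δ) t Δ p * χ (p : ZMod q)‖ := by linarith
    gcongr
  have hfin : (S.card : ℝ) * ((m:ℝ) / 4) ^ (2 * r) ≤ q.totient * ((r:ℝ) ^ r * Y ^ r) := by
    calc (S.card : ℝ) * ((m:ℝ) / 4) ^ (2 * r) = ∑ χ ∈ S, ((m:ℝ) / 4) ^ (2 * r) := by simp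
      _ ≤ ∑ χ ∈ S, ‖∑ p ∈ (X+1).primesBelow, bb (lam / Δ) t Δ p * χ (p : ZMod q)‖ ^ (2 * r) := Finset.sum_le_sum hlow
      _ ≤ ∑ χ : DirichletCharacter ℂ q, ‖∑ p ∈ (X+1).primesBelow, bb (lam / Δ) t Δ p * χ (p : ZMod q)‖ ^ (2 * r) :=
        Finset.sum_le_sum_of_subset_of_nonneg (Finset.subset_univ _) fun _ _ _ => by positivity
      _ ≤ _ := hpm
      _ ≤ _ := by gcongr
  have hrm : (r:ℝ) ≤ m := hr1.trans (div_le_self hm0.le (by linarith))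
  rw [← le_div_iff₀ (by positivity)] at hfin
  refine hfin.trans ?_
  rw [mul_div_assoc]
  refine mul_le_mul_of_nonneg_left ?_ (Nat.cast_nonneg _)
  rw [pow_mul, ← mul_pow, ← div_pow]
  refine pow_le_pow_left₀ (by positivity) ?_ _
  calc (r:ℝ) * Y / ((m:ℝ) / 4) ^ 2 ≤ m * Y / ((m:ℝ) / 4) ^ 2 := by gcongr
    _ = _ := by field_simp; norm_num


lemma exp_neg_sum (S : Finset ℕ) : ∑ m ∈ S, Real.exp (-(m:ℝ)) ≤ 2 := by
  have h1 : ∀ m : ℕ, Real.exp (-(m:ℝ)) = (Real.exp (-1)) ^ m := by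
    intro m; rw [← Real.exp_nat_mul]; ring_nf
  simp only [h1]
  have h2 : Real.exp (-1) ≤ 1/2 := by
    rw [Real.exp_neg]
    have := Real.add_one_le_exp (1:ℝ)
    rw [inv_le_comm₀ (Real.exp_pos _) (by norm_num)]; linarith
  have h3 : Summable (fun m : ℕ => (1/2:ℝ) ^ m) := summable_geometric_of_lt_one (by norm_num) (by norm_num)
  calc ∑ m ∈ S, Real.exp (-1) ^ m ≤ ∑ m ∈ S, (1/2:ℝ) ^ m := by
        gcongr
    _ ≤ ∑' m : ℕ, (1/2:ℝ) ^ m := h3.sum_le_tsum _ fun _ _ => by positivity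
    _ = 2 := tsum_geometric_two

lemma Lmoment (K : ℕ) : ∃ C D : ℝ, 0 < C ∧ 0 < D ∧ ∀ (q : ℕ) [NeZero q], 3 ≤ q →
    (∀ χ : DirichletCharacter ℂ q, ∀ s : ℂ, 0 < s.re → s.re < 1 → DirichletCharacter.LFunction χ s = 0 → s.re = 1/2) →
    ∀ t : ℝ, |t| ≤ (q:ℝ)^4 → ∀ T : Finset (DirichletCharacter ℂ q), (∀ χ ∈ T, χ ≠ 1) →
    ∑ χ ∈ T, ‖DirichletCharacter.LFunction χ ((1/2 + 1 / Real.log q : ℝ) + t * I)‖ ^ (2 * K) ≤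
      C * q.totient * (1 + Real.log q) ^ D := by
  classical
  obtain ⟨A, hA1, HA⟩ := large_dev
  set E : ℝ := Real.exp (18 * A * (2 * K + 1)) with hE
  have hE1 : 1 ≤ E := Real.one_le_exp (by positivity)
  set C1 : ℝ := Real.exp (2 * K * (16 * E + 18 * A + 1)) with hC1
  set D : ℝ := 2 * K * (16 * E * Real.exp 1) + 1 with hD
  have hD0 : 0 < D := by positivity
  refine ⟨C1 + 2 * Real.exp (2 * K), D, by positivity, hD0, ?_⟩
  intro q _ hq hRH t ht T hT
  have hq3 : (3:ℝ) ≤ q := by exact_mod_cast hq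
  have hlog : 0 < Real.log q := Real.log_pos (by linarith)
  have hlog1 : 1 ≤ Real.log q := by
    rw [Real.le_log_iff_exp_le (by linarith)]; linarith [Real.exp_one_lt_d9]
  set Y := Real.exp 1 * Real.log (1 + Real.log q) with hY
  have hY0 : 0 < Y := by
    have : 0 < Real.log (1 + Real.log q) := Real.log_pos (by linarith)
    positivity
  set V : ℕ := ⌈16 * E * (Y + 1) + 18 * A⌉₊ with hV
  have hV1 : 16 * E * (Y + 1) + 18 * A ≤ V := Nat.le_ceil _
  have hV2 : (V:ℝ) < 16 * E * (Y + 1) + 18 * A + 1 := Nat.ceil_lt_add_one (by positivity)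
  set Lv : DirichletCharacter ℂ q → ℝ := fun χ => ‖DirichletCharacter.LFunction χ ((1/2 + 1 / Real.log q : ℝ) + t * I)‖ with hLv
  set M : ℕ := ⌊12 * Real.log q⌋₊ with hM
  have hup : ∀ χ ∈ T, Real.log (Lv χ) ≤ 12 * Real.log q := by
    intro χ hχ
    rcases (norm_nonneg (DirichletCharacter.LFunction χ ((1/2 + 1 / Real.log q : ℝ) + t * I))).eq_or_lt with h | h
    · have : Lv χ = 0 := h.symm
      rw [this, Real.log_zero]; positivity
    rw [Real.log_le_iff_le_exp h]
    have hb0 : 0 < 1 / Real.log q := by positivity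
    have hb1 : 1 / Real.log q ≤ 1 := by rw [div_le_one hlog]; exact hlog1
    have h1 := logL_le hq (hT χ hχ) (t := t) (s := (1/2 + 1 / Real.log q : ℝ) + t * I) (by
      rw [Complex.add_re, Complex.ofReal_re, Complex.re_ofReal_mul, Complex.I_re]; linarith) (by
      refine (norm_add_le _ _).trans ?_
      rw [Complex.norm_real, norm_mul, Complex.norm_real, Complex.norm_I, mul_one, Real.norm_eq_abs, Real.norm_eq_abs,
        abs_of_pos (by positivity)]
      linarith)
    refine h1.trans (Real.exp_le_exp.2 ?_)
    linarith [ell_le_six hq ht]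
  have hcard : ∀ m ∈ Icc V M, ((T.filter (fun χ => (m:ℝ) ≤ Real.log (Lv χ))).card : ℝ) ≤
      q.totient * Real.exp (-((2 * K + 1) * m)) := by
    intro m hm
    obtain ⟨hm1, hm2⟩ := Finset.mem_Icc.1 hm
    have hm1' : (V:ℝ) ≤ m := by exact_mod_cast hm1
    have hm2' : (m:ℝ) ≤ 12 * Real.log q := by
      have : (M:ℝ) ≤ 12 * Real.log q := Nat.floor_le (by positivity)
      have h2 : (m:ℝ) ≤ M := by exact_mod_cast hm2
      linarith
    have hEY : 16 * Y * E ≤ m := by nlinarith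
    have hm0 : (0:ℝ) < m := by nlinarith
    obtain ⟨r, hr1, hr2, hr3⟩ := HA q hq hRH t ht m (by nlinarith) hm2' (by nlinarith)
      (T.filter (fun χ => (m:ℝ) ≤ Real.log (Lv χ)))
      (fun χ hχ => ⟨hT χ (Finset.mem_filter.1 hχ).1, (Finset.mem_filter.1 hχ).2⟩)
    refine hr3.trans ?_
    refine mul_le_mul_of_nonneg_left ?_ (Nat.cast_nonneg _)
    have h1 : 16 * Y / m ≤ Real.exp (-(18 * A * (2 * K + 1))) := by
      rw [Real.exp_neg, div_le_iff₀ hm0, ← hE, ← div_eq_inv_mul, le_div_iff₀ (by positivity)]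
      exact hEY
    calc (16 * Y / m) ^ r ≤ Real.exp (-(18 * A * (2 * K + 1))) ^ r := by gcongr
      _ = Real.exp (r * (-(18 * A * (2 * K + 1)))) := (Real.exp_nat_mul _ _).symm
      _ ≤ _ := by
        rw [Real.exp_le_exp]
        rw [div_le_iff₀ (by positivity)] at hr2
        have : (m:ℝ) * (2 * K + 1) ≤ r * (18 * A) * (2 * K + 1) := by gcongr
        linarith
  have hpt : ∀ χ ∈ T, Lv χ ^ (2 * K) ≤ Real.exp (2 * K * V) +
      ∑ m ∈ Icc V M, if (m:ℝ) ≤ Real.log (Lv χ) then Real.exp (2 * K * (m + 1)) else 0 := by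
    intro χ hχ
    have hnn : ∀ m ∈ Icc V M, 0 ≤ (if (m:ℝ) ≤ Real.log (Lv χ) then Real.exp (2 * K * (m + 1)) else (0:ℝ)) := by
      intro m _; split_ifs <;> positivity
    have hL0 : 0 ≤ Lv χ := norm_nonneg _
    have hpow : ∀ u : ℝ, Real.log (Lv χ) ≤ u → 0 < Lv χ → Lv χ ^ (2 * K) ≤ Real.exp (2 * K * u) := by
      intro u hu hp
      rw [Real.log_le_iff_le_exp hp] at hu
      calc Lv χ ^ (2 * K) ≤ Real.exp u ^ (2 * K) := by gcongr
        _ = _ := by rw [← Real.exp_nat_mul]; push_cast; ring_nf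
    rcases hL0.eq_or_lt with h | h
    · have h1 : (0:ℝ) ^ (2 * K) ≤ 1 := pow_le_one₀ le_rfl zero_le_one
      rw [← h] at hnn ⊢
      have h2 : 1 ≤ Real.exp (2 * K * V) := Real.one_le_exp (by positivity)
      linarith [Finset.sum_nonneg hnn]
    rcases le_total (Real.log (Lv χ)) V with h1 | h1
    · linarith [hpow V h1 h, Finset.sum_nonneg hnn]
    have hlv0 : 0 ≤ Real.log (Lv χ) := le_trans (Nat.cast_nonneg _) h1
    have hmem : ⌊Real.log (Lv χ)⌋₊ ∈ Icc V M :=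
      Finset.mem_Icc.2 ⟨Nat.le_floor h1, Nat.floor_le_floor (hup χ hχ)⟩
    have h2 := Finset.single_le_sum hnn hmem
    rw [if_pos (Nat.floor_le hlv0)] at h2
    have h3 := hpow (⌊Real.log (Lv χ)⌋₊ + 1) (Nat.lt_floor_add_one _).le h
    have := Real.exp_pos (2 * K * V)
    linarith
  have hTc : (T.card : ℝ) ≤ q.totient := by
    have h1 := Finset.card_le_univ T
    rw [← Nat.card_eq_fintype_card, DirichletCharacter.card_eq_totient_of_hasEnoughRootsOfUnity] at h1
    exact_mod_cast h1
  have hsum : ∑ χ ∈ T, Lv χ ^ (2 * K) ≤ q.totient * Real.exp (2 * K * V) + q.totient * (2 * Real.exp (2 * K)) := by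
    refine (Finset.sum_le_sum hpt).trans ?_
    rw [Finset.sum_add_distrib]
    refine add_le_add ?_ ?_
    · rw [Finset.sum_const, nsmul_eq_mul]; gcongr
    · rw [Finset.sum_comm]
      calc ∑ m ∈ Icc V M, ∑ χ ∈ T, (if (m:ℝ) ≤ Real.log (Lv χ) then Real.exp (2 * K * (m + 1)) else 0)
          ≤ ∑ m ∈ Icc V M, q.totient * Real.exp (2 * K) * Real.exp (-(m:ℝ)) := by
            refine Finset.sum_le_sum fun m hm => ?_
            rw [← Finset.sum_filter, Finset.sum_const, nsmul_eq_mul]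
            calc _ ≤ (q.totient * Real.exp (-((2 * K + 1) * m))) * Real.exp (2 * K * (m + 1)) := by
                  gcongr; exact hcard m hm
              _ = _ := by
                rw [mul_assoc (q.totient:ℝ), mul_assoc (q.totient:ℝ), ← Real.exp_add, ← Real.exp_add]; ring_nf
        _ = q.totient * Real.exp (2 * K) * ∑ m ∈ Icc V M, Real.exp (-(m:ℝ)) := by rw [Finset.mul_sum]
        _ ≤ q.totient * Real.exp (2 * K) * 2 := by
            gcongr; exact exp_neg_sum _
        _ = _ := by ring
  refine hsum.trans ?_
  have hlp : 0 < 1 + Real.log q := by linarith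
  have hone : 1 ≤ (1 + Real.log q) ^ D := Real.one_le_rpow (by linarith) hD0.le
  have hVexp : Real.exp (2 * K * V) ≤ C1 * (1 + Real.log q) ^ D := by
    rw [hC1, Real.rpow_def_of_pos hlp, ← Real.exp_add, Real.exp_le_exp]
    have hl : 0 ≤ Real.log (1 + Real.log q) := Real.log_nonneg (by linarith)
    calc 2 * K * (V:ℝ) ≤ 2 * K * (16 * E * (Y + 1) + 18 * A + 1) := by gcongr
      _ = 2 * K * (16 * E + 18 * A + 1) + Real.log (1 + Real.log q) * (2 * K * (16 * E * Real.exp 1)) := by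
        rw [hY]; ring
      _ ≤ _ := by
        rw [hD]
        have : Real.log (1 + Real.log q) * (2 * K * (16 * E * Real.exp 1) + 1) =
          Real.log (1 + Real.log q) * (2 * K * (16 * E * Real.exp 1)) + Real.log (1 + Real.log q) := by ring
        linarith
  calc (q.totient:ℝ) * Real.exp (2 * K * V) + q.totient * (2 * Real.exp (2 * K))
      ≤ q.totient * (C1 * (1 + Real.log q) ^ D) + q.totient * (2 * Real.exp (2 * K) * (1 + Real.log q) ^ D) := by
        refine add_le_add (mul_le_mul_of_nonneg_left hVexp (Nat.cast_nonneg _)) (mul_le_mul_of_nonneg_left ?_ (Nat.cast_nonneg _))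
        exact le_mul_of_one_le_right (by positivity) hone
    _ = _ := by ring


lemma jensen_int {w x : ℝ → ℝ} (hw : Continuous w) (hx : Continuous x) (hw0 : ∀ t, 0 ≤ w t) (hx0 : ∀ t, 0 ≤ x t)
    (a b : ℝ) (hW : 0 < ∫ t in Set.Icc a b, w t) (p : ℕ) (hp : 1 ≤ p) :
    (∫ t in Set.Icc a b, w t * x t) ^ p ≤ (∫ t in Set.Icc a b, w t) ^ (p - 1) * ∫ t in Set.Icc a b, w t * x t ^ p := by
  set W := ∫ t in Set.Icc a b, w t with hWd
  set J := ∫ t in Set.Icc a b, w t * x t with hJ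
  have hJ0 : 0 ≤ J := MeasureTheory.integral_nonneg fun t => mul_nonneg (hw0 t) (hx0 t)
  have iw : MeasureTheory.IntegrableOn w (Set.Icc a b) := hw.continuousOn.integrableOn_Icc
  have iwx : MeasureTheory.IntegrableOn (fun t => w t * x t) (Set.Icc a b) := (hw.mul hx).continuousOn.integrableOn_Icc
  have iwp : MeasureTheory.IntegrableOn (fun t => w t * x t ^ p) (Set.Icc a b) := (hw.mul (hx.pow p)).continuousOn.integrableOn_Icc
  have hR0 : 0 ≤ ∫ t in Set.Icc a b, w t * x t ^ p :=
    MeasureTheory.integral_nonneg fun t => mul_nonneg (hw0 t) (pow_nonneg (hx0 t) p)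
  rcases hJ0.eq_or_lt with h | h
  · rw [← h, zero_pow (by omega)]; positivity
  set c := J / W with hc
  have hc0 : 0 < c := by positivity
  have h1 : ∀ t, c ^ p * (1 - p) * w t + c ^ p * p / c * (w t * x t) ≤ w t * x t ^ p := by
    intro t
    have h2 := one_add_mul_le_pow (a := x t / c - 1) (by have := div_nonneg (hx0 t) hc0.le; linarith) p
    have h3 : c ^ p * (1 + p * (x t / c - 1)) ≤ x t ^ p := by
      calc _ ≤ c ^ p * (1 + (x t / c - 1)) ^ p := by gcongr
        _ = x t ^ p := by rw [← mul_pow]; congr 1; field_simp; ring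
    calc _ = w t * (c ^ p * (1 + p * (x t / c - 1))) := by field_simp; ring
      _ ≤ _ := mul_le_mul_of_nonneg_left h3 (hw0 t)
  have h4 := MeasureTheory.integral_mono (μ := MeasureTheory.volume.restrict (Set.Icc a b))
    ((iw.const_mul (c ^ p * (1 - p))).add (iwx.const_mul (c ^ p * p / c))) iwp h1
  simp only [Pi.add_apply] at h4
  rw [MeasureTheory.integral_add (iw.const_mul _) (iwx.const_mul _), MeasureTheory.integral_const_mul,
    MeasureTheory.integral_const_mul, ← hWd, ← hJ] at h4
  have h5 : c ^ p * (1 - p) * W + c ^ p * p / c * J = c ^ p * W := by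
    have : J = c * W := by rw [hc]; field_simp
    rw [this]; field_simp; ring
  rw [h5] at h4
  calc J ^ p = W ^ (p - 1) * (c ^ p * W) := by
        have h6 : J = c * W := by rw [hc]; field_simp
        obtain ⟨m, rfl⟩ : ∃ m, p = m + 1 := ⟨p - 1, by omega⟩
        rw [h6, mul_pow, Nat.add_sub_cancel]; ring
    _ ≤ _ := by gcongr

lemma w_int {q : ℕ} (hq : 3 ≤ q) {σ : ℝ} (hσ : 1/2 ≤ σ) :
    ∫ t in Set.Icc (-(q:ℝ)^4) ((q:ℝ)^4), 1 / ‖(σ + t * I : ℂ)‖ ≤ 20 * Real.log q := by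
  have hq3 : (3:ℝ) ≤ q := by exact_mod_cast hq
  set Q := (q:ℝ)^4 with hQ
  have hQ0 : 81 ≤ Q := by
    calc (81:ℝ) = 3^4 := by norm_num
      _ ≤ Q := by rw [hQ]; gcongr
  have hs : ∀ t : ℝ, 0 < ‖(σ + t * I : ℂ)‖ := by
    intro t
    have := Complex.abs_re_le_norm (σ + t * I)
    have h2 : (σ + t * I : ℂ).re = σ := by simp
    rw [h2] at this
    have := le_abs_self σ
    linarith
  have h1 : ∀ t : ℝ, 1 / ‖(σ + t * I : ℂ)‖ ≤ 2 * (√(1 + t^2))⁻¹ := by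
    intro t
    rw [← div_eq_mul_inv, div_le_div_iff₀ (hs t) (by positivity), one_mul]
    rw [Real.sqrt_le_left (by positivity), mul_pow, Complex.sq_norm, Complex.normSq_apply]
    have e1 : (σ + t * I : ℂ).re = σ := by simp
    have e2 : (σ + t * I : ℂ).im = t := by simp
    rw [e1, e2]; nlinarith
  have c1 : Continuous (fun t : ℝ => 1 / ‖(σ + t * I : ℂ)‖) :=
    continuous_const.div (by fun_prop) fun t => (hs t).ne'
  have c2 : Continuous (fun t : ℝ => (√(1 + t^2))⁻¹) :=
    Continuous.inv₀ (by fun_prop) fun t => by positivity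
  have c3 : Continuous (fun t : ℝ => 2 * (√(1 + t^2))⁻¹) := continuous_const.mul c2
  have h2 : ∫ t in Set.Icc (-Q) Q, 1 / ‖(σ + t * I : ℂ)‖ ≤ ∫ t in Set.Icc (-Q) Q, 2 * (√(1 + t^2))⁻¹ :=
    MeasureTheory.integral_mono c1.continuousOn.integrableOn_Icc c3.continuousOn.integrableOn_Icc h1
  refine h2.trans ?_
  rw [MeasureTheory.integral_Icc_eq_integral_Ioc, ← intervalIntegral.integral_of_le (by linarith),
    intervalIntegral.integral_const_mul,
    intervalIntegral.integral_eq_sub_of_hasDerivAt (fun t _ => Real.hasDerivAt_arsinh t) (c2.intervalIntegrable _ _),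
    Real.arsinh_neg]
  have h3 : Real.arsinh Q ≤ 5 * Real.log q := by
    rw [Real.arsinh, show (5:ℝ) * Real.log q = Real.log ((q:ℝ)^5) by rw [Real.log_pow]; norm_num]
    refine Real.log_le_log (by positivity) ?_
    have h4 : √(1 + Q^2) ≤ 1 + Q := by
      rw [Real.sqrt_le_left (by positivity)]; nlinarith
    have h5 : (q:ℝ)^5 = q * Q := by rw [hQ]; ring
    rw [h5]; nlinarith
  linarith

lemma large_y (K : ℕ) (hK : 1 ≤ K) : ∃ C D : ℝ, 0 < C ∧ 0 < D ∧ ∀ (q : ℕ) [NeZero q], 3 ≤ q →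
    (∀ χ : DirichletCharacter ℂ q, ∀ s : ℂ, 0 < s.re → s.re < 1 → DirichletCharacter.LFunction χ s = 0 → s.re = 1/2) →
    ∀ T : Finset (DirichletCharacter ℂ q), (∀ χ ∈ T, χ ≠ 1) → ∀ N : ℕ, 1 ≤ N → N ≤ q →
    ∑ χ ∈ T, ‖∑ n ∈ Icc 1 N, χ (n : ZMod q)‖ ^ (2 * K) ≤ C * q.totient * (N:ℝ) ^ K * (1 + Real.log q) ^ D := by
  obtain ⟨C1, hC1, HP⟩ := perron
  obtain ⟨C2, D2, hC2, hD2, HL⟩ := Lmoment K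
  refine ⟨(C1 * (2 * Real.exp 2)) ^ (2 * K) * 2 ^ (2 * K) * (1 + 20 ^ (2 * K) * C2), D2 + (2 * K : ℕ), by positivity, by positivity, ?_⟩
  intro q _ hq hRH T hT N hN1 hNq
  have hq3 : (3:ℝ) ≤ q := by exact_mod_cast hq
  have hlog1 : 1 ≤ Real.log q := by
    rw [Real.le_log_iff_exp_le (by linarith)]; linarith [Real.exp_one_lt_d9]
  have hlog : 0 < Real.log q := by linarith
  set σ : ℝ := 1/2 + 1 / Real.log q with hσ
  have hσ2 : 1/2 ≤ σ := by rw [hσ]; have : 0 < 1 / Real.log q := by positivity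
                           linarith
  set Q : ℝ := (q:ℝ)^4 with hQ
  have hQ0 : 0 < Q := by positivity
  have hs : ∀ t : ℝ, 0 < ‖(σ + t * I : ℂ)‖ := by
    intro t
    have := Complex.abs_re_le_norm (σ + t * I)
    have h2 : (σ + t * I : ℂ).re = σ := by simp
    rw [h2] at this
    have := le_abs_self σ
    linarith
  set w : ℝ → ℝ := fun t => 1 / ‖(σ + t * I : ℂ)‖ with hw
  have cw : Continuous w := continuous_const.div (by fun_prop) fun t => (hs t).ne'
  have hw0 : ∀ t, 0 < w t := fun t => by have := hs t; rw [hw]; positivity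
  set W : ℝ := ∫ t in Set.Icc (-Q) Q, w t with hW
  have hW1 : W ≤ 20 * Real.log q := w_int hq hσ2
  have hW0 : 0 < W := by
    rw [hW, MeasureTheory.integral_Icc_eq_integral_Ioc, ← intervalIntegral.integral_of_le (by linarith)]
    exact intervalIntegral.intervalIntegral_pos_of_pos (cw.intervalIntegrable _ _) hw0 (by linarith)
  set x : DirichletCharacter ℂ q → ℝ → ℝ := fun χ t => ‖DirichletCharacter.LFunction χ (σ + t * I)‖ with hx
  have cx : ∀ χ ∈ T, Continuous (x χ) := fun χ hχ =>
    ((DirichletCharacter.differentiable_LFunction (hT χ hχ)).continuous.comp (by fun_prop)).norm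
  have hx0 : ∀ χ t, 0 ≤ x χ t := fun χ t => norm_nonneg _
  have hp1 : 1 ≤ 2 * K := by omega
  set J : DirichletCharacter ℂ q → ℝ := fun χ => ∫ t in Set.Icc (-Q) Q, w t * x χ t with hJ
  have hJ0 : ∀ χ, 0 ≤ J χ := fun χ => MeasureTheory.integral_nonneg fun t => mul_nonneg (hw0 t).le (hx0 χ t)
  have iwx : ∀ χ ∈ T, MeasureTheory.IntegrableOn (fun t => w t * x χ t ^ (2 * K)) (Set.Icc (-Q) Q) := fun χ hχ =>
    (cw.mul ((cx χ hχ).pow _)).continuousOn.integrableOn_Icc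
  have hJsum : ∑ χ ∈ T, J χ ^ (2 * K) ≤ W ^ (2 * K) * (C2 * q.totient * (1 + Real.log q) ^ D2) := by
    calc ∑ χ ∈ T, J χ ^ (2 * K) ≤ ∑ χ ∈ T, W ^ (2 * K - 1) * ∫ t in Set.Icc (-Q) Q, w t * x χ t ^ (2 * K) :=
          Finset.sum_le_sum fun χ hχ => jensen_int cw (cx χ hχ) (fun t => (hw0 t).le) (hx0 χ) _ _ hW0 _ hp1
      _ = W ^ (2 * K - 1) * ∫ t in Set.Icc (-Q) Q, ∑ χ ∈ T, w t * x χ t ^ (2 * K) := by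
          rw [← Finset.mul_sum, MeasureTheory.integral_finsetSum _ iwx]
      _ ≤ W ^ (2 * K - 1) * ∫ t in Set.Icc (-Q) Q, w t * (C2 * q.totient * (1 + Real.log q) ^ D2) := by
          refine mul_le_mul_of_nonneg_left ?_ (by positivity)
          refine MeasureTheory.setIntegral_mono_on (MeasureTheory.integrable_finsetSum _ iwx)
            (cw.mul continuous_const).continuousOn.integrableOn_Icc measurableSet_Icc fun t ht => ?_
          rw [← Finset.mul_sum]
          refine mul_le_mul_of_nonneg_left ?_ (hw0 t).le
          exact HL q hq hRH t (abs_le.2 ht) T hT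
      _ = _ := by
          rw [MeasureTheory.integral_mul_const, ← hW, ← mul_assoc, ← pow_succ, Nat.sub_add_cancel hp1]
  have hN0 : (1:ℝ) ≤ N := by exact_mod_cast hN1
  have hNq' : (N:ℝ) ≤ q := by exact_mod_cast hNq
  have hNσ : ((N:ℝ) + 1) ^ σ ≤ 2 * Real.exp 2 * (N:ℝ) ^ (1/2 : ℝ) := by
    calc ((N:ℝ) + 1) ^ σ ≤ (2 * N) ^ σ := by gcongr; linarith
      _ = (2 * N) ^ (1/2:ℝ) * (2 * N) ^ (1 / Real.log q) := by rw [hσ, Real.rpow_add (by positivity)]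
      _ ≤ (2 * N ^ (1/2:ℝ)) * Real.exp 2 := by
        refine mul_le_mul ?_ ?_ (by positivity) (by positivity)
        · rw [Real.mul_rpow (by norm_num) (by positivity)]
          gcongr
          calc (2:ℝ) ^ (1/2:ℝ) ≤ 2 ^ (1:ℝ) := Real.rpow_le_rpow_of_exponent_le (by norm_num) (by norm_num)
            _ = 2 := Real.rpow_one _
        · rw [Real.rpow_def_of_pos (by positivity), Real.exp_le_exp, mul_one_div, div_le_iff₀ hlog]
          rw [show (2:ℝ) * Real.log q = Real.log ((q:ℝ)^2) by rw [Real.log_pow]; norm_num]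
          apply Real.log_le_log (by positivity)
          nlinarith
      _ = _ := by ring
  have hpt : ∀ χ ∈ T, ‖∑ n ∈ Icc 1 N, χ (n : ZMod q)‖ ^ (2 * K) ≤
      (C1 * (2 * Real.exp 2)) ^ (2 * K) * 2 ^ (2 * K) * (N:ℝ) ^ K * (1 + J χ ^ (2 * K)) := by
    intro χ hχ
    have h1 := HP q χ (hT χ hχ) σ hσ2 N hN1 hNq
    have h2 : (∫ t in Set.Icc (-(q:ℝ)^4) ((q:ℝ)^4), ‖DirichletCharacter.LFunction χ (σ+t*I)‖/‖(σ+t*I:ℂ)‖) = J χ := by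
      rw [hJ]
      refine MeasureTheory.integral_congr_ae (Filter.Eventually.of_forall fun t => ?_)
      simp only [hw, hx]
      ring
    rw [h2] at h1
    have hJ' := hJ0 χ
    have h3 : (1 + J χ) ^ (2 * K) ≤ 2 ^ (2 * K) * (1 + J χ ^ (2 * K)) := by
      have h4 : (1 + J χ) ≤ 2 * max 1 (J χ) := by linarith [le_max_left 1 (J χ), le_max_right 1 (J χ)]
      calc (1 + J χ) ^ (2 * K) ≤ (2 * max 1 (J χ)) ^ (2 * K) := by gcongr
        _ = 2 ^ (2 * K) * max 1 (J χ) ^ (2 * K) := mul_pow _ _ _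
        _ ≤ _ := by
          gcongr
          rcases max_cases 1 (J χ) with h | h
          · rw [h.1, one_pow]; have : 0 ≤ J χ ^ (2 * K) := by positivity
            linarith
          · rw [h.1]; linarith
    have h5 : ((N:ℝ) ^ (1/2 : ℝ)) ^ (2 * K) = (N:ℝ) ^ K := by
      rw [pow_mul]; congr 1
      rw [← Real.rpow_natCast, ← Real.rpow_mul (by positivity)]; norm_num
    calc ‖∑ n ∈ Icc 1 N, χ (n : ZMod q)‖ ^ (2 * K) ≤ (C1 * (2 * Real.exp 2 * (N:ℝ) ^ (1/2 : ℝ)) * (1 + J χ)) ^ (2 * K) := by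
          refine pow_le_pow_left₀ (norm_nonneg _) (h1.trans ?_) _
          gcongr
      _ = (C1 * (2 * Real.exp 2)) ^ (2 * K) * (N:ℝ) ^ K * (1 + J χ) ^ (2 * K) := by
          rw [← h5, ← mul_pow, ← mul_pow]; congr 1; ring
      _ ≤ (C1 * (2 * Real.exp 2)) ^ (2 * K) * (N:ℝ) ^ K * (2 ^ (2 * K) * (1 + J χ ^ (2 * K))) := by gcongr
      _ = _ := by ring
  refine (Finset.sum_le_sum hpt).trans ?_
  rw [← Finset.mul_sum, Finset.sum_add_distrib, Finset.sum_const, nsmul_eq_mul, mul_one]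
  have hTc : (T.card : ℝ) ≤ q.totient := by
    have h1 := Finset.card_le_univ T
    rw [← Nat.card_eq_fintype_card, DirichletCharacter.card_eq_totient_of_hasEnoughRootsOfUnity] at h1
    exact_mod_cast h1
  set l := 1 + Real.log q with hl
  have hl1 : 1 ≤ l := by linarith
  have hWl : W ≤ 20 * l := by linarith
  have h7 : 1 ≤ l ^ (D2 + (2 * K : ℕ)) := Real.one_le_rpow hl1 (by positivity)
  have h8 : (T.card : ℝ) + ∑ χ ∈ T, J χ ^ (2 * K) ≤ q.totient * (1 + 20 ^ (2 * K) * C2) * l ^ (D2 + (2 * K : ℕ)) := by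
    calc (T.card : ℝ) + ∑ χ ∈ T, J χ ^ (2 * K) ≤ q.totient * l ^ (D2 + (2 * K : ℕ)) + (20 * l) ^ (2 * K) * (C2 * q.totient * l ^ D2) := by
          refine add_le_add (hTc.trans (le_mul_of_one_le_right (Nat.cast_nonneg _) h7)) (hJsum.trans ?_)
          gcongr
      _ = _ := by rw [Real.rpow_add (by linarith), Real.rpow_natCast]; ring
  calc _ ≤ (C1 * (2 * Real.exp 2)) ^ (2 * K) * 2 ^ (2 * K) * (N:ℝ) ^ K * (q.totient * (1 + 20 ^ (2 * K) * C2) * l ^ (D2 + (2 * K : ℕ))) := by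
        gcongr
    _ = _ := by ring


lemma dcard_mul (a b : ℕ) : (a * b).divisors.card ≤ a.divisors.card * b.divisors.card := by
  rw [Nat.divisors_mul]; exact Finset.card_mul_le

lemma div_moment (δ : ℝ) (hδ : 0 < δ) (M j : ℕ) :
    ∑ n ∈ Icc 1 M, (n.divisors.card : ℝ) ^ j * (n:ℝ) ^ (-(1 + δ)) ≤ (1 + 1 / δ) ^ (2 ^ j) := by
  induction j with
  | zero => simpa using zeta_sum δ hδ M
  | succ j ih =>
    set h : ℕ → ℝ := fun n => (n.divisors.card : ℝ) ^ j * (n:ℝ) ^ (-(1 + δ)) with hh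
    have h0 : ∀ n, 0 ≤ h n := fun n => by rw [hh]; positivity
    have h1 : ∑ n ∈ Icc 1 M, (n.divisors.card : ℝ) ^ (j+1) * (n:ℝ) ^ (-(1 + δ)) ≤
        ∑ n ∈ Icc 1 M, ∑ t ∈ (Icc 1 M ×ˢ Icc 1 M) with t.1 * t.2 = n, h t.1 * h t.2 := by
      refine Finset.sum_le_sum fun n hn => ?_
      obtain ⟨hn1, hn2⟩ := Finset.mem_Icc.1 hn
      have e1 : (n.divisors.card : ℝ) ^ (j+1) * (n:ℝ) ^ (-(1 + δ)) = ∑ t ∈ n.divisorsAntidiagonal, h n := by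
        rw [Nat.sum_divisorsAntidiagonal (fun _ _ => h n), Finset.sum_const, nsmul_eq_mul, hh]; ring
      rw [e1]
      refine (Finset.sum_le_sum (g := fun t : ℕ × ℕ => h t.1 * h t.2) fun t ht => ?_).trans
        (Finset.sum_le_sum_of_subset_of_nonneg ?_ fun t _ _ => mul_nonneg (h0 _) (h0 _))
      · have e2 := (Nat.mem_divisorsAntidiagonal.1 ht).1
        rw [← e2, hh]
        simp only
        rw [Nat.cast_mul, Real.mul_rpow (by positivity) (by positivity)]
        calc _ ≤ ((t.1.divisors.card : ℝ) * t.2.divisors.card) ^ j * ((t.1:ℝ) ^ (-(1 + δ)) * (t.2:ℝ) ^ (-(1 + δ))) := by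
              gcongr
              exact_mod_cast dcard_mul _ _
          _ = _ := by rw [mul_pow]; ring
      · intro t ht
        have e2 := Nat.mem_divisorsAntidiagonal.1 ht
        have p1 : 0 < t.1 := Nat.pos_of_ne_zero fun h => by rw [h, zero_mul] at e2; exact e2.2 e2.1.symm
        have p2 : 0 < t.2 := Nat.pos_of_ne_zero fun h => by rw [h, mul_zero] at e2; exact e2.2 e2.1.symm
        rw [Finset.mem_filter, Finset.mem_product, Finset.mem_Icc, Finset.mem_Icc]
        have q1 : t.1 ≤ n := Nat.le_of_dvd (by omega) ⟨_, e2.1.symm⟩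
        have q2 : t.2 ≤ n := Nat.le_of_dvd (by omega) ⟨t.1, by rw [mul_comm]; exact e2.1.symm⟩
        exact ⟨⟨⟨p1, q1.trans hn2⟩, p2, q2.trans hn2⟩, e2.1⟩
    have h2 : ∑ n ∈ Icc 1 M, ∑ t ∈ (Icc 1 M ×ˢ Icc 1 M) with t.1 * t.2 = n, h t.1 * h t.2 ≤
        ∑ t ∈ Icc 1 M ×ˢ Icc 1 M, h t.1 * h t.2 :=
      Finset.sum_fiberwise_le_sum_of_sum_fiber_nonneg fun y _ =>
        Finset.sum_nonneg fun t _ => mul_nonneg (h0 _) (h0 _)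
    refine (h1.trans h2).trans ?_
    rw [Finset.sum_product, ← Finset.sum_mul_sum, ← sq, pow_succ 2 j, pow_mul]
    exact pow_le_pow_left₀ (Finset.sum_nonneg fun _ _ => h0 _) ih 2

lemma div_bound (K : ℕ) (hK : 1 ≤ K) : ∃ T : ℝ, 1 ≤ T ∧ ∀ (q n : ℕ), 1 ≤ q → 1 ≤ n → n ≤ q ^ K →
    (n.divisors.card : ℝ) ^ K ≤ T * (q:ℝ) ^ (1/8 : ℝ) := by
  refine ⟨2 ^ (2 ^ (K * (16 * K))), one_le_pow₀ (by norm_num), ?_⟩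
  intro q n hq hn hnq
  set T : ℝ := 2 ^ (2 ^ (K * (16 * K))) with hT
  have hT1 : 1 ≤ T := one_le_pow₀ (by norm_num)
  clear_value T
  have hn0 : (0:ℝ) < n := by exact_mod_cast hn
  have hq0 : (0:ℝ) < q := by exact_mod_cast hq
  have h1 := div_moment 1 one_pos n (K * (16 * K))
  have h2 := Finset.single_le_sum (f := fun n : ℕ => (n.divisors.card : ℝ) ^ (K * (16 * K)) * (n:ℝ) ^ (-(1 + 1 : ℝ)))
    (fun i _ => by positivity) (Finset.mem_Icc.2 ⟨hn, le_refl n⟩)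
  have h3 : (n.divisors.card : ℝ) ^ (K * (16 * K)) * (n:ℝ) ^ (-(1 + 1 : ℝ)) ≤ T := by
    refine (h2.trans h1).trans (le_of_eq ?_)
    rw [hT]; norm_num
  have h4 : (n:ℝ) ^ (-(1 + 1 : ℝ)) = ((n:ℝ)^2)⁻¹ := by
    rw [Real.rpow_neg hn0.le, ← Real.rpow_natCast]; norm_num
  rw [h4, ← div_eq_mul_inv, div_le_iff₀ (by positivity)] at h3
  have hnq' : (n:ℝ) ≤ (q:ℝ) ^ K := by exact_mod_cast hnq
  refine le_of_pow_le_pow_left₀ (n := 16 * K) (by omega) (by positivity) ?_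
  rw [← pow_mul, mul_pow]
  refine h3.trans ?_
  have h5 : ((q:ℝ) ^ (1/8 : ℝ)) ^ (16 * K) = ((q:ℝ) ^ K) ^ 2 := by
    rw [← Real.rpow_natCast, ← Real.rpow_mul hq0.le, ← pow_mul, ← Real.rpow_natCast]
    congr 1; push_cast; ring
  rw [h5]
  gcongr
  exact le_self_pow₀ hT1 (by omega)

/-- number of factorisations -/
lemma card_fact (K : ℕ) (A : Finset ℕ) (n : ℕ) (hn : 1 ≤ n) :
    (((Fintype.piFinset fun _ : Fin K => A).filter (fun f => ∏ i, f i = n)).card : ℝ) ≤ (n.divisors.card : ℝ) ^ K := by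
  have h1 : (Fintype.piFinset fun _ : Fin K => A).filter (fun f => ∏ i, f i = n) ⊆
      Fintype.piFinset fun _ : Fin K => n.divisors := by
    intro f hf
    rw [Fintype.mem_piFinset]
    intro i
    rw [Nat.mem_divisors, ← (Finset.mem_filter.1 hf).2]
    refine ⟨Finset.dvd_prod_of_mem _ (Finset.mem_univ i), ?_⟩
    rw [(Finset.mem_filter.1 hf).2]; omega
  have h2 := Finset.card_le_card h1
  rw [Fintype.card_piFinset_const] at h2
  exact_mod_cast h2


noncomputable def bet (y : ℝ) (a : ℕ) : ℝ := min (1 / y) (1 / (a:ℝ))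

lemma bet_nonneg (y : ℝ) (hy : 0 < y) (a : ℕ) : 0 ≤ bet y a := by
  unfold bet; exact le_min (by positivity) (by positivity)

lemma bet_geom (y : ℝ) (hy : 0 < y) (a : ℕ) (ha : 1 ≤ a) (δ : ℝ) (h0 : 0 ≤ δ) (h1 : δ ≤ 1/2) :
    bet y a ≤ (1/y) ^ (1/2 - δ) * (1/(a:ℝ)) ^ (1/2 + δ) := by
  have ha0 : (0:ℝ) < a := by exact_mod_cast ha
  have hm : 0 < bet y a := by unfold bet; exact lt_min (by positivity) (by positivity)
  calc bet y a = bet y a ^ (1/2 - δ) * bet y a ^ (1/2 + δ) := by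
        rw [← Real.rpow_add hm]; norm_num
    _ ≤ _ := by
        refine mul_le_mul (Real.rpow_le_rpow hm.le (min_le_left _ _) (by linarith))
          (Real.rpow_le_rpow hm.le (min_le_right _ _) (by linarith)) (by positivity) (by positivity)

lemma part_two (K : ℕ) (hK : 1 ≤ K) : ∃ C : ℝ, 1 ≤ C ∧ ∀ (q : ℕ) [NeZero q] (A : Finset ℕ),
    (∀ a ∈ A, 1 ≤ a ∧ a ≤ q) → ∀ y : ℝ, 1 ≤ y → ∀ x : ZMod q,
    ∑ f ∈ (Fintype.piFinset fun _ : Fin K => A) with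
      (((∏ i, f i : ℕ) : ZMod q) = x ∧ q ≤ ∏ i, f i), ∏ i, bet y (f i) ≤ C * (q:ℝ) ^ (-(3/4) : ℝ) := by
  obtain ⟨T, hT1, hT⟩ := div_bound K hK
  refine ⟨9 * K * T, ?_, ?_⟩
  · have : (1:ℝ) ≤ K := by exact_mod_cast hK
    nlinarith
  intro q _ A hA y hy x
  have hq1 : 1 ≤ q := Nat.one_le_iff_ne_zero.2 (NeZero.ne q)
  have hq0 : (0:ℝ) < q := by exact_mod_cast hq1
  have hq1' : (1:ℝ) ≤ q := by exact_mod_cast hq1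
  set F := (Fintype.piFinset fun _ : Fin K => A) with hF
  set S := F.filter (fun f => (((∏ i, f i : ℕ) : ZMod q) = x ∧ q ≤ ∏ i, f i)) with hS
  have hFA : ∀ f ∈ F, ∀ i, f i ∈ A := fun f hf => Fintype.mem_piFinset.1 hf
  have hprod : ∀ f ∈ F, ∏ i, f i ≤ q ^ K := fun f hf => by
    calc ∏ i, f i ≤ ∏ _i : Fin K, q := Finset.prod_le_prod' fun i _ => (hA _ (hFA f hf i)).2
      _ = q ^ K := by simp
  have hmap : ∀ f ∈ S, (∏ i, f i) / q ∈ Icc 1 (q ^ K) := fun f hf => by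
    rw [hS, Finset.mem_filter] at hf
    rw [Finset.mem_Icc]
    exact ⟨(Nat.one_le_div_iff (by omega)).2 hf.2.2, (Nat.div_le_self _ _).trans (hprod f hf.1)⟩
  rw [← Finset.sum_fiberwise_of_maps_to hmap]
  have h1 : ∀ j ∈ Icc 1 (q ^ K), ∑ f ∈ S with (∏ i, f i) / q = j, ∏ i, bet y (f i) ≤
      (T * (q:ℝ) ^ (1/8 : ℝ)) / q * ((j:ℝ))⁻¹ := by
    intro j hj
    have hj1 := (Finset.mem_Icc.1 hj).1
    have hj0 : (0:ℝ) < j := by exact_mod_cast hj1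
    rcases (S.filter (fun f => (∏ i, f i) / q = j)).eq_empty_or_nonempty with he | ⟨f0, hf0⟩
    · rw [he, Finset.sum_empty]; positivity
    set n := j * q + x.val with hn
    have hfn : ∀ f ∈ S.filter (fun f => (∏ i, f i) / q = j), ∏ i, f i = n := fun f hf => by
      rw [Finset.mem_filter, hS, Finset.mem_filter] at hf
      obtain ⟨⟨_, h2, _⟩, h3⟩ := hf
      have h4 : (∏ i, f i) % q = x.val := by rw [← h2, ZMod.val_natCast]
      have h5 := Nat.div_add_mod' (∏ i, f i) q
      rw [h3, h4] at h5
      exact h5.symm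
    have hn1 : 1 ≤ n := by
      have : 1 * 1 ≤ j * q := Nat.mul_le_mul hj1 hq1
      omega
    have hnK : n ≤ q ^ K := by
      rw [← hfn f0 hf0]
      rw [Finset.mem_filter, hS, Finset.mem_filter] at hf0
      exact hprod f0 hf0.1.1
    have hterm : ∀ f ∈ S.filter (fun f => (∏ i, f i) / q = j), ∏ i, bet y (f i) ≤ 1 / (j * q : ℝ) := fun f hf => by
      have e := hfn f hf
      calc ∏ i, bet y (f i) ≤ ∏ i, 1 / ((f i : ℕ):ℝ) :=
            Finset.prod_le_prod (fun i _ => bet_nonneg y (by linarith) _) fun i _ => min_le_right _ _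
        _ = 1 / (n:ℝ) := by
            rw [← e]; push_cast; simp
        _ ≤ _ := by
            apply one_div_le_one_div_of_le (by positivity)
            rw [hn]; push_cast
            have : (0:ℝ) ≤ x.val := by positivity
            linarith
    have hcard : ((S.filter (fun f => (∏ i, f i) / q = j)).card : ℝ) ≤ T * (q:ℝ) ^ (1/8 : ℝ) := by
      refine le_trans ?_ ((card_fact K A n hn1).trans (hT q n hq1 hn1 hnK))
      have : (S.filter (fun f => (∏ i, f i) / q = j)) ⊆ F.filter (fun f => ∏ i, f i = n) := fun f hf => by
        have e := hfn f hf
        rw [Finset.mem_filter, hS, Finset.mem_filter] at hf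
        exact Finset.mem_filter.2 ⟨hf.1.1, e⟩
      exact_mod_cast Finset.card_le_card this
    calc _ ≤ ((S.filter (fun f => (∏ i, f i) / q = j)).card : ℝ) * (1 / (j * q : ℝ)) := by
          rw [← nsmul_eq_mul]; exact Finset.sum_le_card_nsmul _ _ _ hterm
      _ ≤ (T * (q:ℝ) ^ (1/8 : ℝ)) * (1 / (j * q : ℝ)) := by gcongr
      _ = _ := by field_simp
  refine (Finset.sum_le_sum h1).trans ?_
  rw [← Finset.mul_sum]
  have hh : ∑ j ∈ Icc 1 (q ^ K), ((j:ℝ))⁻¹ ≤ 1 + Real.log ((q:ℝ) ^ K) := by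
    have := harmonic_le_one_add_log (q ^ K)
    rw [harmonic_eq_sum_Icc] at this
    push_cast at this
    exact this
  have hlog : Real.log q ≤ 8 * (q:ℝ) ^ (1/8 : ℝ) := by
    have := Real.log_le_rpow_div hq0.le (ε := 1/8) (by norm_num)
    linarith
  have hqe : 1 ≤ (q:ℝ) ^ (1/8 : ℝ) := Real.one_le_rpow hq1' (by norm_num)
  have hK1 : (1:ℝ) ≤ K := by exact_mod_cast hK
  have hh2 : 1 + Real.log ((q:ℝ) ^ K) ≤ 9 * K * (q:ℝ) ^ (1/8 : ℝ) := by
    rw [Real.log_pow]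
    have a1 : (K:ℝ) * Real.log q ≤ K * (8 * (q:ℝ) ^ (1/8 : ℝ)) := by gcongr
    have a2 : 1 * 1 ≤ (K:ℝ) * (q:ℝ) ^ (1/8 : ℝ) := by gcongr
    linarith
  calc _ ≤ (T * (q:ℝ) ^ (1/8 : ℝ)) / q * (9 * K * (q:ℝ) ^ (1/8 : ℝ)) := by
        gcongr; exact hh.trans hh2
    _ = 9 * K * T * ((q:ℝ) ^ (1/8 : ℝ) * (q:ℝ) ^ (1/8 : ℝ) * (q:ℝ)^(-1:ℝ)) := by
        rw [Real.rpow_neg_one]; ring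
    _ = _ := by
        rw [← Real.rpow_add hq0, ← Real.rpow_add hq0]; norm_num

lemma part_one (K : ℕ) (q : ℕ) [NeZero q] (A : Finset ℕ)
    (hA : ∀ a ∈ A, 1 ≤ a ∧ a ≤ q) (y : ℝ) (hy : 1 ≤ y) (δ : ℝ) (h0 : 0 < δ) (h1 : δ ≤ 1/2) (x : ZMod q) :
    (∑ f ∈ (Fintype.piFinset fun _ : Fin K => A) with ∏ i, f i = x.val, ∏ i, bet y (f i)) ^ 2 ≤
      ((x.val.divisors.card : ℝ) ^ (2 * K) * (x.val : ℝ) ^ (-(1 + 2 * δ))) * ((1/y) ^ (1 - 2 * δ)) ^ K := by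
  set n := x.val with hn
  clear_value n
  have hy0 : 0 < y := by linarith
  set F := (Fintype.piFinset fun _ : Fin K => A) with hF
  have hFA : ∀ f ∈ F, ∀ i, f i ∈ A := fun f hf => Fintype.mem_piFinset.1 hf
  rcases Nat.eq_zero_or_pos n with hn0 | hn0
  · have : F.filter (fun f => ∏ i, f i = n) = ∅ := by
      rw [Finset.filter_eq_empty_iff]
      intro f hf h
      have := Finset.prod_pos (s := univ) (f := fun i => f i) fun i _ => (hA _ (hFA f hf i)).1
      omega
    rw [this, Finset.sum_empty, zero_pow two_ne_zero]
    positivity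
  have hnr : (0:ℝ) < n := by exact_mod_cast hn0
  have hterm : ∀ f ∈ F.filter (fun f => ∏ i, f i = n), ∏ i, bet y (f i) ≤
      ((1/y) ^ (1/2 - δ)) ^ K * (1/(n:ℝ)) ^ (1/2 + δ) := fun f hf => by
    obtain ⟨hf1, hf2⟩ := Finset.mem_filter.1 hf
    calc ∏ i, bet y (f i) ≤ ∏ i, ((1/y) ^ (1/2 - δ) * (1/((f i : ℕ):ℝ)) ^ (1/2 + δ)) :=
          Finset.prod_le_prod (fun i _ => bet_nonneg y hy0 _) fun i _ =>
            bet_geom y hy0 _ (hA _ (hFA f hf1 i)).1 δ h0.le h1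
      _ = _ := by
          rw [Finset.prod_mul_distrib, Finset.prod_const, Finset.card_univ, Fintype.card_fin,
            Real.finsetProd_rpow _ _ (fun i _ => by positivity), ← hf2]
          push_cast
          simp
  have hcard := card_fact K A n hn0
  have hsum : ∑ f ∈ F with ∏ i, f i = n, ∏ i, bet y (f i) ≤
      (n.divisors.card:ℝ) ^ K * (((1/y) ^ (1/2 - δ)) ^ K * (1/(n:ℝ)) ^ (1/2 + δ)) := by
    calc _ ≤ ((F.filter (fun f => ∏ i, f i = n)).card : ℝ) * _ := by
          rw [← nsmul_eq_mul]; exact Finset.sum_le_card_nsmul _ _ _ hterm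
      _ ≤ _ := by gcongr
  have hnn : 0 ≤ ∑ f ∈ F with ∏ i, f i = n, ∏ i, bet y (f i) :=
    Finset.sum_nonneg fun f _ => Finset.prod_nonneg fun i _ => bet_nonneg y hy0 _
  refine (pow_le_pow_left₀ hnn hsum 2).trans (le_of_eq ?_)
  rw [mul_pow, mul_pow, ← pow_mul, ← pow_mul, mul_comm K 2, pow_mul ((1/y) ^ (1/2 - δ))]
  have e1 : ((1/y) ^ (1/2 - δ)) ^ 2 = (1/y) ^ (1 - 2 * δ) := by
    rw [← Real.rpow_natCast, ← Real.rpow_mul (by positivity)]; congr 1; push_cast; ring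
  have e2 : ((1/(n:ℝ)) ^ (1/2 + δ)) ^ 2 = (n:ℝ) ^ (-(1 + 2 * δ)) := by
    rw [← Real.rpow_natCast, ← Real.rpow_mul (by positivity), one_div, Real.inv_rpow hnr.le,
      ← Real.rpow_neg hnr.le]; congr 1; push_cast; ring
  rw [e1, e2]; ring

lemma R_bound (K : ℕ) (hK : 1 ≤ K) : ∃ C D : ℝ, 0 < C ∧ 0 < D ∧ ∀ (q : ℕ) [NeZero q] (A : Finset ℕ),
    (∀ a ∈ A, 1 ≤ a ∧ a ≤ q) → ∀ y : ℝ, 1 ≤ y → y ^ K ≤ (q:ℝ) ^ (1/2 : ℝ) →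
    ∑ x : ZMod q, (∑ f ∈ (Fintype.piFinset fun _ : Fin K => A) with
      ((∏ i, f i : ℕ) : ZMod q) = x, ∏ i, bet y (f i)) ^ 2 ≤ C * (1/y) ^ K * (1 + 2 * Real.log (2 * y)) ^ D := by
  obtain ⟨C2, hC2, h2⟩ := part_two K hK
  refine ⟨2 * Real.exp 1 ^ K + 2 * C2 ^ 2, (2 ^ (2 * K) : ℕ), by positivity, by positivity, ?_⟩
  intro q _ A hA y hy hyq
  have hq1 : 1 ≤ q := Nat.one_le_iff_ne_zero.2 (NeZero.ne q)
  have hq0 : (0:ℝ) < q := by exact_mod_cast hq1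
  have hy0 : 0 < y := by linarith
  set F := (Fintype.piFinset fun _ : Fin K => A) with hF
  have hl2 : Real.log 2 ≤ Real.log (2 * y) := Real.log_le_log (by norm_num) (by linarith)
  have hl := Real.log_two_gt_d9
  set ly := Real.log (2 * y) with hly
  have hl0 : 0 < ly := by linarith
  set δ := 1 / (4 * ly) with hδ
  have hδ0 : 0 < δ := by positivity
  have hδ1 : δ ≤ 1/2 := by
    rw [hδ]; apply one_div_le_one_div_of_le (by norm_num); linarith
  set u1 : ZMod q → ℝ := fun x => ∑ f ∈ F with ∏ i, f i = x.val, ∏ i, bet y (f i) with hu1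
  set u2 : ZMod q → ℝ := fun x => ∑ f ∈ F with (((∏ i, f i : ℕ) : ZMod q) = x ∧ q ≤ ∏ i, f i), ∏ i, bet y (f i) with hu2
  have hw : ∀ f : Fin K → ℕ, 0 ≤ ∏ i, bet y (f i) := fun f => Finset.prod_nonneg fun i _ => bet_nonneg y hy0 _
  have hsplit : ∀ x : ZMod q, ∑ f ∈ F with ((∏ i, f i : ℕ) : ZMod q) = x, ∏ i, bet y (f i) ≤ u1 x + u2 x := by
    intro x
    rw [hu1, hu2]
    simp only [Finset.sum_filter]
    rw [← Finset.sum_add_distrib]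
    refine Finset.sum_le_sum fun f _ => ?_
    have := hw f
    by_cases h : ((∏ i, f i : ℕ) : ZMod q) = x
    · rw [if_pos h]
      by_cases h' : q ≤ ∏ i, f i
      · rw [if_pos (show ((∏ i, f i : ℕ) : ZMod q) = x ∧ q ≤ ∏ i, f i from ⟨h, h'⟩)]
        split_ifs <;> linarith
      · have e : ∏ i, f i = x.val := by
          rw [← h, ZMod.val_natCast, Nat.mod_eq_of_lt (by omega)]
        rw [if_pos e]
        split_ifs <;> linarith
    · rw [if_neg h]
      split_ifs <;> linarith
  have hu2b : ∀ x, u2 x ≤ C2 * (q:ℝ) ^ (-(3/4) : ℝ) := fun x => h2 q A hA y hy x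
  have hu1b := part_one K q A hA y hy δ hδ0 hδ1
  have hu20 : ∀ x, 0 ≤ u2 x := fun x => Finset.sum_nonneg fun f _ => hw f
  have hu10 : ∀ x, 0 ≤ u1 x := fun x => Finset.sum_nonneg fun f _ => hw f
  set g : ℕ → ℝ := fun n => (n.divisors.card : ℝ) ^ (2 * K) * (n : ℝ) ^ (-(1 + 2 * δ)) with hg
  have hg0 : ∀ n, 0 ≤ g n := fun n => by rw [hg]; positivity
  have hgs : ∑ x : ZMod q, g x.val ≤ (1 + 2 * ly) ^ (2 ^ (2 * K)) := by
    have e1 : ∑ x : ZMod q, g x.val = ∑ n ∈ univ.image (ZMod.val : ZMod q → ℕ), g n := by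
      rw [Finset.sum_image]; intro a _ b _ h; exact ZMod.val_injective q h
    have e2 : ∑ n ∈ univ.image (ZMod.val : ZMod q → ℕ), g n ≤ ∑ n ∈ insert 0 (Icc 1 q), g n := by
      apply Finset.sum_le_sum_of_subset_of_nonneg
      · intro n hn
        obtain ⟨x, _, rfl⟩ := Finset.mem_image.1 hn
        have := ZMod.val_lt x
        rw [Finset.mem_insert, Finset.mem_Icc]; omega
      · intro n _ _; exact hg0 n
    rw [Finset.sum_insert (by simp)] at e2
    have e3 : g 0 = 0 := by
      rw [hg]; simp only [Nat.divisors_zero, Finset.card_empty, Nat.cast_zero]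
      rw [zero_pow (by omega), zero_mul]
    have e4 := div_moment (2 * δ) (by positivity) q (2 * K)
    have e5 : 1 / (2 * δ) = 2 * ly := by rw [hδ]; field_simp; norm_num
    rw [e5] at e4
    rw [e1]
    refine e2.trans ?_
    rw [e3, zero_add]
    exact e4
  have hyδ : ((1/y) ^ (1 - 2 * δ)) ^ K ≤ Real.exp 1 ^ K * (1/y)^K := by
    rw [← mul_pow]
    gcongr
    rw [one_div, Real.inv_rpow hy0.le, ← Real.rpow_neg hy0.le, neg_sub, Real.rpow_sub hy0, Real.rpow_one,
      div_eq_mul_inv]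
    gcongr
    rw [Real.rpow_def_of_pos hy0]
    apply Real.exp_le_exp.2
    have : Real.log y ≤ ly := Real.log_le_log hy0 (by linarith)
    calc Real.log y * (2 * δ) ≤ ly * (2 * δ) := by gcongr
      _ = 1/2 := by rw [hδ]; field_simp; norm_num
      _ ≤ 1 := by norm_num
  have hs1 : ∑ x, u1 x ^ 2 ≤ (1 + 2 * ly) ^ (2 ^ (2 * K)) * (Real.exp 1 ^ K * (1/y)^K) := by
    calc _ ≤ ∑ x : ZMod q, g x.val * ((1/y) ^ (1 - 2 * δ)) ^ K := Finset.sum_le_sum fun x _ => hu1b x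
      _ = (∑ x : ZMod q, g x.val) * ((1/y) ^ (1 - 2 * δ)) ^ K := by rw [Finset.sum_mul]
      _ ≤ _ := by gcongr
  have hs2 : ∑ x, u2 x ^ 2 ≤ C2 ^ 2 * (1/y)^K := by
    calc _ ≤ ∑ x : ZMod q, (C2 * (q:ℝ) ^ (-(3/4) : ℝ)) ^ 2 :=
          Finset.sum_le_sum fun x _ => pow_le_pow_left₀ (hu20 x) (hu2b x) 2
      _ = C2 ^ 2 * ((q:ℝ) * ((q:ℝ) ^ (-(3/4) : ℝ)) ^ 2) := by
          rw [Finset.sum_const, Finset.card_univ, ZMod.card, nsmul_eq_mul]; ring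
      _ = C2 ^ 2 * ((q:ℝ) ^ (1/2 : ℝ))⁻¹ := by
          congr 1
          rw [← Real.rpow_natCast, ← Real.rpow_mul hq0.le, ← Real.rpow_neg hq0.le]
          nth_rw 1 [← Real.rpow_one (q:ℝ)]
          rw [← Real.rpow_add hq0]; norm_num
      _ ≤ _ := by
          rw [one_div_pow, one_div (y^K)]
          gcongr
  have hL : 1 ≤ (1 + 2 * ly) ^ (2 ^ (2 * K)) := one_le_pow₀ (by linarith)
  rw [Real.rpow_natCast]
  calc _ ≤ ∑ x, (2 * u1 x ^ 2 + 2 * u2 x ^ 2) := by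
        refine Finset.sum_le_sum fun x _ => ?_
        have := pow_le_pow_left₀ (Finset.sum_nonneg fun f _ => hw f) (hsplit x) 2
        nlinarith [sq_nonneg (u1 x - u2 x)]
    _ = 2 * ∑ x, u1 x ^ 2 + 2 * ∑ x, u2 x ^ 2 := by rw [Finset.sum_add_distrib, Finset.mul_sum, Finset.mul_sum]
    _ ≤ 2 * ((1 + 2 * ly) ^ (2 ^ (2 * K)) * (Real.exp 1 ^ K * (1/y)^K)) + 2 * (C2 ^ 2 * (1/y)^K * (1 + 2 * ly) ^ (2 ^ (2 * K))) := by
        have : C2 ^ 2 * (1/y)^K * 1 ≤ C2 ^ 2 * (1/y)^K * (1 + 2 * ly) ^ (2 ^ (2 * K)) := by gcongr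
        linarith
    _ = _ := by
        generalize (1 + 2 * ly) ^ (2 ^ (2 * K)) = L
        ring


lemma conj_char {q : ℕ} [NeZero q] (χ : DirichletCharacter ℂ q) (x : ZMod q) :
    (starRingEnd ℂ) (χ x) = χ⁻¹ x := by
  have := MulChar.star_apply' χ x
  exact this

lemma conj_std {q : ℕ} [NeZero q] (x : ZMod q) :
    (starRingEnd ℂ) (ZMod.stdAddChar (N := q) x) = ZMod.stdAddChar (N := q) (-x) := by
  rw [AddChar.map_neg_eq_conj]

lemma gauss_expand {q : ℕ} [NeZero q] (χ : DirichletCharacter ℂ q) (hχ : χ.IsPrimitive) (a : ZMod q) :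
    χ a * (starRingEnd ℂ) (gaussSum χ ZMod.stdAddChar) = ∑ x, χ⁻¹ x * ZMod.stdAddChar (-(a * x)) := by
  have h := congrArg (starRingEnd ℂ) (gaussSum_mulShift_of_isPrimitive ZMod.stdAddChar hχ a)
  rw [map_mul, conj_char, inv_inv] at h
  rw [← h, gaussSum, map_sum]
  refine Finset.sum_congr rfl fun x _ => ?_
  rw [map_mul, conj_char, AddChar.mulShift_apply, conj_std]

lemma gauss_norm {q : ℕ} [NeZero q] (χ : DirichletCharacter ℂ q) (hχ : χ.IsPrimitive) :
    ‖gaussSum χ (ZMod.stdAddChar (N := q))‖ ^ 2 = q := by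
  have h := congrFun (ZMod.dft_dft (χ : ZMod q → ℂ)) (-1)
  rw [ZMod.dft_apply] at h
  simp only [hχ.fourierTransform_eq_inv_mul_gaussSum, neg_neg, map_one, smul_eq_mul, mul_one, mul_neg] at h
  have h2 := gauss_expand χ hχ 1
  rw [map_one, one_mul] at h2
  have h3 : ∑ x, χ⁻¹ x * ZMod.stdAddChar (N := q) (-(1 * x)) =
      ∑ x, ZMod.stdAddChar (N := q) x * χ⁻¹ (-x) := by
    rw [← Equiv.sum_comp (Equiv.neg (ZMod q))]
    refine Finset.sum_congr rfl fun x _ => ?_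
    simp [mul_comm]
  have h4 : (starRingEnd ℂ) (gaussSum χ (ZMod.stdAddChar (N := q))) * gaussSum χ (ZMod.stdAddChar (N := q)) = q := by
    rw [h2, h3, ← h, Finset.sum_mul]
    exact Finset.sum_congr rfl fun x _ => by ring
  rw [mul_comm, Complex.mul_conj, Complex.normSq_eq_norm_sq] at h4
  exact_mod_cast h4

noncomputable def BB (q : ℕ) [NeZero q] (N : ℕ) (x : ZMod q) : ℂ :=
  ∑ n ∈ Icc 1 N, ZMod.stdAddChar (N := q) ((n : ZMod q) * x)

lemma gauss_S {q : ℕ} [NeZero q] (χ : DirichletCharacter ℂ q) (hχ : χ.IsPrimitive) (N : ℕ) :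
    ‖∑ n ∈ Icc 1 N, χ (n : ZMod q)‖ ^ 2 * q = ‖∑ x, χ⁻¹ x * BB q N (-x)‖ ^ 2 := by
  rw [← gauss_norm χ hχ, ← mul_pow]
  congr 1
  rw [← Complex.norm_conj (gaussSum χ _), ← norm_mul, Finset.sum_mul]
  congr 1
  simp only [gauss_expand χ hχ]
  rw [Finset.sum_comm]
  refine Finset.sum_congr rfl fun x _ => ?_
  rw [BB, Finset.mul_sum]
  exact Finset.sum_congr rfl fun n _ => by rw [mul_neg]

lemma geom_norm (z : ℂ) (hz : ‖z‖ = 1) (N : ℕ) : ‖z - 1‖ * ‖∑ n ∈ Icc 1 N, z ^ n‖ ≤ 2 := by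
  have h : (z - 1) * ∑ n ∈ Icc 1 N, z ^ n = z ^ (N+1) - z := by
    induction N with
    | zero => simp
    | succ n ih =>
      rw [Finset.sum_Icc_succ_top (by omega), mul_add, ih]; ring
  rw [← norm_mul, h]
  refine (norm_sub_le _ _).trans ?_
  rw [norm_pow, hz]; norm_num

lemma std_sub_one {q : ℕ} [NeZero q] (j : ℤ) :
    ‖ZMod.stdAddChar (N := q) (j : ZMod q) - 1‖ = |2 * Real.sin (π * j / q)| := by
  rw [ZMod.stdAddChar_coe]
  have : 2 * π * I * j / q = I * ((2 * π * j / q : ℝ) : ℂ) := by push_cast; ring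
  rw [this, Complex.norm_exp_I_mul_ofReal_sub_one, Real.norm_eq_abs]
  congr 3; ring

lemma BB_bound {q : ℕ} [NeZero q] (N : ℕ) (a : ℕ) (ha : 1 ≤ a) (ha2 : 2 * a ≤ q) (x : ZMod q)
    (hx : x = a ∨ x = -(a : ZMod q)) (y : ℝ) (hy : 0 < y) (hN : (N:ℝ) ≤ q / y) :
    ‖BB q N x‖ ≤ q * bet y a := by
  have hq0 : (0:ℝ) < q := by exact_mod_cast (by omega : 0 < q)
  have ha0 : (0:ℝ) < a := by exact_mod_cast ha
  have ha2' : 2 * (a:ℝ) ≤ q := by exact_mod_cast ha2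
  have hz : ‖ZMod.stdAddChar (N := q) x‖ = 1 := AddChar.norm_apply _ _
  have e : BB q N x = ∑ n ∈ Icc 1 N, (ZMod.stdAddChar (N := q) x) ^ n := by
    rw [BB]; refine Finset.sum_congr rfl fun n _ => ?_
    rw [← nsmul_eq_mul, AddChar.map_nsmul_eq_pow]
  have h1 : ‖BB q N x‖ ≤ N := by
    rw [e]
    refine (norm_sum_le _ _).trans ?_
    simp [norm_pow, hz]
  have hs : ‖ZMod.stdAddChar (N := q) x - 1‖ = |2 * Real.sin (π * a / q)| := by
    rcases hx with rfl | rfl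
    · have := std_sub_one (q := q) (a : ℤ)
      push_cast at this; exact this
    · have := std_sub_one (q := q) (-(a : ℤ))
      push_cast at this
      rw [this, mul_neg, neg_div, Real.sin_neg, mul_neg, abs_neg]
  have hs2 : 4 * a / q ≤ ‖ZMod.stdAddChar (N := q) x - 1‖ := by
    rw [hs]
    refine le_trans ?_ (le_abs_self _)
    have h3 : π * a / q ≤ π / 2 := by
      rw [div_le_div_iff₀ hq0 (by norm_num)]
      nlinarith [Real.pi_pos]
    have h2 := Real.mul_le_sin (x := π * a / q) (by positivity) h3
    have h4 : 2 / π * (π * a / q) = 2 * a / q := by field_simp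
    rw [h4] at h2
    calc 4 * (a:ℝ) / q = 2 * (2 * a / q) := by ring
      _ ≤ _ := by linarith
  have h5 := geom_norm _ hz N
  rw [← e] at h5
  have h6 : 4 * a / q * ‖BB q N x‖ ≤ 2 := (mul_le_mul_of_nonneg_right hs2 (norm_nonneg _)).trans h5
  have h7 : ‖BB q N x‖ ≤ q / a := by
    rw [le_div_iff₀ ha0]
    rw [div_mul_eq_mul_div, div_le_iff₀ hq0] at h6
    linarith
  unfold bet
  rw [mul_min_of_nonneg _ _ hq0.le]
  refine le_min ?_ ?_
  · rw [mul_one_div]; exact h1.trans hN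
  · rw [mul_one_div]; exact h7

lemma sum_zmod_split {q : ℕ} [NeZero q] (F : ZMod q → ℂ) :
    ∑ x, F x = F 0 + ∑ a ∈ Icc 1 (q/2), F (a : ZMod q) + ∑ a ∈ Icc 1 ((q-1)/2), F (-(a : ZMod q)) := by
  have hq : 0 < q := Nat.pos_of_ne_zero (NeZero.ne q)
  have hcast : ∀ a : ℕ, a ≤ q → (-(a : ZMod q)) = ((q - a : ℕ) : ZMod q) := fun a ha => by
    rw [Nat.cast_sub ha]; simp
  rw [← Finset.sum_filter_add_sum_filter_not univ (fun x : ZMod q => x.val ≤ q/2)]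
  congr 1
  · have : F 0 + ∑ a ∈ Icc 1 (q/2), F (a : ZMod q) = ∑ a ∈ insert 0 (Icc 1 (q/2)), F (a : ZMod q) := by
      rw [Finset.sum_insert (by simp)]; simp
    rw [this]
    refine Finset.sum_nbij' (fun x => x.val) (fun a => (a : ZMod q)) ?_ ?_ ?_ ?_ ?_
    · intro x hx
      have := (Finset.mem_filter.1 hx).2
      rw [Finset.mem_insert, Finset.mem_Icc]; omega
    · intro a ha
      rw [Finset.mem_insert, Finset.mem_Icc] at ha
      refine Finset.mem_filter.2 ⟨Finset.mem_univ _, ?_⟩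
      rw [ZMod.val_natCast]
      exact (Nat.mod_le _ _).trans (by omega)
    · intro x _; simp
    · intro a ha
      rw [Finset.mem_insert, Finset.mem_Icc] at ha
      rw [ZMod.val_natCast]
      exact Nat.mod_eq_of_lt (by omega)
    · intro x _; simp
  · refine Finset.sum_nbij' (fun x => q - x.val) (fun a => -(a : ZMod q)) ?_ ?_ ?_ ?_ ?_
    · intro x hx
      have := (Finset.mem_filter.1 hx).2
      have := ZMod.val_lt x
      rw [Finset.mem_Icc]; omega
    · intro a ha
      rw [Finset.mem_Icc] at ha
      refine Finset.mem_filter.2 ⟨Finset.mem_univ _, ?_⟩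
      rw [hcast a (by omega), ZMod.val_natCast, Nat.mod_eq_of_lt (by omega)]
      omega
    · intro x _
      have := ZMod.val_lt x
      rw [Nat.cast_sub this.le]; simp
    · intro a ha
      rw [Finset.mem_Icc] at ha
      rw [hcast a (by omega), ZMod.val_natCast, Nat.mod_eq_of_lt (by omega)]
      omega
    · intro x _
      have := ZMod.val_lt x
      rw [Nat.cast_sub this.le]; simp

lemma half_moment {q : ℕ} [NeZero q] (K : ℕ) (A : Finset ℕ) (b : ℕ → ℂ) (y : ℝ)
    (hb : ∀ a ∈ A, ‖b a‖ ≤ q * bet y a) :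
    ∑ χ : DirichletCharacter ℂ q, ‖∑ a ∈ A, b a * χ (a : ZMod q)‖ ^ (2 * K) ≤
      (q.totient : ℝ) * ((q:ℝ) ^ (2 * K) * ∑ x : ZMod q, (∑ f ∈ (Fintype.piFinset fun _ : Fin K => A) with
      ((∏ i, f i : ℕ) : ZMod q) = x, ∏ i, bet y (f i)) ^ 2) := by
  refine (moment_le K A b).trans ?_
  gcongr
  rw [Finset.mul_sum]
  refine Finset.sum_le_sum fun x _ => ?_
  rw [mul_comm 2 K, pow_mul, ← mul_pow]
  gcongr
  rw [Dco, Finset.mul_sum]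
  refine (norm_sum_le _ _).trans (Finset.sum_le_sum fun f hf => ?_)
  rw [norm_prod]
  have hfA := Fintype.mem_piFinset.1 (Finset.mem_filter.1 hf).1
  calc _ ≤ ∏ i, ((q:ℝ) * bet y (f i)) := Finset.prod_le_prod (fun i _ => norm_nonneg _) fun i _ => hb _ (hfA i)
    _ = _ := by rw [Finset.prod_mul_distrib]; simp

open Classical in
lemma small_y (K : ℕ) (hK : 1 ≤ K) : ∃ C D : ℝ, 0 < C ∧ 0 < D ∧ ∀ (q : ℕ) [NeZero q], 3 ≤ q →
    ∀ y : ℝ, 1 ≤ y → y ^ K ≤ (q:ℝ) ^ (1/2 : ℝ) →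
    ∑ χ ∈ (Finset.univ : Finset (DirichletCharacter ℂ q)).filter (fun χ => χ.IsPrimitive),
      ‖∑ n ∈ Icc 1 ⌊(q:ℝ) / y⌋₊, χ (n : ZMod q)‖ ^ (2 * K) ≤
      C * q.totient * ((q:ℝ) / y) ^ K * (1 + 2 * Real.log (2 * y)) ^ D := by
  obtain ⟨C, D, hC, hD, h⟩ := R_bound K hK
  refine ⟨2 ^ (2 * K) * (2 * C), D, by positivity, hD, ?_⟩
  intro q _ hq3 y hy hyq
  have hq0 : (0:ℝ) < q := by exact_mod_cast (by omega : 0 < q)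
  have hy0 : 0 < y := by linarith
  set N := ⌊(q:ℝ) / y⌋₊ with hN
  have hNq : (N:ℝ) ≤ q / y := Nat.floor_le (by positivity)
  clear_value N
  set R := C * (1/y) ^ K * (1 + 2 * Real.log (2 * y)) ^ D with hR
  set G : ZMod q → ℂ := fun x => BB q N (-x) with hG
  have hS : ∀ χ : DirichletCharacter ℂ q, χ.IsPrimitive →
      ‖∑ n ∈ Icc 1 N, χ (n : ZMod q)‖ ^ (2 * K) * (q:ℝ) ^ K = ‖∑ x, χ⁻¹ x * G x‖ ^ (2 * K) := fun χ hχ => by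
    rw [pow_mul, ← mul_pow, gauss_S χ hχ, ← pow_mul]
  have hb1 : ∑ χ : DirichletCharacter ℂ q, ‖∑ a ∈ Icc 1 (q/2), G a * χ (a : ZMod q)‖ ^ (2 * K) ≤
      (q.totient : ℝ) * ((q:ℝ) ^ (2 * K) * R) := by
    refine (half_moment K _ _ y fun a ha => ?_).trans ?_
    · have := Finset.mem_Icc.1 ha
      exact BB_bound N a this.1 (by omega) _ (Or.inr rfl) y hy0 hNq
    · gcongr
      refine h q _ (fun a ha => ?_) y hy hyq
      have := Finset.mem_Icc.1 ha
      omega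
  have hb2 : ∑ χ : DirichletCharacter ℂ q, ‖∑ a ∈ Icc 1 ((q-1)/2), G (-(a : ZMod q)) * χ (a : ZMod q)‖ ^ (2 * K) ≤
      (q.totient : ℝ) * ((q:ℝ) ^ (2 * K) * R) := by
    refine (half_moment K _ (fun a => G (-(a : ZMod q))) y fun a ha => ?_).trans ?_
    · have := Finset.mem_Icc.1 ha
      exact BB_bound N a this.1 (by omega) _ (Or.inl (neg_neg _)) y hy0 hNq
    · gcongr
      refine h q _ (fun a ha => ?_) y hy hyq
      have := Finset.mem_Icc.1 ha
      omega
  have hpt : ∀ χ : DirichletCharacter ℂ q, ‖∑ x, χ x * G x‖ ^ (2 * K) ≤ 2 ^ (2 * K) *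
      (‖∑ a ∈ Icc 1 (q/2), G a * χ (a : ZMod q)‖ ^ (2 * K) +
       ‖∑ a ∈ Icc 1 ((q-1)/2), G (-(a : ZMod q)) * χ (a : ZMod q)‖ ^ (2 * K)) := by
    intro χ
    set s1 := ∑ a ∈ Icc 1 (q/2), G a * χ (a : ZMod q) with hs1
    set s2 := ∑ a ∈ Icc 1 ((q-1)/2), G (-(a : ZMod q)) * χ (a : ZMod q) with hs2
    have hχ0 : χ 0 = 0 := by
      haveI : Fact (1 < q) := ⟨by omega⟩
      exact MulChar.map_nonunit χ not_isUnit_zero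
    have e : ∑ x, χ x * G x = s1 + χ (-1) * s2 := by
      rw [sum_zmod_split, hχ0, zero_mul, zero_add, hs1, hs2, Finset.mul_sum]
      congr 1
      · exact Finset.sum_congr rfl fun a _ => mul_comm _ _
      · refine Finset.sum_congr rfl fun a _ => ?_
        rw [← neg_one_mul (a : ZMod q), map_mul]; ring
    have hn : ‖∑ x, χ x * G x‖ ≤ ‖s1‖ + ‖s2‖ := by
      rw [e]
      refine (norm_add_le _ _).trans ?_
      rw [norm_mul]
      have := DirichletCharacter.norm_le_one χ (-1)
      nlinarith [norm_nonneg s2]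
    have h2 := add_pow_le (norm_nonneg s1) (norm_nonneg s2) (2 * K)
    refine ((pow_le_pow_left₀ (norm_nonneg _) hn _).trans h2).trans ?_
    gcongr
    · norm_num
    · omega
  have hfin : (q:ℝ) ^ K * ∑ χ ∈ (Finset.univ : Finset (DirichletCharacter ℂ q)).filter (fun χ => χ.IsPrimitive),
      ‖∑ n ∈ Icc 1 N, χ (n : ZMod q)‖ ^ (2 * K) ≤ 2 ^ (2 * K) * (2 * ((q.totient : ℝ) * ((q:ℝ) ^ (2 * K) * R))) := by
    calc _ = ∑ χ ∈ (Finset.univ : Finset (DirichletCharacter ℂ q)).filter (fun χ => χ.IsPrimitive),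
          ‖∑ x, χ⁻¹ x * G x‖ ^ (2 * K) := by
          rw [Finset.mul_sum]
          refine Finset.sum_congr rfl fun χ hχ => ?_
          rw [← hS χ (Finset.mem_filter.1 hχ).2, mul_comm]
      _ ≤ ∑ χ : DirichletCharacter ℂ q, ‖∑ x, χ⁻¹ x * G x‖ ^ (2 * K) :=
          Finset.sum_le_sum_of_subset_of_nonneg (Finset.filter_subset _ _) fun _ _ _ => by positivity
      _ = ∑ χ : DirichletCharacter ℂ q, ‖∑ x, χ x * G x‖ ^ (2 * K) :=
          Equiv.sum_comp (Equiv.inv (DirichletCharacter ℂ q)) (fun χ => ‖∑ x, χ x * G x‖ ^ (2 * K))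
      _ ≤ _ := (Finset.sum_le_sum fun χ _ => hpt χ)
      _ ≤ _ := by
          rw [← Finset.mul_sum, Finset.sum_add_distrib]
          gcongr
          linarith
  have hqK : (0:ℝ) < (q:ℝ) ^ K := by positivity
  refine le_of_mul_le_mul_left (hfin.trans (le_of_eq ?_)) hqK
  rw [hR, one_div_pow, div_pow, mul_comm 2 K, pow_mul (q:ℝ) K 2]
  generalize (2:ℝ) ^ (K * 2) = t
  generalize (1 + 2 * Real.log (2 * y)) ^ D = L
  field_simp



open Classical in
lemma int_bound (K : ℕ) (hK : 1 ≤ K) : ∃ C D : ℝ, 0 < C ∧ 0 < D ∧ ∀ (q : ℕ) [NeZero q], 3 ≤ q →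
    (∀ χ : DirichletCharacter ℂ q, dirichletRH χ) →
    ∀ y : ℝ, 1 ≤ y → y ≤ (q:ℝ) ^ ((1:ℝ)/2) →
    ∑ χ ∈ (Finset.univ : Finset (DirichletCharacter ℂ q)).filter (fun χ => χ.IsPrimitive),
      ‖∑ n ∈ Icc 1 ⌊(q:ℝ) / y⌋₊, χ (n : ZMod q)‖ ^ (2 * K) ≤
      C * q.totient * ((q:ℝ) / y) ^ K * (1 + 2 * Real.log (2 * y)) ^ D := by
  obtain ⟨C1, D1, hC1, hD1, h1⟩ := small_y K hK
  obtain ⟨C2, D2, hC2, hD2, h2⟩ := large_y K hK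
  have hKr : (1:ℝ) ≤ K := by exact_mod_cast hK
  refine ⟨C1 + C2 * (K:ℝ) ^ D2, D1 + D2, by positivity, by positivity, ?_⟩
  intro q _ hq3 hRH y hy hyq
  have hq3r : (3:ℝ) ≤ q := by exact_mod_cast hq3
  have hq0 : (0:ℝ) < q := by linarith
  have hy0 : 0 < y := by linarith
  have hly : 0 ≤ Real.log (2 * y) := Real.log_nonneg (by linarith)
  have hL1 : 1 ≤ 1 + 2 * Real.log (2 * y) := by linarith
  by_cases hc : y ^ K ≤ (q:ℝ) ^ (1/2 : ℝ)
  · refine (h1 q hq3 y hy hc).trans ?_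
    gcongr
    · have : 0 ≤ C2 * (K:ℝ) ^ D2 := by positivity
      linarith
    · linarith
  · push Not at hc
    have hlog : Real.log q ≤ 2 * K * Real.log (2 * y) := by
      have e1 := Real.log_le_log (by positivity) hc.le
      rw [Real.log_pow, Real.log_rpow hq0] at e1
      have e2 : Real.log y ≤ Real.log (2 * y) := Real.log_le_log hy0 (by linarith)
      have e3 : (K:ℝ) * Real.log y ≤ K * Real.log (2 * y) := by gcongr
      linarith
    have hlq : 0 ≤ Real.log q := Real.log_nonneg (by linarith)
    have hN : 1 ≤ ⌊(q:ℝ) / y⌋₊ := by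
      rw [Nat.one_le_floor_iff, le_div_iff₀ hy0, one_mul]
      refine hyq.trans ?_
      calc (q:ℝ) ^ ((1:ℝ)/2) ≤ (q:ℝ) ^ (1:ℝ) := Real.rpow_le_rpow_of_exponent_le (by linarith) (by norm_num)
        _ = q := Real.rpow_one _
    have hNr : (⌊(q:ℝ) / y⌋₊ : ℝ) ≤ q / y := Nat.floor_le (by positivity)
    have hNq : ⌊(q:ℝ) / y⌋₊ ≤ q := by
      have : (⌊(q:ℝ) / y⌋₊ : ℝ) ≤ q := hNr.trans (div_le_self hq0.le hy)
      exact_mod_cast this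
    refine (h2 q hq3 hRH _ ?_ _ hN hNq).trans ?_
    · intro χ hχ h
      have := (Finset.mem_filter.1 hχ).2
      rw [h, DirichletCharacter.isPrimitive_def, DirichletCharacter.conductor_one] at this
      omega
    · have e1 : (1 + Real.log q) ^ D2 ≤ (K:ℝ) ^ D2 * (1 + 2 * Real.log (2 * y)) ^ (D1 + D2) := by
        calc (1 + Real.log q) ^ D2 ≤ (K * (1 + 2 * Real.log (2 * y))) ^ D2 := by
              gcongr; linarith
          _ = (K:ℝ) ^ D2 * (1 + 2 * Real.log (2 * y)) ^ D2 := by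
              rw [Real.mul_rpow (by positivity) (by linarith)]
          _ ≤ _ := by
              gcongr
              linarith
      calc _ ≤ C2 * q.totient * ((q:ℝ) / y) ^ K * ((K:ℝ) ^ D2 * (1 + 2 * Real.log (2 * y)) ^ (D1 + D2)) := by
            gcongr
        _ = (C2 * (K:ℝ) ^ D2) * q.totient * ((q:ℝ) / y) ^ K * (1 + 2 * Real.log (2 * y)) ^ (D1 + D2) := by ring
        _ ≤ _ := by
            gcongr
            linarith

open Classical in
theorem stmt17 (k : ℝ) (hk : 2 < k) :
    ∃ C D : ℝ, 0 < C ∧ 0 < D ∧ ∃ q0 : ℕ, ∀ (q : ℕ) [NeZero q], q0 ≤ q →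
      (∀ χ : DirichletCharacter ℂ q, dirichletRH χ) →
      ∀ y : ℝ, 1 ≤ y → y ≤ (q : ℝ) ^ ((1 : ℝ) / 2) →
      ∑ χ ∈ Finset.univ.filter (fun χ : DirichletCharacter ℂ q => χ.IsPrimitive),
        ‖∑ n ∈ Finset.Icc 1 ⌊(q : ℝ) / y⌋₊, χ n‖ ^ (2 * k)
      ≤ C * (Nat.totient q) * ((q : ℝ) / y) ^ k * Real.log (2 * y) ^ D := by
  set K := ⌈k⌉₊ with hKdef
  have hkK : k ≤ K := Nat.le_ceil k
  have hK : 1 ≤ K := by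
    have : (1:ℝ) ≤ K := by linarith
    exact_mod_cast this
  obtain ⟨C, D, hC, hD, h⟩ := int_bound K hK
  refine ⟨(1 + C) * 4 ^ D, D, by positivity, hD, 3, ?_⟩
  intro q _ hq3 hRH y hy hyq
  have hI := h q hq3 hRH y hy hyq
  have hq3r : (3:ℝ) ≤ q := by exact_mod_cast hq3
  have hq0 : (0:ℝ) < q := by linarith
  have hy0 : 0 < y := by linarith
  have hl2 : Real.log 2 ≤ Real.log (2 * y) := Real.log_le_log (by norm_num) (by linarith)
  have hl := Real.log_two_gt_d9
  set M := (q:ℝ) / y with hM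
  have hM0 : 0 < M := by positivity
  set T := (Finset.univ : Finset (DirichletCharacter ℂ q)).filter (fun χ => χ.IsPrimitive) with hT
  set S : DirichletCharacter ℂ q → ℝ := fun χ => ‖∑ n ∈ Icc 1 ⌊M⌋₊, χ (n : ZMod q)‖ with hS
  have hS0 : ∀ χ, 0 ≤ S χ := fun χ => norm_nonneg _
  have hpt : ∀ χ, S χ ^ (2 * k) ≤ M ^ k * (1 + S χ ^ (2 * K) / M ^ K) := by
    intro χ
    set t := S χ ^ 2 / M with ht
    have ht0 : 0 ≤ t := by positivity
    have e1 : S χ ^ (2 * k) = M ^ k * t ^ k := by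
      rw [← Real.mul_rpow hM0.le ht0, ht, mul_div_cancel₀ _ hM0.ne', Real.rpow_mul (hS0 χ)]
      norm_num
    have e2 : S χ ^ (2 * K) / M ^ K = t ^ K := by rw [pow_mul, ht, div_pow (S χ ^ 2) M K]
    rw [e1, e2]
    gcongr
    rcases le_total t 1 with h1 | h1
    · have := Real.rpow_le_one ht0 h1 (by linarith : 0 ≤ k)
      have := pow_nonneg ht0 K
      linarith
    · have : t ^ k ≤ t ^ (K:ℝ) := Real.rpow_le_rpow_of_exponent_le h1 hkK
      rw [Real.rpow_natCast] at this
      linarith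
  have hcard : (T.card : ℝ) ≤ q.totient := by
    have h1 : T.card ≤ Fintype.card (DirichletCharacter ℂ q) := Finset.card_le_univ T
    have h2 := DirichletCharacter.card_eq_totient_of_hasEnoughRootsOfUnity ℂ q
    rw [Nat.card_eq_fintype_card] at h2
    rw [h2] at h1
    exact_mod_cast h1
  have hL : 1 ≤ (1 + 2 * Real.log (2 * y)) ^ D := Real.one_le_rpow (by linarith) hD.le
  have hL4 : (1 + 2 * Real.log (2 * y)) ^ D ≤ 4 ^ D * Real.log (2 * y) ^ D := by
    rw [← Real.mul_rpow (by norm_num) (by linarith)]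
    apply Real.rpow_le_rpow (by linarith) (by linarith) hD.le
  have hMK : 0 < M ^ K := by positivity
  have hMk : 0 < M ^ k := by positivity
  have hdiv : (∑ χ ∈ T, S χ ^ (2 * K)) / M ^ K ≤ C * q.totient * (1 + 2 * Real.log (2 * y)) ^ D := by
    rw [div_le_iff₀ hMK]
    refine le_trans hI (le_of_eq ?_)
    ring
  calc ∑ χ ∈ T, S χ ^ (2 * k) ≤ ∑ χ ∈ T, M ^ k * (1 + S χ ^ (2 * K) / M ^ K) := Finset.sum_le_sum fun χ _ => hpt χ
    _ = M ^ k * (T.card + (∑ χ ∈ T, S χ ^ (2 * K)) / M ^ K) := by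
        rw [← Finset.mul_sum, Finset.sum_add_distrib, Finset.sum_div]; simp
    _ ≤ M ^ k * ((q.totient:ℝ) * (1 + 2 * Real.log (2 * y)) ^ D + C * q.totient * (1 + 2 * Real.log (2 * y)) ^ D) := by
        gcongr
        refine hcard.trans ?_
        exact le_mul_of_one_le_right (by positivity) hL
    _ = (1 + C) * q.totient * M ^ k * (1 + 2 * Real.log (2 * y)) ^ D := by ring
    _ ≤ (1 + C) * q.totient * M ^ k * (4 ^ D * Real.log (2 * y) ^ D) := by gcongr
    _ = _ := by ring
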